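/- arXiv:1612.02663 — 7 statements merged into one kernel-verified Lean document; each statement's English description precedes it below -/
import Mathlib

section
/- Let N be a positive integer, let n_1, …, n_N be positive integers, and let 𝓑 be a finite family of atomic bad-events for permutations π_k of [n_k], k = 1,…,N. Suppose there exist reals p ≥ 0 and an integer d ≥ 0 such that every B ∈ 𝓑 satisfies P_Ω(B) ≤ p and is dependent with at most d other bad-events (i.e. |{B' ∈ 𝓑 : B' ≠ B and B' ∼ B}| ≤ d), and suppose e·p·(d+1) ≤ 1. Then there exist permutations π_1, …, π_N (with π_k a permutation of [n_k]) such that no bad-event of 𝓑 holds. -/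
open scoped Classical

/-- The bad-event `B` (a set of triples `(k,x,y)`) holds for the tuple of
permutations `π` iff `π k x = y` for every `(k,x,y) ∈ B`. -/
def PermHolds {N : ℕ} {n : Fin N → ℕ} (π : ∀ k : Fin N, Equiv.Perm (Fin (n k)))
    (B : Finset (Σ k : Fin N, Fin (n k) × Fin (n k))) : Prop :=
  ∀ t ∈ B, π t.1 t.2.1 = t.2.2

/-- `B` is an atomic bad-event: no two of its triples share the same pair `(k,x)`,
and no two share the same pair `(k,y)`. -/
def PermAtomic {N : ℕ} {n : Fin N → ℕ}
    (B : Finset (Σ k : Fin N, Fin (n k) × Fin (n k))) : Prop :=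
  (∀ (k : Fin N) (x y y' : Fin (n k)),
      Sigma.mk k (x, y) ∈ B → Sigma.mk k (x, y') ∈ B → y = y') ∧
  (∀ (k : Fin N) (x x' y : Fin (n k)),
      Sigma.mk k (x, y) ∈ B → Sigma.mk k (x', y) ∈ B → x = x')

/-- The dependency relation `B ∼ B'`: some triples `(k,x,y) ∈ B`, `(k,x',y') ∈ B'`
share a domain or range element of the same permutation. -/
def PermRel {N : ℕ} {n : Fin N → ℕ}
    (B B' : Finset (Σ k : Fin N, Fin (n k) × Fin (n k))) : Prop :=
  ∃ (k : Fin N) (x y x' y' : Fin (n k)),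
    Sigma.mk k (x, y) ∈ B ∧ Sigma.mk k (x', y') ∈ B' ∧ (x = x' ∨ y = y')

/-- `P_Ω(B)`: the probability that `B` holds when the permutations `π k` are chosen
independently and uniformly at random. -/
noncomputable def POmega {N : ℕ} {n : Fin N → ℕ}
    (B : Finset (Σ k : Fin N, Fin (n k) × Fin (n k))) : ℝ :=
  (Nat.card {π : ∀ k : Fin N, Equiv.Perm (Fin (n k)) // PermHolds π B} : ℝ) /
    (Nat.card (∀ k : Fin N, Equiv.Perm (Fin (n k))) : ℝ)

/-- The outcomes at which no event indexed by `T` holds. -/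
noncomputable def avoiding {Ω ι : Type*} [Fintype Ω] (E : ι → Ω → Prop) (T : Finset ι) :
    Finset Ω :=
  Finset.univ.filter fun ω => ∀ C ∈ T, ¬ E C ω

section LopsidedLocalLemma

variable {Ω ι : Type*} [Fintype Ω] {E : ι → Ω → Prop}

lemma card_avoiding_insert (C : ι) (T : Finset ι) :
    ((avoiding E (insert C T)).card : ℝ) =
      (avoiding E T).card - ((avoiding E T).filter (E C)).card := by
  have h := Finset.card_filter_add_card_filter_not (s := avoiding E T) (E C)
  have h' : avoiding E (insert C T) = (avoiding E T).filter (fun ω => ¬ E C ω) := by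
    ext ω
    simp [avoiding, and_comm]
  rw [h', ← h]
  push_cast
  ring

lemma pow_mul_card_avoiding_le {x : ℝ} (hx : x ≤ 1) (T U : Finset ι)
    (h : ∀ C ∈ U, ∀ V ⊆ U, C ∉ V →
      (((avoiding E (T ∪ V)).filter (E C)).card : ℝ) ≤ x * (avoiding E (T ∪ V)).card) :
    (1 - x) ^ U.card * ((avoiding E T).card : ℝ) ≤ (avoiding E (T ∪ U)).card := by
  induction U using Finset.induction_on with
  | empty => simp
  | insert C U hC ih =>
    have ih' := ih fun D hD V hV => h D (Finset.mem_insert_of_mem hD) V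
      (hV.trans (Finset.subset_insert C U))
    have hb := h C (Finset.mem_insert_self C U) U (Finset.subset_insert C U) hC
    rw [Finset.union_insert, card_avoiding_insert, Finset.card_insert_of_notMem hC, pow_succ]
    nlinarith [mul_le_mul_of_nonneg_left ih' (sub_nonneg.2 hx)]

/-- The symmetric lopsided Lovász Local Lemma, in counting form. -/
theorem exists_avoiding_of_lopsided [Nonempty Ω] (R : ι → ι → Prop) (s : Finset ι)
    {p x : ℝ} {d : ℕ} (hx0 : 0 ≤ x) (hx1 : x < 1) (hpx : p ≤ x * (1 - x) ^ d)
    (hneg : ∀ B ∈ s, ∀ T ⊆ s, (∀ C ∈ T, ¬ R C B) →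
      (((avoiding E T).filter (E B)).card : ℝ) ≤ p * (avoiding E T).card)
    (hdeg : ∀ B ∈ s, (s.filter fun C => C ≠ B ∧ R C B).card ≤ d) :
    ∃ ω, ∀ B ∈ s, ¬ E B ω := by
  have key : ∀ m : ℕ, ∀ T ⊆ s, T.card = m → ∀ B ∈ s, B ∉ T →
      (((avoiding E T).filter (E B)).card : ℝ) ≤ x * (avoiding E T).card := by
    intro m
    induction m using Nat.strong_induction_on with
    | _ m ih =>
    intro T hT hm B hB hBT
    set T₁ := T.filter fun C => R C B
    set T₂ := T.filter fun C => ¬ R C B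
    have hU : T₂ ∪ T₁ = T := by
      rw [Finset.union_comm]; exact Finset.filter_union_filter_not_eq _ _
    have hT₁ : T₁.card ≤ d := by
      refine (Finset.card_le_card ?_).trans (hdeg B hB)
      intro C hC
      obtain ⟨hCT, hR⟩ := Finset.mem_filter.1 hC
      exact Finset.mem_filter.2 ⟨hT hCT, fun h => hBT (h ▸ hCT), hR⟩
    have hpow : (1 - x) ^ T₁.card * ((avoiding E T₂).card : ℝ) ≤ (avoiding E T).card := by
      have h := pow_mul_card_avoiding_le (E := E) hx1.le T₂ T₁ ?_
      · rwa [hU] at h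
      intro C hC V hV hCV
      have hsub : T₂ ∪ V ⊆ T := hU ▸ Finset.union_subset_union_right hV
      have hC' : C ∉ T₂ ∪ V := by
        simp only [Finset.mem_union, not_or]
        exact ⟨fun h => (Finset.mem_filter.1 h).2 (Finset.mem_filter.1 hC).2, hCV⟩
      have hCT := (Finset.mem_filter.1 hC).1
      refine ih _ ?_ _ (hsub.trans hT) rfl C (hT hCT) hC'
      rw [← hm]
      exact Finset.card_lt_card ⟨hsub, fun h => hC' (h hCT)⟩
    have hmono : (((avoiding E T).filter (E B)).card : ℝ) ≤
        ((avoiding E T₂).filter (E B)).card := by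
      norm_cast
      refine Finset.card_le_card (Finset.filter_subset_filter _ ?_)
      intro ω hω
      simp only [avoiding, Finset.mem_filter, Finset.mem_univ, true_and] at hω ⊢
      exact fun C hC => hω C (Finset.mem_filter.1 hC).1
    have hbase := hneg B hB T₂ ((Finset.filter_subset _ _).trans hT)
      fun C hC => (Finset.mem_filter.1 hC).2
    calc (((avoiding E T).filter (E B)).card : ℝ)
        ≤ p * (avoiding E T₂).card := hmono.trans hbase
      _ ≤ x * (1 - x) ^ d * (avoiding E T₂).card := by gcongr
      _ ≤ x * ((1 - x) ^ T₁.card * (avoiding E T₂).card) := by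
          rw [mul_assoc]
          refine mul_le_mul_of_nonneg_left (mul_le_mul_of_nonneg_right ?_ (by positivity)) hx0
          exact pow_le_pow_of_le_one (by linarith) (by linarith) hT₁
      _ ≤ x * (avoiding E T).card := by gcongr
  have h := pow_mul_card_avoiding_le (E := E) hx1.le ∅ s fun C hC V hV hCV => by
    rw [Finset.empty_union]
    exact key _ V hV rfl C hC hCV
  rw [Finset.empty_union] at h
  have hpos : (0 : ℝ) < (avoiding E (∅ : Finset ι)).card := by
    simp [avoiding, Fintype.card_pos]
  have hs : (0 : ℝ) < (avoiding E s).card :=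
    lt_of_lt_of_le (mul_pos (pow_pos (by linarith) _) hpos) h
  obtain ⟨ω, hω⟩ := Finset.card_pos.1 (Nat.cast_pos.1 hs)
  exact ⟨ω, (Finset.mem_filter.1 hω).2⟩

end LopsidedLocalLemma

lemma exists_weight_of_exp_mul_le {p : ℝ} (hp : 0 ≤ p) {d : ℕ}
    (h : Real.exp 1 * p * (d + 1) ≤ 1) :
    ∃ x : ℝ, 0 ≤ x ∧ x < 1 ∧ p ≤ x * (1 - x) ^ d := by
  rcases Nat.eq_zero_or_pos d with rfl | hd
  · refine ⟨p, hp, ?_, by simp⟩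
    have := Real.add_one_lt_exp (x := 1) one_ne_zero
    simp only [Nat.cast_zero, zero_add, mul_one] at h
    nlinarith
  · have hd' : (0 : ℝ) < d := Nat.cast_pos.2 hd
    refine ⟨1 / (d + 1), by positivity, ?_, ?_⟩
    · rw [div_lt_one (by positivity)]; linarith
    · have hle : (1 + 1 / (d : ℝ)) ^ d ≤ Real.exp 1 := by
        calc (1 + 1 / (d : ℝ)) ^ d ≤ Real.exp (1 / d) ^ d := by
              gcongr
              linarith [Real.add_one_le_exp (1 / (d : ℝ))]
          _ = Real.exp 1 := by
              rw [← Real.exp_nat_mul]; congr 1; field_simp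
      have heq : 1 - 1 / ((d : ℝ) + 1) = (1 + 1 / (d : ℝ))⁻¹ := by
        field_simp; ring
      rw [heq, inv_pow, ← div_eq_mul_inv, le_div_iff₀ (by positivity),
        le_div_iff₀ (by positivity)]
      calc p * (1 + 1 / (d : ℝ)) ^ d * (d + 1) ≤ p * Real.exp 1 * (d + 1) := by gcongr
        _ ≤ 1 := by linarith

section Permutations

variable {N : ℕ} {n : Fin N → ℕ}

/-- Compose the `k`-th permutation with the transposition of `y` and `z`. -/
noncomputable def swapValues (k : Fin N) (y z : Fin (n k))
    (π : ∀ k : Fin N, Equiv.Perm (Fin (n k))) : ∀ k : Fin N, Equiv.Perm (Fin (n k)) :=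
  Function.update π k (Equiv.swap y z * π k)

lemma swapValues_same (k : Fin N) (y z : Fin (n k))
    (π : ∀ k : Fin N, Equiv.Perm (Fin (n k))) (x : Fin (n k)) :
    swapValues k y z π k x = Equiv.swap y z (π k x) := by
  simp [swapValues]

lemma swapValues_of_ne {k j : Fin N} (h : j ≠ k) (y z : Fin (n k))
    (π : ∀ k : Fin N, Equiv.Perm (Fin (n k))) :
    swapValues k y z π j = π j := by
  simp [swapValues, h]

lemma swapValues_injective (k : Fin N) (y z : Fin (n k)) :
    Function.Injective (swapValues k y z) := by
  intro π ρ h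
  funext j
  rcases eq_or_ne j k with rfl | hj
  · have := congrFun h j
    simpa [swapValues] using this
  · have := congrFun h j
    rwa [swapValues_of_ne hj, swapValues_of_ne hj] at this

lemma permHolds_swapValues {π : ∀ k : Fin N, Equiv.Perm (Fin (n k))}
    {B : Finset (Σ k : Fin N, Fin (n k) × Fin (n k))} (hB : PermHolds π B)
    {k : Fin N} {y z : Fin (n k)}
    (hy : ∀ x, Sigma.mk k (x, y) ∉ B) (hz : ∀ x, Sigma.mk k (x, z) ∉ B) :
    PermHolds (swapValues k y z π) B := by
  rintro ⟨j, a, b⟩ ht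
  have hj : π j a = b := hB _ ht
  rcases eq_or_ne j k with rfl | hjk
  · change swapValues j y z π j a = b
    rw [swapValues_same, hj]
    refine Equiv.swap_apply_of_ne_of_ne ?_ ?_
    · rintro rfl; exact hy _ ht
    · rintro rfl; exact hz _ ht
  · change swapValues k y z π j a = b
    rw [swapValues_of_ne hjk, hj]

/-- Exchanging the value of `π k` at `x` with another one cannot create an event that uses neither
the argument `x` nor the value `y`. -/
lemma permHolds_of_swapValues {π : ∀ k : Fin N, Equiv.Perm (Fin (n k))}
    {C : Finset (Σ k : Fin N, Fin (n k) × Fin (n k))} {k : Fin N} {x y z : Fin (n k)}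
    (hπ : π k x = y) (hC : PermHolds (swapValues k y z π) C)
    (hx : ∀ b, Sigma.mk k (x, b) ∉ C) (hy : ∀ a, Sigma.mk k (a, y) ∉ C) :
    PermHolds π C := by
  have hz : ∀ a, Sigma.mk k (a, z) ∉ C := by
    intro a ha
    have h : swapValues k y z π k a = z := hC _ ha
    have hxz : swapValues k y z π k x = z := by
      rw [swapValues_same, hπ, Equiv.swap_apply_left]
    obtain rfl := (swapValues k y z π k).injective (h.trans hxz.symm)
    exact hx _ ha
  have h := permHolds_swapValues hC hy hz
  convert h using 1
  funext j
  ext a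
  rcases eq_or_ne j k with rfl | hj
  · simp [swapValues_same]
  · simp [swapValues_of_ne hj]

/-- The outcomes at which `B` holds and no event of `T` does. -/
noncomputable def holdingAvoiding (T : Finset (Finset (Σ k : Fin N, Fin (n k) × Fin (n k))))
    (B : Finset (Σ k : Fin N, Fin (n k) × Fin (n k))) :
    Finset (∀ k : Fin N, Equiv.Perm (Fin (n k))) :=
  (avoiding (fun B π => PermHolds π B) T).filter fun π => PermHolds π B

lemma mem_holdingAvoiding {T : Finset (Finset (Σ k : Fin N, Fin (n k) × Fin (n k)))}
    {B : Finset (Σ k : Fin N, Fin (n k) × Fin (n k))}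
    {π : ∀ k : Fin N, Equiv.Perm (Fin (n k))} :
    π ∈ holdingAvoiding T B ↔ (∀ C ∈ T, ¬ PermHolds π C) ∧ PermHolds π B := by
  simp [holdingAvoiding, avoiding]

lemma permHolds_insert {t : Σ k : Fin N, Fin (n k) × Fin (n k)}
    {B : Finset (Σ k : Fin N, Fin (n k) × Fin (n k))}
    {π : ∀ k : Fin N, Equiv.Perm (Fin (n k))} :
    PermHolds π (insert t B) ↔ π t.1 t.2.1 = t.2.2 ∧ PermHolds π B := by
  simp only [PermHolds, Finset.forall_mem_insert]

/-- The values of the `k`-th permutation not prescribed by `B`. -/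
noncomputable def freeValues (k : Fin N) (B : Finset (Σ k : Fin N, Fin (n k) × Fin (n k))) :
    Finset (Fin (n k)) :=
  Finset.univ.filter fun z => ∀ a, Sigma.mk k (a, z) ∉ B

lemma card_holdingAvoiding_eq_sum (T : Finset (Finset (Σ k : Fin N, Fin (n k) × Fin (n k))))
    (B : Finset (Σ k : Fin N, Fin (n k) × Fin (n k))) (k : Fin N) (x : Fin (n k))
    (hx : ∀ b, Sigma.mk k (x, b) ∉ B) :
    (holdingAvoiding T B).card =
      ∑ z ∈ freeValues k B, ((holdingAvoiding T B).filter fun π => π k x = z).card := by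
  refine Finset.card_eq_sum_card_fiberwise fun π hπ => ?_
  simp only [freeValues, Finset.coe_filter, Finset.mem_univ, true_and, Set.mem_ofPred_eq]
  intro a ha
  have h : π k a = π k x := (mem_holdingAvoiding.1 hπ).2 _ ha
  obtain rfl := (π k).injective h
  exact hx _ ha

lemma card_mul_le_card_holdingAvoiding
    (T : Finset (Finset (Σ k : Fin N, Fin (n k) × Fin (n k))))
    (B : Finset (Σ k : Fin N, Fin (n k) × Fin (n k))) (k : Fin N) (x y : Fin (n k))
    (hx : ∀ b, Sigma.mk k (x, b) ∉ B) (hy : ∀ a, Sigma.mk k (a, y) ∉ B)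
    (hTx : ∀ C ∈ T, ∀ b, Sigma.mk k (x, b) ∉ C) (hTy : ∀ C ∈ T, ∀ a, Sigma.mk k (a, y) ∉ C) :
    (freeValues k B).card * (holdingAvoiding T (insert ⟨k, x, y⟩ B)).card ≤
      (holdingAvoiding T B).card := by
  rw [card_holdingAvoiding_eq_sum T B k x hx, ← smul_eq_mul]
  refine Finset.card_nsmul_le_sum _ _ _ fun z hz => ?_
  refine Finset.card_le_card_of_injOn (swapValues k y z) ?_ (swapValues_injective k y z).injOn
  intro π hπ
  obtain ⟨hT, hB⟩ := mem_holdingAvoiding.1 hπ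
  obtain ⟨hxy, hB⟩ := permHolds_insert.1 hB
  change π k x = y at hxy
  refine Finset.mem_coe.2 (Finset.mem_filter.2 ⟨mem_holdingAvoiding.2 ⟨fun C hC h => ?_, ?_⟩, ?_⟩)
  · exact hT C hC (permHolds_of_swapValues hxy h (hTx C hC) (hTy C hC))
  · exact permHolds_swapValues hB hy (Finset.mem_filter.1 hz).2
  · rw [swapValues_same, hxy, Equiv.swap_apply_left]

lemma card_holdingAvoiding_empty_le (B : Finset (Σ k : Fin N, Fin (n k) × Fin (n k)))
    (k : Fin N) (x y : Fin (n k))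
    (hx : ∀ b, Sigma.mk k (x, b) ∉ B) (hy : ∀ a, Sigma.mk k (a, y) ∉ B) :
    (holdingAvoiding ∅ B).card ≤
      (freeValues k B).card * (holdingAvoiding ∅ (insert ⟨k, x, y⟩ B)).card := by
  rw [card_holdingAvoiding_eq_sum ∅ B k x hx, ← smul_eq_mul]
  refine Finset.sum_le_card_nsmul _ _ _ fun z hz => ?_
  refine Finset.card_le_card_of_injOn (swapValues k y z) ?_ (swapValues_injective k y z).injOn
  intro π hπ
  obtain ⟨hB, hxz⟩ := Finset.mem_filter.1 hπ
  have hB := (mem_holdingAvoiding.1 hB).2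
  refine mem_holdingAvoiding.2 ⟨by simp, permHolds_insert.2 ⟨?_, ?_⟩⟩
  · change swapValues k y z π k x = y
    rw [swapValues_same, hxz, Equiv.swap_apply_right]
  · exact permHolds_swapValues hB hy (Finset.mem_filter.1 hz).2

/-- Negative dependence: conditioning on the failure of events unrelated to `B` does not make `B`
more likely. -/
lemma card_holdingAvoiding_mul_le (T : Finset (Finset (Σ k : Fin N, Fin (n k) × Fin (n k))))
    (B : Finset (Σ k : Fin N, Fin (n k) × Fin (n k))) (hB : PermAtomic B)
    (hT : ∀ C ∈ T, ¬ PermRel C B) :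
    (holdingAvoiding T B).card * (holdingAvoiding (n := n) ∅ ∅).card ≤
      (holdingAvoiding ∅ B).card * (holdingAvoiding T ∅).card := by
  induction B using Finset.induction_on with
  | empty => rw [mul_comm]
  | insert t B ht ih =>
    obtain ⟨k, x, y⟩ := t
    have hmem {u} (hu : u ∈ B) : u ∈ insert ⟨k, x, y⟩ B := Finset.mem_insert_of_mem hu
    have hself : Sigma.mk k (x, y) ∈ insert ⟨k, x, y⟩ B := Finset.mem_insert_self _ _
    have ih := ih ⟨fun k x y y' h h' => hB.1 k x y y' (hmem h) (hmem h'),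
        fun k x x' y h h' => hB.2 k x x' y (hmem h) (hmem h')⟩
      fun C hC ⟨k, x, y, x', y', h, h', he⟩ => hT C hC ⟨k, x, y, x', y', h, hmem h', he⟩
    have hx : ∀ b, Sigma.mk k (x, b) ∉ B := fun b hb => by
      obtain rfl := hB.1 k x b y (hmem hb) hself
      exact ht hb
    have hy : ∀ a, Sigma.mk k (a, y) ∉ B := fun a ha => by
      obtain rfl := hB.2 k a x y (hmem ha) hself
      exact ht ha
    have h₁ := card_mul_le_card_holdingAvoiding T B k x y hx hy
      (fun C hC b hb => hT C hC ⟨k, x, b, x, y, hb, hself, Or.inl rfl⟩)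
      (fun C hC a ha => hT C hC ⟨k, a, y, x, y, ha, hself, Or.inr rfl⟩)
    have h₂ := card_holdingAvoiding_empty_le B k x y hx hy
    rcases Nat.eq_zero_or_pos (holdingAvoiding ∅ B).card with h0 | hpos
    · have hz : (holdingAvoiding T (insert ⟨k, x, y⟩ B)).card = 0 := by
        rw [Finset.card_eq_zero] at h0 ⊢
        refine Finset.eq_empty_of_forall_notMem fun π hπ => ?_
        have : π ∈ holdingAvoiding ∅ B := mem_holdingAvoiding.2
          ⟨by simp, (permHolds_insert.1 (mem_holdingAvoiding.1 hπ).2).2⟩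
        simp [h0] at this
      simp [hz]
    · refine Nat.le_of_mul_le_mul_left ?_ hpos
      set A := (holdingAvoiding T (insert ⟨k, x, y⟩ B)).card
      set O := (holdingAvoiding ∅ (insert ⟨k, x, y⟩ B)).card
      calc (holdingAvoiding ∅ B).card * (A * (holdingAvoiding (n := n) ∅ ∅).card)
          ≤ ((freeValues k B).card * O) * (A * (holdingAvoiding (n := n) ∅ ∅).card) := by gcongr
        _ = O * (((freeValues k B).card * A) * (holdingAvoiding (n := n) ∅ ∅).card) := by ring
        _ ≤ O * ((holdingAvoiding T B).card * (holdingAvoiding (n := n) ∅ ∅).card) := by gcongr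
        _ ≤ O * ((holdingAvoiding ∅ B).card * (holdingAvoiding T ∅).card) := by gcongr
        _ = _ := by ring

lemma card_holdingAvoiding_le_POmega_mul
    (T : Finset (Finset (Σ k : Fin N, Fin (n k) × Fin (n k))))
    (B : Finset (Σ k : Fin N, Fin (n k) × Fin (n k))) (hB : PermAtomic B)
    (hT : ∀ C ∈ T, ¬ PermRel C B) :
    ((holdingAvoiding T B).card : ℝ) ≤
      POmega B * (avoiding (fun B π => PermHolds π B) T).card := by
  have h : ((holdingAvoiding T B).card : ℝ) * (holdingAvoiding (n := n) ∅ ∅).card ≤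
      (holdingAvoiding ∅ B).card * (holdingAvoiding T ∅).card :=
    mod_cast card_holdingAvoiding_mul_le T B hB hT
  have h₁ : holdingAvoiding T ∅ = avoiding (fun B π => PermHolds π B) T := by
    simp [holdingAvoiding, PermHolds]
  have h₂ : (holdingAvoiding (n := n) ∅ ∅).card =
      Nat.card (∀ k : Fin N, Equiv.Perm (Fin (n k))) := by
    rw [Nat.card_eq_fintype_card, ← Finset.card_univ]
    congr 1
    ext π
    simp [mem_holdingAvoiding, PermHolds]
  have h₃ : (holdingAvoiding ∅ B).card =
      Nat.card {π : ∀ k : Fin N, Equiv.Perm (Fin (n k)) // PermHolds π B} := by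
    rw [Nat.card_eq_fintype_card, Fintype.card_subtype]
    congr 1
    ext π
    simp [mem_holdingAvoiding]
  rw [h₁, h₂, h₃] at h
  rw [POmega, div_mul_eq_mul_div, le_div_iff₀ (Nat.cast_pos.2 Nat.card_pos)]
  exact h

end Permutations

/-- The symmetric Lovász Local Lemma for permutations: if every bad-event has
probability at most `p`, is dependent with at most `d` other bad-events, and
`e·p·(d+1) ≤ 1`, then there are permutations avoiding all the bad-events. -/
theorem permutation_lll_symmetric {N : ℕ} (hN : 0 < N) (n : Fin N → ℕ) (hn : ∀ k, 0 < n k)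
    (𝓑 : Finset (Finset (Σ k : Fin N, Fin (n k) × Fin (n k))))
    (hatom : ∀ B ∈ 𝓑, PermAtomic B)
    (p : ℝ) (hp : 0 ≤ p) (d : ℕ)
    (hprob : ∀ B ∈ 𝓑, POmega B ≤ p)
    (hdeg : ∀ B ∈ 𝓑, (𝓑.filter (fun B' => B' ≠ B ∧ PermRel B' B)).card ≤ d)
    (hcrit : Real.exp 1 * p * (d + 1) ≤ 1) :
    ∃ π : ∀ k : Fin N, Equiv.Perm (Fin (n k)), ∀ B ∈ 𝓑, ¬ PermHolds π B := by
  obtain ⟨x, hx0, hx1, hpx⟩ := exists_weight_of_exp_mul_le hp hcrit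
  refine exists_avoiding_of_lopsided (E := fun B π => PermHolds π B) PermRel 𝓑 hx0 hx1 hpx
    (fun B hB T _ hT => ?_) fun B hB => ?_
  · refine (card_holdingAvoiding_le_POmega_mul T B (hatom B hB) hT).trans ?_
    exact mul_le_mul_of_nonneg_right (hprob B hB) (Nat.cast_nonneg _)
  · convert hdeg B hB
end

section
/- Let n be a positive integer and let A be an n × n matrix with entries from a set C of colors. Suppose every color c ∈ C appears at most (27/256)·n times among the entries of A. Then A has a Latin transversal: there exists a permutation π of [n] such that for all i ≠ i' in [n], A(i, π(i)) ≠ A(i', π(i')). -/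
open Finset in
/-- If `F` is stable under replacing the value `j` at `i` by any `b ∈ B` through a transposition,
then the permutations in `F` with `π i = j` make up at most a `1 / #B` fraction of `F`. -/
theorem card_mul_card_filter_apply_eq_le {α : Type*} [Fintype α] [DecidableEq α]
    (F : Finset (Equiv.Perm α)) (i j : α) (B : Finset α)
    (hF : ∀ π ∈ F, π i = j → ∀ b ∈ B, Equiv.swap j b * π ∈ F) :
    #B * #{π ∈ F | π i = j} ≤ #F := by
  calc #B * #{π ∈ F | π i = j} = ∑ _b ∈ B, #{π ∈ F | π i = j} := by simp
    _ ≤ ∑ b ∈ B, #{π ∈ F | π i = b} := by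
        refine sum_le_sum fun b hb => ?_
        refine card_le_card_of_injOn (fun π => Equiv.swap j b * π) ?_
          (fun π _ σ _ h => mul_left_cancel h)
        intro π hπ
        simp only [coe_filter, Set.mem_ofPred_eq] at hπ ⊢
        exact ⟨hF π hπ.1 hπ.2 b hb, by simp [hπ.2]⟩
    _ ≤ #F := by
        rw [← card_biUnion]
        · refine card_le_card fun π hπ => ?_
          simp only [mem_biUnion, mem_filter] at hπ
          obtain ⟨_, _, h, _⟩ := hπ
          exact h
        · intro b _ c _ hbc
          rw [Function.onFun, disjoint_left]
          intro π h h'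
          exact hbc ((mem_filter.1 h).2.symm.trans (mem_filter.1 h').2)

open scoped Classical in
/-- The permutations whose cells avoiding the rows (`Sum.inl`) and columns (`Sum.inr`) in `Z`
have pairwise distinct colors. -/
noncomputable def rainbowOff {α C : Type*} [Fintype α] (A : α → α → C) (Z : Finset (α ⊕ α)) :
    Finset (Equiv.Perm α) :=
  {π | ∀ r r', r ≠ r' → Sum.inl r ∉ Z → Sum.inl r' ∉ Z → Sum.inr (π r) ∉ Z →
    Sum.inr (π r') ∉ Z → A r (π r) ≠ A r' (π r')}

section RainbowOff

open Finset
open scoped Classical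

variable {α C : Type*} [Fintype α] {A : α → α → C} {Z W : Finset (α ⊕ α)}

theorem mem_rainbowOff {π : Equiv.Perm α} : π ∈ rainbowOff A Z ↔
    ∀ r r', r ≠ r' → Sum.inl r ∉ Z → Sum.inl r' ∉ Z → Sum.inr (π r) ∉ Z →
      Sum.inr (π r') ∉ Z → A r (π r) ≠ A r' (π r') := by
  simp [rainbowOff]

theorem rainbowOff_mono (h : Z ⊆ W) : rainbowOff A Z ⊆ rainbowOff A W := by
  intro π hπ
  rw [mem_rainbowOff] at hπ ⊢
  exact fun r r' hr h1 h2 h3 h4 => hπ r r' hr (fun h' => h1 (h h')) (fun h' => h2 (h h'))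
    (fun h' => h3 (h h')) (fun h' => h4 (h h'))

theorem swap_mul_mem_rainbowOff {π : Equiv.Perm α} {i j : α} (hi : Sum.inl i ∈ Z)
    (hj : Sum.inr j ∈ Z) (hπ : π ∈ rainbowOff A Z) (hij : π i = j) (b : α) :
    Equiv.swap j b * π ∈ rainbowOff A Z := by
  have key : ∀ r, Sum.inl r ∉ Z → Sum.inr ((Equiv.swap j b * π) r) ∉ Z →
      (Equiv.swap j b * π) r = π r := by
    intro r hr hc
    rw [Equiv.Perm.mul_apply] at hc ⊢
    refine Equiv.swap_apply_of_ne_of_ne ?_ ?_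
    · intro h
      rw [← hij] at h
      exact hr (π.injective h ▸ hi)
    · intro h
      rw [h, Equiv.swap_apply_right] at hc
      exact hc hj
  rw [mem_rainbowOff] at hπ ⊢
  intro r r' hr h1 h2 h3 h4
  have e := key r h1 h3
  have e' := key r' h2 h4
  rw [e] at h3 ⊢
  rw [e'] at h4 ⊢
  exact hπ r r' hr h1 h2 h3 h4

/-- Given that a random permutation is rainbow off `Z`, it passes through two prescribed cells
inside `Z` with at most the unconditional probability. -/
theorem card_mul_card_filter_rainbowOff_le {i i' j j' : α} (hj : j ≠ j')
    (hiZ : Sum.inl i ∈ Z) (hiZ' : Sum.inl i' ∈ Z) (hjZ : Sum.inr j ∈ Z)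
    (hjZ' : Sum.inr j' ∈ Z) :
    Fintype.card α * ((Fintype.card α - 1) * #{π ∈ rainbowOff A Z | π i = j ∧ π i' = j'})
      ≤ #(rainbowOff A Z) := by
  have h1 := card_mul_card_filter_apply_eq_le (rainbowOff A Z) i j univ
    (fun π hπ h b _ => swap_mul_mem_rainbowOff hiZ hjZ hπ h b)
  have h2 := card_mul_card_filter_apply_eq_le {π ∈ rainbowOff A Z | π i = j} i' j'
    (univ.erase j) (fun π hπ h b hb => by
      rw [mem_filter] at hπ ⊢
      refine ⟨swap_mul_mem_rainbowOff hiZ' hjZ' hπ.1 h b, ?_⟩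
      rw [Equiv.Perm.mul_apply, hπ.2]
      exact Equiv.swap_apply_of_ne_of_ne hj (ne_of_mem_erase hb).symm)
  rw [filter_filter, card_erase_of_mem (mem_univ _), card_univ] at h2
  rw [card_univ] at h1
  exact (Nat.mul_le_mul_left _ h2).trans h1

theorem pow_mul_card_rainbowOff_union_le {c : ℝ} (hc : 0 ≤ c)
    (h : ∀ W, Z ⊆ W → ∀ u, c * #(rainbowOff A (insert u W)) ≤ #(rainbowOff A W))
    (T : Finset (α ⊕ α)) :
    c ^ #T * #(rainbowOff A (Z ∪ T)) ≤ #(rainbowOff A Z) := by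
  induction T using Finset.induction_on with
  | empty => simp
  | insert u T hu ih =>
    rw [card_insert_of_notMem hu, union_insert, pow_succ, mul_assoc]
    exact (mul_le_mul_of_nonneg_left (h _ subset_union_left u) (by positivity)).trans ih

/-- The pairs of equally colored cells in general position whose first cell lies on the
line `u`. -/
noncomputable def conflictsOn (A : α → α → C) (u : α ⊕ α) : Finset ((α × α) × (α × α)) :=
  {e | (Sum.inl e.1.1 = u ∨ Sum.inr e.1.2 = u) ∧ e.1.1 ≠ e.2.1 ∧ e.1.2 ≠ e.2.2 ∧
    A e.1.1 e.1.2 = A e.2.1 e.2.2}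

theorem card_line_le (u : α ⊕ α) :
    #{p : α × α | Sum.inl p.1 = u ∨ Sum.inr p.2 = u} ≤ Fintype.card α := by
  rw [← card_univ]
  rcases u with i | j
  · refine card_le_card_of_injOn Prod.snd (fun _ _ => mem_coe.2 (mem_univ _)) ?_
    rintro ⟨a, b⟩ h ⟨c, d⟩ h' e
    simp at h h' e
    simp [h, h', e]
  · refine card_le_card_of_injOn Prod.fst (fun _ _ => mem_coe.2 (mem_univ _)) ?_
    rintro ⟨a, b⟩ h ⟨c, d⟩ h' e
    simp at h h' e
    simp [h, h', e]

theorem card_conflictsOn_le {k : ℝ} (hk : ∀ c, (#{p : α × α | A p.1 p.2 = c} : ℝ) ≤ k)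
    (u : α ⊕ α) : (#(conflictsOn A u) : ℝ) ≤ Fintype.card α * (k - 1) := by
  rcases isEmpty_or_nonempty α with hα | ⟨⟨a⟩⟩
  · simp [conflictsOn]
  have hfib : ∀ p : α × α, (#(({q | A q.1 q.2 = A p.1 p.2} : Finset (α × α)).erase p) : ℝ)
      ≤ k - 1 := by
    intro p
    have hp : p ∈ ({q | A q.1 q.2 = A p.1 p.2} : Finset (α × α)) := by simp
    have h := card_erase_add_one hp
    have h' := hk (A p.1 p.2)
    rw [← h] at h'
    push_cast at h'
    linarith
  have hk1 : 0 ≤ k - 1 := (Nat.cast_nonneg _).trans (hfib (a, a))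
  have hsub : conflictsOn A u ⊆
      ({p : α × α | Sum.inl p.1 = u ∨ Sum.inr p.2 = u} : Finset (α × α)).biUnion
        fun p => (({q | A q.1 q.2 = A p.1 p.2} : Finset (α × α)).erase p).image (Prod.mk p) := by
    rintro ⟨p, q⟩ h
    simp only [conflictsOn, mem_filter, mem_univ, true_and] at h
    simp only [mem_biUnion, mem_image, mem_filter, mem_univ, true_and, mem_erase]
    exact ⟨p, h.1, q, ⟨fun e => h.2.1 (by rw [e]), h.2.2.2.symm⟩, rfl⟩
  calc (#(conflictsOn A u) : ℝ)
      ≤ ∑ p : α × α with Sum.inl p.1 = u ∨ Sum.inr p.2 = u,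
          (#(({q | A q.1 q.2 = A p.1 p.2} : Finset (α × α)).erase p) : ℝ) := by
        exact_mod_cast (card_le_card hsub).trans
          (card_biUnion_le.trans (sum_le_sum fun p _ => card_image_le))
    _ ≤ ∑ p : α × α with Sum.inl p.1 = u ∨ Sum.inr p.2 = u, (k - 1) :=
        sum_le_sum fun p _ => hfib p
    _ ≤ Fintype.card α * (k - 1) := by
        rw [sum_const, nsmul_eq_mul]
        exact mul_le_mul_of_nonneg_right (by exact_mod_cast card_line_le u) hk1

theorem rainbowOff_insert_subset (u : α ⊕ α) : rainbowOff A (insert u Z) ⊆ rainbowOff A Z ∪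
    (conflictsOn A u).biUnion
      fun e => {π ∈ rainbowOff A (insert u Z) | π e.1.1 = e.1.2 ∧ π e.2.1 = e.2.2} := by
  intro π hπ
  rw [mem_union, or_iff_not_imp_left]
  intro hZ
  have hex : ∃ r r', (Sum.inl r = u ∨ Sum.inr (π r) = u) ∧ r ≠ r' ∧
      A r (π r) = A r' (π r') := by
    by_contra! hno
    refine hZ (mem_rainbowOff.2 fun r r' hr h1 h2 h3 h4 hA => ?_)
    have hu : ¬(Sum.inl r = u ∨ Sum.inr (π r) = u) := fun h => hno r r' h hr hA
    have hu' : ¬(Sum.inl r' = u ∨ Sum.inr (π r') = u) := fun h => hno r' r h hr.symm hA.symm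
    push Not at hu hu'
    exact mem_rainbowOff.1 hπ r r' hr (by simp [hu, h1]) (by simp [hu', h2]) (by simp [hu, h3])
      (by simp [hu', h4]) hA
  obtain ⟨r, r', hu, hr, hA⟩ := hex
  refine mem_biUnion.2 ⟨((r, π r), (r', π r')), ?_, ?_⟩
  · simp [conflictsOn, hu, hr, hA]
  · simp [hπ]

/-- Releasing one line keeps at least three quarters of the permutations. -/
theorem three_quarters_mul_card_rainbowOff_insert_le
    (hA : ∀ c, (#{p : α × α | A p.1 p.2 = c} : ℝ) ≤ 27 / 256 * Fintype.card α)
    (hcard : 2 ≤ Fintype.card α) (Z : Finset (α ⊕ α)) :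
    ∀ u, (3 / 4 : ℝ) * #(rainbowOff A (insert u Z)) ≤ #(rainbowOff A Z) := by
  induction hk : #Zᶜ using Nat.strong_induction_on generalizing Z with
  | _ k ih =>
  intro u
  by_cases hu : u ∈ Z
  · rw [insert_eq_of_mem hu]
    have : (0 : ℝ) ≤ #(rainbowOff A Z) := Nat.cast_nonneg _
    linarith
  have hW : ∀ W, insert u Z ⊆ W → ∀ v,
      (3 / 4 : ℝ) * #(rainbowOff A (insert v W)) ≤ #(rainbowOff A W) := by
    intro W hZW
    refine ih _ ?_ W rfl
    rw [← hk]
    exact card_lt_card (compl_ssubset_compl.2 ((ssubset_insert hu).trans_subset hZW))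
  set n : ℝ := (Fintype.card α : ℝ) with hn
  have hn2 : 2 ≤ n := by rw [hn]; exact_mod_cast hcard
  set N : ℝ := (#(rainbowOff A (insert u Z)) : ℝ) with hN
  have hN0 : 0 ≤ N := Nat.cast_nonneg _
  have hpair : ∀ e ∈ conflictsOn A u, (#{π ∈ rainbowOff A (insert u Z) |
      π e.1.1 = e.1.2 ∧ π e.2.1 = e.2.2} : ℝ) ≤ 64 / 27 * N / (n * (n - 1)) := by
    rintro ⟨⟨i, j⟩, ⟨i', j'⟩⟩ he
    simp only [conflictsOn, mem_filter, mem_univ, true_and] at he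
    obtain ⟨hline, -, hj, -⟩ := he
    dsimp only
    set L : Finset (α ⊕ α) := {Sum.inl i, Sum.inr j, Sum.inl i', Sum.inr j'} with hL
    have huL : u ∈ L := by rcases hline with h | h <;> simp [hL, ← h]
    have hL4 : #L ≤ 4 := card_le_four
    have hT : #(L.erase u) ≤ 3 := by rw [card_erase_of_mem huL]; omega
    have hU : insert u Z ∪ L.erase u = insert u Z ∪ L := by
      ext v
      by_cases hv : v = u <;> simp [hv]
    have h1 := pow_mul_card_rainbowOff_union_le (by norm_num) hW (L.erase u)
    rw [hU] at h1
    have h2 : (27 / 64 : ℝ) * #(rainbowOff A (insert u Z ∪ L)) ≤ N := by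
      refine le_trans (mul_le_mul_of_nonneg_right ?_ (Nat.cast_nonneg _)) h1
      calc (27 / 64 : ℝ) = (3 / 4) ^ 3 := by norm_num
        _ ≤ (3 / 4) ^ #(L.erase u) := pow_le_pow_of_le_one (by norm_num) (by norm_num) hT
    have h3 := card_mul_card_filter_rainbowOff_le (A := A) (Z := insert u Z ∪ L) (i := i) (i' := i') hj
      (by simp [hL]) (by simp [hL]) (by simp [hL]) (by simp [hL])
    have h4 : #{π ∈ rainbowOff A (insert u Z) | π i = j ∧ π i' = j'} ≤
        #{π ∈ rainbowOff A (insert u Z ∪ L) | π i = j ∧ π i' = j'} :=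
      card_le_card (filter_subset_filter _ (rainbowOff_mono subset_union_left))
    have h5 : n * ((n - 1) * #{π ∈ rainbowOff A (insert u Z) | π i = j ∧ π i' = j'}) ≤
        #(rainbowOff A (insert u Z ∪ L)) := by
      have := (Nat.mul_le_mul_left (Fintype.card α)
        (Nat.mul_le_mul_left (Fintype.card α - 1) h4)).trans h3
      rw [← Nat.cast_le (α := ℝ)] at this
      rwa [Nat.cast_mul, Nat.cast_mul, Nat.cast_sub (by omega), Nat.cast_one] at this
    rw [le_div_iff₀ (mul_pos (by linarith) (by linarith))]
    linarith
  have hsum : N ≤ #(rainbowOff A Z) +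
      #(conflictsOn A u) * (64 / 27 * N / (n * (n - 1))) := by
    calc N ≤ #(rainbowOff A Z) + ∑ e ∈ conflictsOn A u,
          (#{π ∈ rainbowOff A (insert u Z) | π e.1.1 = e.1.2 ∧ π e.2.1 = e.2.2} : ℝ) := by
          rw [hN]
          exact_mod_cast (card_le_card (rainbowOff_insert_subset u)).trans
            ((card_union_le _ _).trans (Nat.add_le_add_left card_biUnion_le _))
      _ ≤ _ := by
          rw [← nsmul_eq_mul]
          gcongr
          exact sum_le_card_nsmul _ _ _ hpair
  have hconf := card_conflictsOn_le hA u
  have hbound : (#(conflictsOn A u) : ℝ) * (64 / 27 * N / (n * (n - 1))) ≤ N / 4 := by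
    have hpos : 0 < n * (n - 1) := mul_pos (by linarith) (by linarith)
    calc (#(conflictsOn A u) : ℝ) * (64 / 27 * N / (n * (n - 1)))
        ≤ (27 / 256 * (n * (n - 1))) * (64 / 27 * N / (n * (n - 1))) := by
          refine mul_le_mul_of_nonneg_right ?_ (by positivity)
          nlinarith
      _ = N / 4 := by
          have hne : n - 1 ≠ 0 := right_ne_zero_of_mul hpos.ne'
          field_simp
          ring
  linarith

theorem rainbowOff_empty_nonempty
    (hA : ∀ c, (#{p : α × α | A p.1 p.2 = c} : ℝ) ≤ 27 / 256 * Fintype.card α)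
    (hcard : 2 ≤ Fintype.card α) : (rainbowOff A ∅).Nonempty := by
  have h := pow_mul_card_rainbowOff_union_le (A := A) (Z := ∅) (by norm_num)
    (fun W _ => three_quarters_mul_card_rainbowOff_insert_le hA hcard W) univ
  have h1 : (1 : Equiv.Perm α) ∈ rainbowOff A (∅ ∪ univ) := by simp [mem_rainbowOff]
  have h2 : 0 < #(rainbowOff A (∅ ∪ univ)) := card_pos.2 ⟨1, h1⟩
  rw [← card_pos, ← Nat.cast_pos (α := ℝ)]
  exact lt_of_lt_of_le (by positivity) h

end RainbowOff

/-- If every color appears at most `(27/256)·n` times in the `n × n` matrix `A`,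
then `A` has a Latin transversal: a permutation `π` of `[n]` such that the entries
`A(i, π(i))` are pairwise distinct colors. -/
theorem latin_transversal_exists (n : ℕ) (hn : 0 < n) (C : Type*)
    (A : Fin n → Fin n → C)
    (hA : ∀ c : C, (Nat.card {p : Fin n × Fin n // A p.1 p.2 = c} : ℝ) ≤ (27 / 256 : ℝ) * n) :
    ∃ π : Equiv.Perm (Fin n), ∀ i i' : Fin n, i ≠ i' → A i (π i) ≠ A i' (π i') := by
  classical
  rcases Nat.lt_or_ge n 2 with h2 | h2
  · exact ⟨1, fun i i' h => absurd (Fin.ext (by omega)) h⟩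
  · obtain ⟨π, hπ⟩ := rainbowOff_empty_nonempty (A := A) (fun c => by
      have h := hA c
      rw [Nat.card_eq_fintype_card, Fintype.card_subtype] at h
      rw [Fintype.card_fin]
      convert h) (by simpa using h2)
    exact ⟨π, fun i i' h => mem_rainbowOff.1 hπ i i' h (by simp) (by simp) (by simp) (by simp)⟩
end

section
/- There exists a constant c > 0 with the following property. Let n and s be positive integers, let A be an n × n matrix with entries from a set C of colors, and suppose every color appears at most (s − c·√s)·n times among the entries of A. Then there exists a permutation π of [n] such that every color appears at most s times among the entries A(1, π(1)), …, A(n, π(n)); that is, for every color c' ∈ C, |{i ∈ [n] : A(i, π(i)) = c'}| ≤ s. -/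
/-- If the items meeting `F` and the constraints in `T` together are fewer than the cells of `F`,
there is a nonzero direction supported on `F` with zero sum over each item and orthogonal to every
constraint in `T`. -/
theorem exists_kernel_direction {J O K : Type*} [Fintype J] [Fintype O] [Fintype K]
    [DecidableEq J] [DecidableEq O] [DecidableEq K] (a : K → J → O → ℝ) (F : Finset (J × O))
    (T : Finset K) (hcard : (F.image Prod.fst).card + T.card < F.card) :
    ∃ y : J → O → ℝ, (∃ j o, y j o ≠ 0) ∧ (∀ j o, (j, o) ∉ F → y j o = 0) ∧
      (∀ j, ∑ o, y j o = 0) ∧ ∀ k ∈ T, ∑ j, ∑ o, y j o * a k j o = 0 := by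
  classical
  let extend : (F → ℝ) →ₗ[ℝ] (J → O → ℝ) :=
    { toFun := fun z j o => if h : (j, o) ∈ F then z ⟨(j, o), h⟩ else 0
      map_add' := by intro z w; ext j o; by_cases h : (j, o) ∈ F <;> simp [h]
      map_smul' := by intro r z; ext j o; by_cases h : (j, o) ∈ F <;> simp [h] }
  let L : (F → ℝ) →ₗ[ℝ] ((F.image Prod.fst → ℝ) × (T → ℝ)) :=
    { toFun := fun z => (fun j => ∑ o, extend z j.1 o, fun k => ∑ j, ∑ o, extend z j o * a k j o)
      map_add' := by
        intro z w; ext i <;> simp [add_mul, Finset.sum_add_distrib]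
      map_smul' := by
        intro r z; ext i <;> simp [Finset.mul_sum, mul_assoc] }
  have hker : LinearMap.ker L ≠ ⊥ := by
    apply LinearMap.ker_ne_bot_of_finrank_lt
    simpa only [Module.finrank_prod, Module.finrank_fintype_fun_eq_card, Fintype.card_coe]
      using hcard
  obtain ⟨z, hz, hz0⟩ := (Submodule.ne_bot_iff _).1 hker
  rw [LinearMap.mem_ker] at hz
  have h1 : ∀ j : F.image Prod.fst, ∑ o, extend z j.1 o = 0 := fun j =>
    congrFun (congrArg Prod.fst hz) j
  have h2 : ∀ k : T, ∑ j, ∑ o, extend z j o * a k j o = 0 := fun k =>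
    congrFun (congrArg Prod.snd hz) k
  have hoff : ∀ j o, (j, o) ∉ F → extend z j o = 0 := by
    intro j o h; simp [extend, h]
  refine ⟨extend z, ?_, hoff, ?_, fun k hk => h2 ⟨k, hk⟩⟩
  · by_contra! hcon
    apply hz0
    ext p
    have := hcon p.1.1 p.1.2
    simpa [extend] using this
  · intro j
    by_cases hj : j ∈ F.image Prod.fst
    · exact h1 ⟨j, hj⟩
    · apply Finset.sum_eq_zero
      intro o _
      apply hoff
      intro h
      exact hj (Finset.mem_image_of_mem Prod.fst h)

/-- Moving a nonnegative `x` along a nonzero direction `y` with zero item sums, until the first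
coordinate vanishes. -/
theorem exists_step_to_boundary {J O : Type*} [Fintype J] [Fintype O] (x y : J → O → ℝ)
    (hx : ∀ j o, 0 ≤ x j o) (hxy : ∀ j o, x j o = 0 → y j o = 0) (hy : ∃ j o, y j o ≠ 0)
    (hsum : ∀ j, ∑ o, y j o = 0) :
    ∃ t : ℝ, (∀ j o, 0 ≤ x j o + t * y j o) ∧ ∃ j o, x j o ≠ 0 ∧ x j o + t * y j o = 0 := by
  classical
  obtain ⟨j₀, o₀, h₀⟩ := hy
  have hneg : ∃ o, y j₀ o < 0 := by
    by_contra! hcon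
    exact h₀ ((Finset.sum_eq_zero_iff_of_nonneg fun o _ => hcon o).1 (hsum j₀) o₀
      (Finset.mem_univ _))
  obtain ⟨o₁, h₁⟩ := hneg
  let N : Finset (J × O) := Finset.univ.filter fun p => y p.1 p.2 < 0
  obtain ⟨p, hp, hmin⟩ := N.exists_min_image (fun p => x p.1 p.2 / -y p.1 p.2)
    ⟨(j₀, o₁), by simpa [N] using h₁⟩
  have hpn : y p.1 p.2 < 0 := by simpa [N] using hp
  have ht : 0 ≤ x p.1 p.2 / -y p.1 p.2 := div_nonneg (hx _ _) (by linarith)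
  refine ⟨x p.1 p.2 / -y p.1 p.2, fun j o => ?_, p.1, p.2, fun h => ?_, ?_⟩
  · rcases lt_or_ge (y j o) 0 with h | h
    · have := hmin (j, o) (by simpa [N] using h)
      rw [le_div_iff₀ (by simpa using h)] at this
      dsimp only at this
      linarith
    · have := mul_nonneg ht h
      linarith [hx j o]
  · exact hpn.ne (hxy _ _ h)
  · have : y p.1 p.2 ≠ 0 := hpn.ne
    field_simp
    ring

theorem abs_sub_le_of_mem_unit {u v : ℝ} (hu : 0 ≤ u) (hu1 : u ≤ 1) (hv : 0 ≤ v) (hv1 : v ≤ 1) :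
    |u - v| ≤ 1 := by
  rw [abs_le]; constructor <;> linarith

/-- Beck-Fiala rounding of fractional choices: every item `j` picks an option, and each linear
constraint is exceeded by at most `2`, provided each variable has total weight at most `1`. -/
theorem exists_rounding {J O K : Type*} [Fintype J] [Fintype O] [Fintype K]
    (a : K → J → O → ℝ) (ha : ∀ j o, ∑ k, |a k j o| ≤ 1) (x : J → O → ℝ)
    (hx : ∀ j o, 0 ≤ x j o) (hx1 : ∀ j, ∑ o, x j o = 1) :
    ∃ f : J → O, (∀ j, x j (f j) ≠ 0) ∧
      ∀ k, ∑ j, a k j (f j) ≤ ∑ j, ∑ o, x j o * a k j o + 2 := by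
  classical
  induction hn : (Finset.univ.filter fun p : J × O => x p.1 p.2 ≠ 0).card using
    Nat.strong_induction_on generalizing x with
  | _ n ih =>
  have hle : ∀ j o, x j o ≤ 1 := fun j o => by
    rw [← hx1 j]
    exact Finset.single_le_sum (fun o _ => hx j o) (Finset.mem_univ o)
  let F : Finset (J × O) := Finset.univ.filter fun p => x p.1 p.2 ≠ 0 ∧ x p.1 p.2 ≠ 1
  let T : Finset K := Finset.univ.filter fun k => 2 < ∑ p ∈ F, |a k p.1 p.2|
  -- a choice inside the support of `x` respects every constraint with small fractional weight
  have hdead : ∀ f : J → O, (∀ j, x j (f j) ≠ 0) → ∀ k, k ∉ T →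
      ∑ j, a k j (f j) ≤ ∑ j, ∑ o, x j o * a k j o + 2 := by
    intro f hf k hk
    have hk' : ∑ p ∈ F, |a k p.1 p.2| ≤ 2 := by simpa [T] using hk
    have hind : ∀ j, a k j (f j) = ∑ o, (if o = f j then 1 else 0) * a k j o := by
      intro j; simp
    have hdiff : ∑ j, a k j (f j) - ∑ j, ∑ o, x j o * a k j o
        = ∑ p : J × O, ((if p.2 = f p.1 then 1 else 0) - x p.1 p.2) * a k p.1 p.2 := by
      rw [Fintype.sum_prod_type, ← Finset.sum_sub_distrib]
      refine Finset.sum_congr rfl fun j _ => ?_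
      rw [hind, ← Finset.sum_sub_distrib]
      exact Finset.sum_congr rfl fun o _ => by ring
    have hF : ∑ p : J × O, ((if p.2 = f p.1 then 1 else 0) - x p.1 p.2) * a k p.1 p.2
        = ∑ p ∈ F, ((if p.2 = f p.1 then 1 else 0) - x p.1 p.2) * a k p.1 p.2 := by
      symm
      apply Finset.sum_subset (Finset.subset_univ _)
      rintro ⟨j, o⟩ _ hp
      have : x j o = 0 ∨ x j o = 1 := by
        by_contra! hcon
        exact hp (by simpa [F] using hcon)
      rcases this with h | h
      · have : o ≠ f j := fun e => hf j (e ▸ h)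
        simp [h, this]
      · have : o = f j := by
          by_contra hne
          have h2 : x j o + x j (f j) ≤ 1 := by
            rw [← hx1 j, ← Finset.sum_pair hne]
            exact Finset.sum_le_sum_of_subset_of_nonneg (Finset.subset_univ _)
              fun i _ _ => hx j i
          exact hf j (le_antisymm (by linarith) (hx _ _))
        simp [h, this.symm]
    have hbd : ∑ p ∈ F, ((if p.2 = f p.1 then 1 else 0) - x p.1 p.2) * a k p.1 p.2
        ≤ ∑ p ∈ F, |a k p.1 p.2| := by
      refine Finset.sum_le_sum fun p _ => (le_abs_self _).trans ?_
      rw [abs_mul]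
      refine mul_le_of_le_one_left (abs_nonneg _) ?_
      refine abs_sub_le_of_mem_unit ?_ ?_ (hx _ _) (hle _ _) <;> split_ifs <;> norm_num
    linarith
  rcases F.eq_empty_or_nonempty with hF | hF
  · have hex : ∀ j, ∃ o, x j o ≠ 0 := by
      intro j
      by_contra! hcon
      simpa [hcon] using hx1 j
    choose f hf using hex
    refine ⟨f, hf, fun k => hdead f hf k ?_⟩
    have h2 : ¬ (2 : ℝ) < 0 := by norm_num
    simp [T, hF, h2]
  · have hitems : 2 * (F.image Prod.fst).card ≤ F.card := by
      have := Finset.mul_card_image_le_card (f := Prod.fst) (s := F) (n := 2) ?_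
      · exact this
      intro j hj
      obtain ⟨⟨j', o⟩, hp, rfl⟩ := Finset.mem_image.1 hj
      have hp' : x j' o ≠ 0 ∧ x j' o ≠ 1 := by simpa [F] using hp
      have : ∃ o', o' ≠ o ∧ x j' o' ≠ 0 := by
        by_contra! hcon
        apply hp'.2
        rw [← hx1 j']
        exact (Finset.sum_eq_single o (fun b _ hb => hcon b hb) (by simp)).symm
      obtain ⟨o', hne, ho'⟩ := this
      have ho1 : x j' o' ≠ 1 := by
        intro h1
        have h2 : x j' o' + x j' o ≤ 1 := by
          rw [← hx1 j', ← Finset.sum_pair hne]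
          exact Finset.sum_le_sum_of_subset_of_nonneg (Finset.subset_univ _)
            fun i _ _ => hx j' i
        exact hp'.1 (le_antisymm (by linarith) (hx _ _))
      have : ({(j', o'), (j', o)} : Finset (J × O)).card = 2 :=
        Finset.card_pair (by simpa using hne)
      rw [← this]
      apply Finset.card_le_card
      intro q hq
      simp only [Finset.mem_insert, Finset.mem_singleton] at hq
      rcases hq with rfl | rfl <;> simp [F, ho', ho1, hp']
    have hT : (2 : ℝ) * T.card ≤ F.card := by
      calc (2 : ℝ) * T.card = ∑ k ∈ T, (2 : ℝ) := by simp [mul_comm]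
        _ ≤ ∑ k ∈ T, ∑ p ∈ F, |a k p.1 p.2| :=
          Finset.sum_le_sum fun k hk => by
            have : 2 < ∑ p ∈ F, |a k p.1 p.2| := by simpa [T] using hk
            exact this.le
        _ ≤ ∑ k, ∑ p ∈ F, |a k p.1 p.2| :=
          Finset.sum_le_sum_of_subset_of_nonneg (Finset.subset_univ _)
            fun k _ _ => Finset.sum_nonneg fun p _ => abs_nonneg _
        _ = ∑ p ∈ F, ∑ k, |a k p.1 p.2| := Finset.sum_comm
        _ ≤ ∑ p ∈ F, (1 : ℝ) := Finset.sum_le_sum fun p _ => ha _ _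
        _ = F.card := by simp
    have hTlt : T.Nonempty → (2 : ℝ) * T.card < F.card := by
      intro hTn
      calc (2 : ℝ) * T.card = ∑ k ∈ T, (2 : ℝ) := by simp [mul_comm]
        _ < ∑ k ∈ T, ∑ p ∈ F, |a k p.1 p.2| :=
          Finset.sum_lt_sum_of_nonempty hTn fun k hk => by simpa [T] using hk
        _ ≤ ∑ k, ∑ p ∈ F, |a k p.1 p.2| :=
          Finset.sum_le_sum_of_subset_of_nonneg (Finset.subset_univ _)
            fun k _ _ => Finset.sum_nonneg fun p _ => abs_nonneg _
        _ = ∑ p ∈ F, ∑ k, |a k p.1 p.2| := Finset.sum_comm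
        _ ≤ ∑ p ∈ F, (1 : ℝ) := Finset.sum_le_sum fun p _ => ha _ _
        _ = F.card := by simp
    have hcard : (F.image Prod.fst).card + T.card < F.card := by
      have hpos := hF.card_pos
      rcases T.eq_empty_or_nonempty with h | h
      · simp only [h, Finset.card_empty]; omega
      · have : 2 * T.card < F.card := by exact_mod_cast hTlt h
        omega
    obtain ⟨y, hy0, hyF, hysum, hyT⟩ := exists_kernel_direction a F T hcard
    have hxy : ∀ j o, x j o = 0 → y j o = 0 := fun j o h => hyF j o (by simp [F, h])
    obtain ⟨t, htnn, j₁, o₁, hne, hzero⟩ := exists_step_to_boundary x y hx hxy hy0 hysum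
    have hlt : (Finset.univ.filter fun p : J × O => x p.1 p.2 + t * y p.1 p.2 ≠ 0).card < n := by
      rw [← hn]
      apply Finset.card_lt_card
      rw [Finset.ssubset_iff_of_subset]
      · exact ⟨(j₁, o₁), by simpa using hne, by simpa using hzero⟩
      · intro p hp
        simp only [Finset.mem_filter, Finset.mem_univ, true_and] at hp ⊢
        exact fun h => hp (by simp [h, hxy _ _ h])
    obtain ⟨f, hf, hfk⟩ := ih _ hlt (fun j o => x j o + t * y j o) htnn
      (fun j => by rw [Finset.sum_add_distrib, ← Finset.mul_sum, hysum, hx1]; ring) rfl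
    have hfx : ∀ j, x j (f j) ≠ 0 := fun j h => hf j (by simp [h, hxy _ _ h])
    refine ⟨f, hfx, fun k => ?_⟩
    by_cases hk : k ∈ T
    · refine (hfk k).trans (le_of_eq ?_)
      have := hyT k hk
      simp only [add_mul, Finset.sum_add_distrib, mul_assoc, ← Finset.mul_sum, this]
      ring
    · exact hdead f hfx k hk

/-- The permutations containing both cells of the pair `b`. -/
def ContainsPair {α : Type*} (π : Equiv.Perm α) (b : (α × α) × (α × α)) : Prop :=
  π b.1.1 = b.1.2 ∧ π b.2.1 = b.2.2

/-- The cells in the two rows and two columns used by the pair `b`. -/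
def OnLines {α : Type*} (b : (α × α) × (α × α)) (p : α × α) : Prop :=
  p.1 = b.1.1 ∨ p.1 = b.2.1 ∨ p.2 = b.1.2 ∨ p.2 = b.2.2

open Classical in
/-- The permutations containing no pair of `S`. -/
noncomputable def permsAvoiding {α : Type*} [Fintype α] (S : Finset ((α × α) × (α × α))) :
    Finset (Equiv.Perm α) :=
  Finset.univ.filter fun π => ∀ b ∈ S, ¬ ContainsPair π b

theorem mem_permsAvoiding {α : Type*} [Fintype α] {S : Finset ((α × α) × (α × α))}
    {π : Equiv.Perm α} : π ∈ permsAvoiding S ↔ ∀ b ∈ S, ¬ ContainsPair π b := by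
  simp [permsAvoiding]

theorem exists_perm_moving_pair {α : Type*} [DecidableEq α] {j k u v : α} (hjk : j ≠ k)
    (huv : u ≠ v) : ∃ σ : Equiv.Perm α, σ j = u ∧ σ k = v ∧
      ∀ w, w ≠ j → w ≠ k → w ≠ u → w ≠ v → σ w = w := by
  refine ⟨(Equiv.swap j u).trans (Equiv.swap (Equiv.swap j u k) v), ?_, ?_, ?_⟩
  · simp only [Equiv.trans_apply, Equiv.swap_apply_left]
    apply Equiv.swap_apply_of_ne_of_ne _ huv
    intro h
    have : Equiv.swap j u j = Equiv.swap j u k := by simpa using h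
    exact hjk ((Equiv.swap j u).injective this)
  · simp
  · intro w h1 h2 h3 h4
    simp only [Equiv.trans_apply]
    rw [Equiv.swap_apply_of_ne_of_ne h1 h3]
    apply Equiv.swap_apply_of_ne_of_ne _ h4
    intro h
    have h5 : Equiv.swap j u w = k := by rw [h]; simp
    rw [Equiv.swap_apply_of_ne_of_ne h1 h3] at h5
    exact h2 h5

open Classical in
/-- Switching: conditioning on avoiding pairs off the lines of `b` does not make `b` likelier. -/
theorem card_containing_mul_le {α : Type*} [Fintype α] (S : Finset ((α × α) × (α × α)))
    (b : (α × α) × (α × α)) (hc : b.1.2 ≠ b.2.2)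
    (hS : ∀ q ∈ S, ¬ OnLines b q.1 ∧ ¬ OnLines b q.2) :
    ((permsAvoiding S).filter fun π => ContainsPair π b).card *
      (Fintype.card α * Fintype.card α - Fintype.card α) ≤ (permsAvoiding S).card := by
  have hσ : ∀ q : α × α, ∃ σ : Equiv.Perm α, q.1 ≠ q.2 → σ b.1.2 = q.1 ∧ σ b.2.2 = q.2 ∧
      ∀ w, w ≠ b.1.2 → w ≠ b.2.2 → w ≠ q.1 → w ≠ q.2 → σ w = w := by
    intro q
    by_cases h : q.1 = q.2
    · exact ⟨1, fun h' => absurd h h'⟩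
    · obtain ⟨σ, h'⟩ := exists_perm_moving_pair hc h
      exact ⟨σ, fun _ => h'⟩
  choose σ hσ using hσ
  have hoff : (Finset.univ.offDiag : Finset (α × α)).card
      = Fintype.card α * Fintype.card α - Fintype.card α := by
    rw [Finset.offDiag_card, Finset.card_univ]
  rw [← hoff, ← Finset.card_product]
  apply Finset.card_le_card_of_injOn fun p => p.1.trans (σ p.2)
  · rintro ⟨π, q⟩ hp
    simp only [Finset.coe_product, Set.mem_prod, Finset.mem_coe, Finset.mem_filter,
      mem_permsAvoiding, Finset.mem_offDiag, Finset.mem_univ, true_and] at hp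
    obtain ⟨⟨hav, hb1, hb2⟩, hq⟩ := hp
    obtain ⟨h1, h2, h3⟩ := hσ q hq
    have key : ∀ p : α × α, ¬ OnLines b p → σ q (π p.1) = p.2 → π p.1 = p.2 := by
      intro p hp hσp
      simp only [OnLines, not_or] at hp
      obtain ⟨n1, n2, n3, n4⟩ := hp
      have m1 : p.2 ≠ q.1 := fun h => n1 (by
        apply π.injective; rw [hb1]; apply (σ q).injective; rw [hσp, h, h1])
      have m2 : p.2 ≠ q.2 := fun h => n2 (by
        apply π.injective; rw [hb2]; apply (σ q).injective; rw [hσp, h, h2])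
      apply (σ q).injective
      rw [hσp, h3 _ n3 n4 m1 m2]
    rw [Finset.mem_coe, mem_permsAvoiding]
    rintro p hp ⟨c1, c2⟩
    exact hav p hp ⟨key _ (hS p hp).1 c1, key _ (hS p hp).2 c2⟩
  · rintro ⟨π, q⟩ hp ⟨π', q'⟩ hp' heq
    simp only [Finset.coe_product, Set.mem_prod, Finset.mem_coe, Finset.mem_filter,
      mem_permsAvoiding, Finset.mem_offDiag, Finset.mem_univ, true_and] at hp hp'
    obtain ⟨⟨-, hb1, hb2⟩, hq⟩ := hp
    obtain ⟨⟨-, hb1', hb2'⟩, hq'⟩ := hp'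
    obtain ⟨h1, h2, -⟩ := hσ q hq
    obtain ⟨h1', h2', -⟩ := hσ q' hq'
    have e1 := congrArg (fun τ : Equiv.Perm α => τ b.1.1) heq
    have e2 := congrArg (fun τ : Equiv.Perm α => τ b.2.1) heq
    simp only [Equiv.trans_apply, hb1, hb1', hb2, hb2', h1, h1', h2, h2'] at e1 e2
    have hqq : q = q' := Prod.ext e1 e2
    subst hqq
    have : π = π' := by
      ext i
      have := congrArg (fun τ : Equiv.Perm α => τ i) heq
      simpa using this
    rw [this]

open Classical in
theorem card_onLines_le {α : Type*} [Fintype α] (b : (α × α) × (α × α)) :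
    (Finset.univ.filter (OnLines b)).card ≤ 4 * Fintype.card α := by
  have hrow : ∀ i : α, (Finset.univ.filter fun p : α × α => p.1 = i).card ≤ Fintype.card α := by
    intro i
    rw [← Finset.card_univ]
    apply Finset.card_le_card_of_injOn Prod.snd (fun _ _ => Finset.mem_univ _)
    intro p hp q hq h
    simp only [Finset.coe_filter, Finset.mem_univ, true_and, Set.mem_ofPred_eq] at hp hq
    exact Prod.ext (hp.trans hq.symm) h
  have hcol : ∀ i : α, (Finset.univ.filter fun p : α × α => p.2 = i).card ≤ Fintype.card α := by
    intro i
    rw [← Finset.card_univ]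
    apply Finset.card_le_card_of_injOn Prod.fst (fun _ _ => Finset.mem_univ _)
    intro p hp q hq h
    simp only [Finset.coe_filter, Finset.mem_univ, true_and, Set.mem_ofPred_eq] at hp hq
    exact Prod.ext h (hp.trans hq.symm)
  have := hrow b.1.1
  have := hrow b.2.1
  have := hcol b.1.2
  have := hcol b.2.2
  have hsub : Finset.univ.filter (OnLines b) ⊆
      (Finset.univ.filter fun p => p.1 = b.1.1) ∪ ((Finset.univ.filter fun p => p.1 = b.2.1) ∪
        ((Finset.univ.filter fun p => p.2 = b.1.2) ∪
          (Finset.univ.filter fun p => p.2 = b.2.2))) := by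
    intro p
    simp [OnLines]
  refine (Finset.card_le_card hsub).trans ?_
  refine (Finset.card_union_le _ _).trans ?_
  refine (Nat.add_le_add_left (Finset.card_union_le _ _) _).trans ?_
  refine (Nat.add_le_add_left (Nat.add_le_add_left (Finset.card_union_le _ _) _) _).trans ?_
  omega

/-- Erdős-Spencer: if each color fills at most a `1/64` fraction of a row's worth of cells, there
is a permutation whose cells have pairwise distinct colors. -/
theorem exists_rainbow_perm {α C : Type*} [Fintype α] [DecidableEq C] (A : α × α → C)
    (hA : ∀ c, 64 * (Finset.univ.filter fun p => A p = c).card ≤ Fintype.card α) :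
    ∃ π : Equiv.Perm α, ∀ i i', A (i, π i) = A (i', π i') → i = i' := by
  classical
  rcases isEmpty_or_nonempty α with hα | hα
  · exact ⟨1, fun i => hα.elim i⟩
  set N := Fintype.card α with hN
  have hN64 : 64 ≤ N := by
    obtain ⟨i⟩ := hα
    have h1 : 0 < (Finset.univ.filter fun p => A p = A (i, i)).card :=
      Finset.card_pos.2 ⟨(i, i), by simp⟩
    have := hA (A (i, i))
    omega
  let B : Finset ((α × α) × (α × α)) :=
    Finset.univ.filter fun b => b.1.1 ≠ b.2.1 ∧ b.1.2 ≠ b.2.2 ∧ A b.1 = A b.2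
  have htouch : ∀ b, 8 * (B.filter fun q => OnLines b q.1 ∨ OnLines b q.2).card ≤ N * N := by
    intro b
    let E : Finset (α × α) := Finset.univ.filter (OnLines b)
    let P : Finset ((α × α) × (α × α)) := E.biUnion fun e =>
      (Finset.univ.filter fun p => A p = A e).image fun p => (e, p)
    have hP : 64 * P.card ≤ 4 * N * N := by
      have h1 : P.card ≤ ∑ e ∈ E, (Finset.univ.filter fun p => A p = A e).card :=
        Finset.card_biUnion_le.trans (Finset.sum_le_sum fun e _ => Finset.card_image_le)
      calc 64 * P.card ≤ 64 * ∑ e ∈ E, (Finset.univ.filter fun p => A p = A e).card := by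
            gcongr
        _ = ∑ e ∈ E, 64 * (Finset.univ.filter fun p => A p = A e).card := Finset.mul_sum _ _ _
        _ ≤ ∑ e ∈ E, N := Finset.sum_le_sum fun e _ => hA _
        _ = E.card * N := by simp
        _ ≤ 4 * N * N := Nat.mul_le_mul_right _ (card_onLines_le b)
    have hsub : (B.filter fun q => OnLines b q.1 ∨ OnLines b q.2) ⊆ P ∪ P.image Prod.swap := by
      rintro ⟨e, f⟩ hq
      simp only [B, Finset.mem_filter, Finset.mem_univ, true_and] at hq
      obtain ⟨⟨-, -, h⟩, h1 | h1⟩ := hq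
      · refine Finset.mem_union_left _ ?_
        simp [P, E, h1, h]
      · refine Finset.mem_union_right _ (Finset.mem_image.2 ⟨(f, e), ?_, rfl⟩)
        simp [P, E, h1, h]
    have h2 := (Finset.card_le_card hsub).trans (Finset.card_union_le _ _)
    have h3 : (P.image Prod.swap).card ≤ P.card := Finset.card_image_le
    nlinarith
  have hcond : ∀ S ⊆ B, ∀ b ∈ B,
      ((permsAvoiding S).filter fun π => ContainsPair π b).card * (N * N) ≤
        4 * (permsAvoiding S).card := by
    intro S
    induction hn : S.card using Nat.strong_induction_on generalizing S with
    | _ n ih =>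
    intro hSB b hb
    let S₁ := S.filter fun q => OnLines b q.1 ∨ OnLines b q.2
    let S₂ := S.filter fun q => ¬ (OnLines b q.1 ∨ OnLines b q.2)
    have hS₂ : S₂ ⊆ S := Finset.filter_subset _ _
    have hmono : permsAvoiding S ⊆ permsAvoiding S₂ := by
      intro π hπ
      rw [mem_permsAvoiding] at hπ ⊢
      exact fun q hq => hπ q (hS₂ hq)
    have hb' : b.1.1 ≠ b.2.1 ∧ b.1.2 ≠ b.2.2 ∧ A b.1 = A b.2 := by simpa [B] using hb
    have hsw := card_containing_mul_le S₂ b hb'.2.1 (fun q hq => by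
      have := (Finset.mem_filter.1 hq).2
      exact not_or.1 this)
    rw [← hN] at hsw
    have hle : ((permsAvoiding S).filter fun π => ContainsPair π b).card ≤
        ((permsAvoiding S₂).filter fun π => ContainsPair π b).card :=
      Finset.card_le_card (Finset.filter_subset_filter _ hmono)
    have hS₁ : 8 * S₁.card ≤ N * N :=
      (Nat.mul_le_mul_left 8 (Finset.card_le_card (Finset.filter_subset_filter _ hSB))).trans
        (htouch b)
    have hunion : permsAvoiding S₂ ⊆ permsAvoiding S ∪
        S₁.biUnion fun q => (permsAvoiding S₂).filter fun π => ContainsPair π q := by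
      intro π hπ
      by_cases h : π ∈ permsAvoiding S
      · exact Finset.mem_union_left _ h
      · rw [mem_permsAvoiding] at h
        push Not at h
        obtain ⟨q, hq, hc⟩ := h
        refine Finset.mem_union_right _ (Finset.mem_biUnion.2 ⟨q, ?_, ?_⟩)
        · refine Finset.mem_filter.2 ⟨hq, ?_⟩
          by_contra hno
          exact mem_permsAvoiding.1 hπ q (Finset.mem_filter.2 ⟨hq, hno⟩) hc
        · exact Finset.mem_filter.2 ⟨hπ, hc⟩
    have hcount : (permsAvoiding S₂).card ≤ (permsAvoiding S).card +
        ∑ q ∈ S₁, ((permsAvoiding S₂).filter fun π => ContainsPair π q).card :=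
      (Finset.card_le_card hunion).trans ((Finset.card_union_le _ _).trans
        (Nat.add_le_add_left Finset.card_biUnion_le _))
    have hsum : (∑ q ∈ S₁, ((permsAvoiding S₂).filter fun π => ContainsPair π q).card) * (N * N) ≤
        S₁.card * (4 * (permsAvoiding S₂).card) := by
      rw [Finset.sum_mul, ← smul_eq_mul S₁.card, ← Finset.sum_const]
      refine Finset.sum_le_sum fun q hq => ?_
      have hqS := Finset.mem_filter.1 hq
      refine ih S₂.card ?_ S₂ rfl (hS₂.trans hSB) q (hSB hqS.1)
      rw [← hn]
      apply Finset.card_lt_card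
      rw [Finset.ssubset_iff_of_subset hS₂]
      exact ⟨q, hqS.1, fun h => (Finset.mem_filter.1 h).2 hqS.2⟩
    have hNN : N * N ≤ 2 * (N * N - N) := by
      have : 2 * N ≤ N * N := Nat.mul_le_mul_right _ (by omega)
      omega
    set X := (permsAvoiding S₂).card
    set Y := (permsAvoiding S).card
    set Z := ∑ q ∈ S₁, ((permsAvoiding S₂).filter fun π => ContainsPair π q).card
    have hNpos : 0 < N * N := by positivity
    have hZ : 2 * Z ≤ X := by
      have : (2 * Z) * (N * N) ≤ X * (N * N) := by
        calc (2 * Z) * (N * N) ≤ 2 * (S₁.card * (4 * X)) := by linarith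
          _ = (8 * S₁.card) * X := by ring
          _ ≤ (N * N) * X := Nat.mul_le_mul_right _ hS₁
          _ = X * (N * N) := by ring
      exact Nat.le_of_mul_le_mul_right this hNpos
    have hX : X ≤ 2 * Y := by omega
    calc _ ≤ ((permsAvoiding S₂).filter fun π => ContainsPair π b).card * (2 * (N * N - N)) :=
          Nat.mul_le_mul hle hNN
      _ ≤ 2 * X := by linarith
      _ ≤ 4 * Y := by omega
  have hpos : ∀ S ⊆ B, 0 < (permsAvoiding S).card := by
    intro S
    induction S using Finset.induction_on with
    | empty =>
      intro _
      exact Finset.card_pos.2 ⟨1, by simp [mem_permsAvoiding]⟩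
    | insert b S hbS ih =>
      intro hsub
      have hSB : S ⊆ B := (Finset.subset_insert _ _).trans hsub
      have h1 := ih hSB
      have h2 := hcond S hSB b (hsub (Finset.mem_insert_self _ _))
      have hsplit : permsAvoiding S ⊆ permsAvoiding (insert b S) ∪
          (permsAvoiding S).filter fun π => ContainsPair π b := by
        intro π hπ
        by_cases h : ContainsPair π b
        · exact Finset.mem_union_right _ (Finset.mem_filter.2 ⟨hπ, h⟩)
        · refine Finset.mem_union_left _ (mem_permsAvoiding.2 fun q hq => ?_)
          rcases Finset.mem_insert.1 hq with rfl | hq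
          · exact h
          · exact mem_permsAvoiding.1 hπ q hq
      have h3 := (Finset.card_le_card hsplit).trans (Finset.card_union_le _ _)
      by_contra h4
      have h5 : (permsAvoiding (insert b S)).card = 0 := by omega
      have h6 : 64 * 64 ≤ N * N := Nat.mul_le_mul hN64 hN64
      rw [h5, zero_add] at h3
      have h7 := Nat.mul_le_mul h3 h6
      omega
  obtain ⟨π, hπ⟩ := Finset.card_pos.1 (hpos B subset_rfl)
  refine ⟨π, fun i i' h => ?_⟩
  by_contra hne
  refine mem_permsAvoiding.1 hπ ((i, π i), (i', π i')) ?_ ⟨rfl, rfl⟩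
  simp [B, hne, h]

/-- If each color fills at most `t` rows' worth of cells, some permutation has `O(t)` cells of each
color. -/
theorem exists_perm_card_color_le {α C : Type*} [Fintype α] [DecidableEq C] (A : α × α → C)
    (t : ℕ) (hA : ∀ c, (Finset.univ.filter fun p => A p = c).card ≤ t * Fintype.card α) :
    ∃ π : Equiv.Perm α, ∀ c,
      (Finset.univ.filter fun i => A (i, π i) = c).card ≤ 127 * t + 64 := by
  classical
  rcases lt_or_ge (Fintype.card α) 64 with hN | hN
  · exact ⟨1, fun c => by have := Finset.card_le_univ
                            (Finset.univ.filter fun i => A (i, (1 : Equiv.Perm α) i) = c); omega⟩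
  have hg : ∀ c : C, ∃ g : α × α → ℕ,
      Set.InjOn g {p | A p = c} ∧ ∀ p, A p = c → g p < t * Fintype.card α := by
    intro c
    let S := Finset.univ.filter fun p => A p = c
    have hS : ∀ {p}, p ∈ S ↔ A p = c := by intro p; simp [S]
    refine ⟨fun p => if h : p ∈ S then (S.equivFin ⟨p, h⟩ : ℕ) else 0, ?_, ?_⟩
    · intro p hp q hq h
      have hp' : p ∈ S := hS.2 hp
      have hq' : q ∈ S := hS.2 hq
      simp only [hp', hq', dif_pos] at h
      have := S.equivFin.injective (Fin.ext h)
      simpa using this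
    · intro p hp
      have hp' : p ∈ S := hS.2 hp
      simp only [hp', dif_pos]
      exact (S.equivFin ⟨p, hp'⟩).2.trans_le (hA c)
  choose g hinj hlt using hg
  let q := Fintype.card α / 64
  have hq : 0 < q := Nat.div_pos hN (by norm_num)
  obtain ⟨π, hπ⟩ := exists_rainbow_perm (fun p => (A p, g (A p) p / q)) (by
    rintro ⟨c, d⟩
    have : (Finset.univ.filter fun p => (A p, g (A p) p / q) = (c, d)).card ≤ q := by
      calc _ ≤ (Finset.Ico (d * q) (d * q + q)).card := by
            refine Finset.card_le_card_of_injOn (g c) ?_ ?_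
            · intro p hp
              simp only [Finset.coe_filter, Finset.mem_univ, true_and, Set.mem_ofPred_eq,
                Prod.mk.injEq] at hp
              obtain ⟨rfl, rfl⟩ := hp
              simp only [Finset.coe_Ico, Set.mem_Ico]
              exact ⟨Nat.div_mul_le_self _ _, Nat.lt_div_mul_add hq⟩
            · intro p hp p' hp' h
              simp only [Finset.coe_filter, Finset.mem_univ, true_and, Set.mem_ofPred_eq,
                Prod.mk.injEq] at hp hp'
              exact hinj c hp.1 hp'.1 h
        _ = q := by simp
    have h2 : q * 64 ≤ Fintype.card α := Nat.div_mul_le_self _ _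
    omega)
  refine ⟨π, fun c => ?_⟩
  calc _ ≤ (Finset.range (127 * t)).card := by
        refine Finset.card_le_card_of_injOn (fun i => g c (i, π i) / q) ?_ ?_
        · intro i hi
          simp only [Finset.coe_filter, Finset.mem_univ, true_and, Set.mem_ofPred_eq] at hi
          simp only [Finset.coe_range, Set.mem_Iio]
          rw [Nat.div_lt_iff_lt_mul hq]
          refine (hlt c _ hi).trans_le ?_
          have : Fintype.card α ≤ 127 * q := by omega
          calc t * Fintype.card α ≤ t * (127 * q) := Nat.mul_le_mul_left _ this
            _ = 127 * t * q := by ring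
        · intro i hi i' hi' h
          simp only [Finset.coe_filter, Finset.mem_univ, true_and, Set.mem_ofPred_eq] at hi hi'
          apply hπ
          simp only [hi, hi', Prod.mk.injEq, true_and]
          exact h
    _ ≤ 127 * t + 64 := by simp

/-- Completing a partial injection `φ`, defined on the columns satisfying `p`, to a bijection. -/
theorem exists_equiv_extending {J R C : Type*} [Fintype J] [Fintype R] [DecidableEq C]
    (hcard : Fintype.card J = Fintype.card R) (A : R → J → C) (p : J → Prop) [DecidablePred p]
    (φ : J → R) (hφ : ∀ j j', p j → p j' → φ j = φ j' → j = j') (W : Finset R)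
    (hW : ∀ r, r ∈ W ↔ ∀ j, p j → φ j ≠ r) (t : ℕ)
    (ht : ∀ c, ∑ r ∈ W, (Finset.univ.filter fun j => ¬ p j ∧ A r j = c).card ≤
      t * (Finset.univ.filter fun j => ¬ p j).card) :
    ∃ Ψ : J ≃ R, ∀ c, (Finset.univ.filter fun j => A (Ψ j) j = c).card ≤
      (Finset.univ.filter fun j => p j ∧ A (φ j) j = c).card + (127 * t + 64) := by
  classical
  let L := {j // ¬ p j}
  have hWcard : Fintype.card L = Fintype.card W := by
    have h1 : Wᶜ = (Finset.univ.filter p).image φ := by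
      ext r
      simp only [Finset.mem_compl, hW, Finset.mem_image, Finset.mem_filter, Finset.mem_univ,
        true_and]
      push Not
      rfl
    have h2 : (Wᶜ).card = (Finset.univ.filter p).card := by
      rw [h1, Finset.card_image_of_injOn]
      intro j hj j' hj' h
      exact hφ j j' (by simpa using hj) (by simpa using hj') h
    rw [Finset.card_compl] at h2
    have h3 : Fintype.card L = Fintype.card J - (Finset.univ.filter p).card := by
      rw [Fintype.card_subtype_compl, Fintype.card_subtype]
    rw [Fintype.card_coe]
    have h4 := W.card_le_univ
    have h5 := (Finset.univ.filter p).card_le_univ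
    omega
  let ε : L ≃ W := Fintype.equivOfCardEq hWcard
  obtain ⟨π, hπ⟩ := exists_perm_card_color_le (fun q : L × L => A (ε q.2) q.1.1) t (by
    intro c
    have hL : Fintype.card L = (Finset.univ.filter fun j => ¬ p j).card :=
      Fintype.card_subtype _
    rw [hL]
    refine le_trans ?_ (ht c)
    rw [← Finset.card_sigma]
    refine Finset.card_le_card_of_injOn (fun q => ⟨(ε q.2 : R), q.1.1⟩) ?_ ?_
    · intro q hq
      have hq' : A (ε q.2) q.1.1 = c := by simpa using hq
      simp [hq', q.1.2]
    · intro q _ q' _ h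
      simp only [Sigma.mk.injEq, heq_eq_eq] at h
      exact Prod.ext (Subtype.ext h.2) (ε.injective (Subtype.ext h.1)))
  let ψ : J → R := fun j => if h : p j then φ j else ε (π ⟨j, h⟩)
  have hψ : ∀ j, p j → ψ j = φ j := fun j h => by simp [ψ, h]
  have hψ' : ∀ j (h : ¬ p j), ψ j = ε (π ⟨j, h⟩) := fun j h => by simp [ψ, h]
  have hinj : Function.Injective ψ := by
    have hmix : ∀ j j', p j → ¬ p j' → ψ j ≠ ψ j' := by
      intro j j' h h' heq
      rw [hψ j h, hψ' j' h'] at heq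
      exact (hW _).1 (ε (π ⟨j', h'⟩)).2 j h heq
    intro j j' heq
    by_cases h : p j <;> by_cases h' : p j'
    · rw [hψ j h, hψ j' h'] at heq
      exact hφ j j' h h' heq
    · exact (hmix j j' h h' heq).elim
    · exact (hmix j' j h' h heq.symm).elim
    · rw [hψ' j h, hψ' j' h'] at heq
      have := π.injective (ε.injective (Subtype.ext heq))
      exact congrArg Subtype.val this
  refine ⟨Equiv.ofBijective ψ ((Fintype.bijective_iff_injective_and_card ψ).2 ⟨hinj, hcard⟩),
    fun c => ?_⟩
  simp only [Equiv.ofBijective_apply]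
  have hsub : (Finset.univ.filter fun j => A (ψ j) j = c) ⊆
      (Finset.univ.filter fun j => p j ∧ A (φ j) j = c) ∪
        (Finset.univ.filter fun l : L => A (ε (π l)) l.1 = c).image Subtype.val := by
    intro j hj
    have hj' : A (ψ j) j = c := by simpa using hj
    by_cases h : p j
    · refine Finset.mem_union_left _ ?_
      simpa [h, ← hψ j h] using hj'
    · refine Finset.mem_union_right _ (Finset.mem_image.2 ⟨⟨j, h⟩, ?_, rfl⟩)
      simpa [← hψ' j h] using hj'
  refine (Finset.card_le_card hsub).trans ((Finset.card_union_le _ _).trans ?_)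
  exact Nat.add_le_add_left (Finset.card_image_le.trans (hπ c)) _

/-- Distributing columns: each group of `m` rows receives slightly fewer than `m` columns, the
columns sent to `none` are held in reserve, and every color is distributed evenly. -/
theorem exists_column_distribution {Γ Z J C : Type*} [Fintype Γ] [Fintype Z] [Fintype J]
    [Fintype C] [DecidableEq Γ] [Nonempty Γ] (χ : C → Γ × Z → J → ℝ)
    (hχ : ∀ c r j, 0 ≤ χ c r j) (hχ1 : ∀ r j, ∑ c, χ c r j = 1) (m : ℕ) (hm : 9 ≤ m)
    (hZ : Fintype.card Z = m) (hJ : Fintype.card J = Fintype.card Γ * m) (σ : ℝ)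
    (hσ : ∀ c, ∑ r, ∑ j, χ c r j ≤ σ * (Fintype.card Γ * m)) :
    ∃ f : J → Option Γ,
      (∀ g, (Finset.univ.filter fun j => f j = some g).card + 1 ≤ m ∧
        m ≤ (Finset.univ.filter fun j => f j = some g).card + 17) ∧
      (∀ c, ∑ g, ∑ j with f j = some g, ∑ z, χ c (g, z) j ≤ m * (σ + 4)) ∧
      ∀ c, ∑ j with f j = none, ∑ r, χ c r j ≤
        9 * Fintype.card Γ * σ + 2 * (Fintype.card Γ * m) := by
  classical
  set G := Fintype.card Γ with hG
  have hGpos : (0 : ℝ) < G := by exact_mod_cast Fintype.card_pos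
  have hm9 : (9 : ℝ) ≤ m := by exact_mod_cast hm
  have hmpos : (0 : ℝ) < m := by linarith
  have hJ' : (Fintype.card J : ℝ) = G * m := by exact_mod_cast hJ
  have hnn : ∀ c, 0 ≤ ∑ r, ∑ j, χ c r j := fun c =>
    Finset.sum_nonneg fun r _ => Finset.sum_nonneg fun j _ => hχ c r j
  let w : J → Option Γ → ℝ := fun _ o => o.elim (9 / m) fun _ => (m - 9) / (G * m)
  let a : (Γ ⊕ Γ) ⊕ (C ⊕ C) → J → Option Γ → ℝ := fun k j o =>
    Sum.elim (Sum.elim (fun g => if o = some g then 1 / 4 else 0)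
        fun g => if o = some g then -(1 / 4) else 0)
      (Sum.elim (fun c => ∑ g, if o = some g then (∑ z, χ c (g, z) j) / (2 * m) else 0)
        fun c => if o = none then (∑ r, χ c r j) / (G * m) else 0) k
  have ha : ∀ j o, ∑ k, |a k j o| ≤ 1 := by
    intro j o
    rw [Fintype.sum_sum_type, Fintype.sum_sum_type, Fintype.sum_sum_type]
    cases o with
    | none =>
      simp only [a, Sum.elim_inl, Sum.elim_inr, reduceCtorEq, if_false, if_true, abs_zero,
        Finset.sum_const_zero, zero_add]
      have h1 : ∀ c, |(∑ r, χ c r j) / (G * m)| = (∑ r, χ c r j) / (G * m) := fun c =>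
        abs_of_nonneg (div_nonneg (Finset.sum_nonneg fun r _ => hχ c r j) (by positivity))
      simp only [h1]
      rw [← Finset.sum_div, Finset.sum_comm]
      simp only [hχ1, Finset.sum_const, Finset.card_univ, nsmul_eq_mul, mul_one,
        Fintype.card_prod, hZ]
      rw [div_le_one (by positivity)]
      push_cast
      exact le_of_eq rfl
    | some g =>
      have h1 : ∀ c, |(∑ z, χ c (g, z) j) / (2 * m)| = (∑ z, χ c (g, z) j) / (2 * m) := fun c =>
        abs_of_nonneg (div_nonneg (Finset.sum_nonneg fun r _ => hχ c _ j) (by positivity))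
      have h2 : ∀ (g' : Γ) (r : ℝ), |if g = g' then r else 0| = if g = g' then |r| else 0 := by
        intro g' r; split_ifs <;> simp
      simp only [a, Sum.elim_inl, Sum.elim_inr, Option.some.injEq, Finset.sum_ite_eq,
        Finset.mem_univ, if_true, h1, reduceCtorEq, if_false, abs_zero, Finset.sum_const_zero,
        add_zero, h2]
      rw [← Finset.sum_div, Finset.sum_comm]
      simp only [hχ1, Finset.sum_const, Finset.card_univ, nsmul_eq_mul, mul_one, hZ]
      have h3 : (m : ℝ) / (2 * m) = 1 / 2 := by field_simp
      rw [h3]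
      norm_num [abs_of_pos]
  have hw : ∀ j o, 0 ≤ w j o := by
    intro j o
    cases o with
    | none => simp only [w, Option.elim_none]; positivity
    | some g =>
      simp only [w, Option.elim_some]
      exact div_nonneg (by linarith) (by positivity)
  have hw1 : ∀ j, ∑ o, w j o = 1 := by
    intro j
    simp only [w, Fintype.sum_option, Option.elim_none, Option.elim_some, Finset.sum_const,
      Finset.card_univ, nsmul_eq_mul, ← hG]
    field_simp
    ring
  obtain ⟨f, -, hf⟩ := exists_rounding a ha w hw hw1
  refine ⟨f, fun g => ?_, fun c => ?_, fun c => ?_⟩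
  · have h1 := hf (Sum.inl (Sum.inl g))
    have h2 := hf (Sum.inl (Sum.inr g))
    simp only [a, w, Sum.elim_inl, Sum.elim_inr, mul_ite, mul_zero, Finset.sum_ite_eq',
      Finset.mem_univ, if_true, Option.elim_some, Finset.sum_const, Finset.card_univ,
      nsmul_eq_mul, hJ', ← Finset.sum_filter] at h1 h2
    have h3 : (G * m : ℝ) * ((m - 9) / (G * m) * (1 / 4)) = (m - 9) / 4 := by
      field_simp
    have h4 : (G * m : ℝ) * ((m - 9) / (G * m) * -(1 / 4)) = -((m - 9) / 4) := by
      field_simp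
    rw [h3] at h1
    rw [h4] at h2
    constructor
    · have : ((Finset.univ.filter fun j => f j = some g).card + 1 : ℝ) ≤ m := by linarith
      exact_mod_cast this
    · have : (m : ℝ) ≤ (Finset.univ.filter fun j => f j = some g).card + 17 := by linarith
      exact_mod_cast this
  · have h1 := hf (Sum.inr (Sum.inl c))
    simp only [a, w, Sum.elim_inl, Sum.elim_inr, Fintype.sum_option, mul_zero,
      reduceCtorEq, if_false, Option.some.injEq, Finset.sum_ite_eq, Finset.mem_univ, if_true,
      Option.elim_some, Option.elim_none, zero_add, Finset.sum_const_zero] at h1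
    rw [Finset.sum_comm] at h1
    simp only [← Finset.sum_filter, ← Finset.sum_div, ← Finset.mul_sum] at h1
    have h2 : ∑ j, ∑ g, ∑ z, χ c (g, z) j = ∑ r, ∑ j, χ c r j := by
      rw [Finset.sum_comm (s := (Finset.univ : Finset (Γ × Z)))]
      simp only [Fintype.sum_prod_type]
    rw [h2] at h1
    have h3 : (m - 9) / (G * m) * ((∑ r, ∑ j, χ c r j) / (2 * m)) ≤ σ / 2 := by
      have h4 : (m - 9) / (G * m) * ((∑ r, ∑ j, χ c r j) / (2 * m))
          = ((m - 9) / m) * ((∑ r, ∑ j, χ c r j) / (G * m)) / 2 := by field_simp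
      have h5 : (∑ r, ∑ j, χ c r j) / (G * m) ≤ σ := by
        rw [div_le_iff₀ (by positivity)]; exact hσ c
      have h6 : 0 ≤ (∑ r, ∑ j, χ c r j) / (G * m) := div_nonneg (hnn c) (by positivity)
      have h7 : ((m : ℝ) - 9) / m ≤ 1 := by rw [div_le_one hmpos]; linarith
      rw [h4]
      have := mul_le_of_le_one_left h6 h7
      linarith
    have h8 := h1.trans (add_le_add_left h3 2)
    rw [div_le_iff₀ (by positivity)] at h8
    linarith
  · have h1 := hf (Sum.inr (Sum.inr c))
    simp only [a, w, Sum.elim_inr, Fintype.sum_option, mul_ite, mul_zero,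
      reduceCtorEq, if_false, if_true, Option.elim_some, Option.elim_none, add_zero,
      Finset.sum_const_zero] at h1
    simp only [← Finset.sum_filter, ← Finset.sum_div, ← Finset.mul_sum] at h1
    rw [Finset.sum_comm (s := (Finset.univ : Finset J))] at h1
    have h5 : (∑ r, ∑ j, χ c r j) / (G * m) ≤ σ := by
      rw [div_le_iff₀ (by positivity)]; exact hσ c
    have h6 := h1.trans (add_le_add_left
      (mul_le_mul_of_nonneg_left h5 (by positivity : (0 : ℝ) ≤ 9 / m)) 2)
    rw [div_le_iff₀ (by positivity)] at h6
    refine h6.trans (le_of_eq ?_)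
    field_simp

/-- Rotating the rows of each group: the cells `(g, e j + k g), j` and the rows left over by the
groups meet each color about as often as on average over all rotations. -/
theorem exists_rotations {Γ Z J C : Type*} [Fintype Γ] [Fintype Z] [AddCommGroup Z] [Fintype J]
    [Fintype C] (χ : C → Γ × Z → J → ℝ) (hχ : ∀ c r j, 0 ≤ χ c r j)
    (hχ1 : ∀ r j, ∑ c, χ c r j = 1) (m : ℕ) (hm : 0 < m) (hZ : Fintype.card Z = m)
    (S : Γ → Finset J) (L : Finset J) (hL : 0 < L.card) (e : J → Z) (U : Γ → Finset Z)
    (hS : ∀ g, (S g).card ≤ m) (hU : ∀ g, (U g).card ≤ 17) :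
    ∃ k : Γ → Z, ∀ c,
      ∑ g, ∑ j ∈ S g, χ c (g, e j + k g) j ≤
        (∑ g, ∑ j ∈ S g, ∑ z, χ c (g, z) j) / m + 4 * m ∧
      ∑ g, ∑ z ∈ U g, ∑ j ∈ L, χ c (g, z + k g) j ≤
        17 / m * (∑ j ∈ L, ∑ r, χ c r j) + 68 * L.card := by
  classical
  have hmpos : (0 : ℝ) < m := by exact_mod_cast hm
  have hLpos : (0 : ℝ) < L.card := by exact_mod_cast hL
  have hrot : ∀ c g j (z₀ : Z), ∑ z, χ c (g, z₀ + z) j = ∑ z, χ c (g, z) j := fun c g j z₀ =>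
    Equiv.sum_comp (Equiv.addLeft z₀) fun z => χ c (g, z) j
  let a : C ⊕ C → Γ → Z → ℝ := fun k g z =>
    Sum.elim (fun c => (∑ j ∈ S g, χ c (g, e j + z) j) / (2 * m))
      (fun c => (∑ y ∈ U g, ∑ j ∈ L, χ c (g, y + z) j) / (34 * L.card)) k
  have ha : ∀ g z, ∑ k, |a k g z| ≤ 1 := by
    intro g z
    rw [Fintype.sum_sum_type]
    have h1 : ∀ c, |(∑ j ∈ S g, χ c (g, e j + z) j) / (2 * m)| =
        (∑ j ∈ S g, χ c (g, e j + z) j) / (2 * m) := fun c =>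
      abs_of_nonneg (div_nonneg (Finset.sum_nonneg fun j _ => hχ c _ j) (by positivity))
    have h2 : ∀ c, |(∑ y ∈ U g, ∑ j ∈ L, χ c (g, y + z) j) / (34 * L.card)| =
        (∑ y ∈ U g, ∑ j ∈ L, χ c (g, y + z) j) / (34 * L.card) := fun c =>
      abs_of_nonneg (div_nonneg (Finset.sum_nonneg fun y _ =>
        Finset.sum_nonneg fun j _ => hχ c _ j) (by positivity))
    have h3 : ∑ c, ∑ j ∈ S g, χ c (g, e j + z) j = (S g).card := by
      rw [Finset.sum_comm]; simp [hχ1]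
    have h4 : ∑ c, ∑ y ∈ U g, ∑ j ∈ L, χ c (g, y + z) j = (U g).card * L.card := by
      rw [Finset.sum_comm]
      simp_rw [Finset.sum_comm (s := (Finset.univ : Finset C)), hχ1]
      simp
    simp only [a, Sum.elim_inl, Sum.elim_inr, h1, h2]
    rw [← Finset.sum_div, ← Finset.sum_div, h3, h4]
    have h5 : ((S g).card : ℝ) / (2 * m) ≤ 1 / 2 := by
      have : ((S g).card : ℝ) ≤ m := by exact_mod_cast hS g
      rw [div_le_iff₀ (by positivity)]; linarith
    have h6 : ((U g).card * L.card : ℝ) / (34 * L.card) ≤ 1 / 2 := by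
      have : ((U g).card : ℝ) ≤ 17 := by exact_mod_cast hU g
      rw [div_le_iff₀ (by positivity)]; nlinarith
    linarith
  have hw : ∀ (_ : Γ) (_ : Z), (0 : ℝ) ≤ 1 / m := by
    intro g z; positivity
  have hw1 : ∀ _ : Γ, ∑ _ : Z, (1 : ℝ) / m = 1 := by
    intro g
    simp [hZ, hmpos.ne']
  obtain ⟨k, -, hk⟩ := exists_rounding a ha (fun _ _ => 1 / m) hw hw1
  refine ⟨k, fun c => ⟨?_, ?_⟩⟩
  · have h1 := hk (Sum.inl c)
    simp only [a, Sum.elim_inl, ← Finset.sum_div, ← Finset.mul_sum] at h1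
    have h2 : ∑ g, ∑ z, ∑ j ∈ S g, χ c (g, e j + z) j
        = ∑ g, ∑ j ∈ S g, ∑ z, χ c (g, z) j := by
      refine Finset.sum_congr rfl fun g _ => ?_
      rw [Finset.sum_comm]
      exact Finset.sum_congr rfl fun j _ => hrot c g j (e j)
    rw [h2, div_le_iff₀ (by positivity)] at h1
    refine h1.trans (le_of_eq ?_)
    field_simp
    ring
  · have h1 := hk (Sum.inr c)
    simp only [a, Sum.elim_inr, ← Finset.sum_div, ← Finset.mul_sum] at h1
    have h2 : ∑ g, ∑ z, ∑ y ∈ U g, ∑ j ∈ L, χ c (g, y + z) j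
        ≤ 17 * ∑ j ∈ L, ∑ r, χ c r j := by
      calc _ = ∑ g, ∑ y ∈ U g, ∑ j ∈ L, ∑ z, χ c (g, z) j := by
            refine Finset.sum_congr rfl fun g _ => ?_
            rw [Finset.sum_comm]
            refine Finset.sum_congr rfl fun y _ => ?_
            rw [Finset.sum_comm]
            exact Finset.sum_congr rfl fun j _ => hrot c g j y
        _ ≤ ∑ g, 17 * ∑ j ∈ L, ∑ z, χ c (g, z) j := by
            refine Finset.sum_le_sum fun g _ => ?_
            rw [Finset.sum_const, nsmul_eq_mul]
            refine mul_le_mul_of_nonneg_right (by exact_mod_cast hU g) ?_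
            exact Finset.sum_nonneg fun j _ => Finset.sum_nonneg fun z _ => hχ c _ j
        _ = 17 * ∑ j ∈ L, ∑ r, χ c r j := by
            rw [← Finset.mul_sum, Finset.sum_comm]
            simp only [Fintype.sum_prod_type]
    have h3 : 1 / (m : ℝ) * ((∑ g, ∑ z, ∑ y ∈ U g, ∑ j ∈ L, χ c (g, y + z) j) /
        (34 * L.card)) ≤ 1 / m * ((17 * ∑ j ∈ L, ∑ r, χ c r j) / (34 * L.card)) := by
      gcongr
    have h4 := h1.trans (add_le_add_left h3 2)
    rw [div_le_iff₀ (by positivity)] at h4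
    refine h4.trans (le_of_eq ?_)
    field_simp
    ring

/-- The transversal bound for arrays whose rows split evenly into groups of size `m`. -/
theorem exists_equiv_of_grouped_rows {Γ Z J C : Type*} [Fintype Γ] [Fintype Z] [AddCommGroup Z]
    [Fintype J] [Fintype C] [DecidableEq C] [Nonempty Γ] (A : Γ × Z → J → C) (m : ℕ)
    (hm : 9 ≤ m) (hZ : Fintype.card Z = m) (hJ : Fintype.card J = Fintype.card Γ * m) (σ : ℝ)
    (hσ : ∀ c, ∑ r, ∑ j, (if A r j = c then (1 : ℝ) else 0) ≤ σ * (Fintype.card Γ * m))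
    (t : ℕ) (ht : 153 * σ / m + 102 ≤ t) :
    ∃ Ψ : J ≃ Γ × Z, ∀ c, ((Finset.univ.filter fun j => A (Ψ j) j = c).card : ℝ) ≤
      σ + 4 + 4 * m + (127 * t + 64) := by
  classical
  let χ : C → Γ × Z → J → ℝ := fun c r j => if A r j = c then 1 else 0
  have hχ : ∀ c r j, 0 ≤ χ c r j := by intro c r j; simp only [χ]; split_ifs <;> norm_num
  have hχ1 : ∀ r j, ∑ c, χ c r j = 1 := by intro r j; simp [χ]
  have hmpos : (0 : ℝ) < m := by exact_mod_cast (by omega : 0 < m)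
  set G := Fintype.card Γ with hG
  have hGpos : 0 < G := Fintype.card_pos
  obtain ⟨f, hsize, hmain, hres⟩ := exists_column_distribution χ hχ hχ1 m hm hZ hJ σ hσ
  let S : Γ → Finset J := fun g => Finset.univ.filter fun j => f j = some g
  let L : Finset J := Finset.univ.filter fun j => f j = none
  have hLcard : G ≤ L.card := by
    have h1 : L.card + ∑ g, (S g).card = Fintype.card J := by
      have h2 := Finset.card_eq_sum_card_fiberwise (f := f) (s := Finset.univ)
        (t := Finset.univ) (fun _ _ => Finset.mem_univ _)
      rw [Fintype.sum_option, Finset.card_univ] at h2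
      exact h2.symm
    have h3 : ∑ g, ((S g).card + 1) ≤ ∑ _ : Γ, m := Finset.sum_le_sum fun g _ => (hsize g).1
    rw [Finset.sum_add_distrib, Finset.sum_const, Finset.sum_const, Finset.card_univ,
      smul_eq_mul, smul_eq_mul] at h3
    have h4 : L.card + ∑ g, (S g).card = G * m := h1.trans hJ
    have h5 : ∑ g, (S g).card + G * 1 ≤ G * m := h3
    omega
  have hemb : ∀ g, ∃ e : J → Z, Set.InjOn e (S g) := by
    intro g
    have h1 : Fintype.card (S g) ≤ Fintype.card Z := by
      rw [Fintype.card_coe, hZ]; have := (hsize g).1; exact (Nat.le_succ _).trans this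
    obtain ⟨ι⟩ := Function.Embedding.nonempty_of_card_le h1
    refine ⟨fun j => if h : j ∈ S g then ι ⟨j, h⟩ else 0, fun j hj j' hj' h => ?_⟩
    have hj1 : j ∈ S g := hj
    have hj2 : j' ∈ S g := hj'
    simp only [hj1, hj2, dif_pos] at h
    simpa using ι.injective h
  choose E hE using hemb
  let e : J → Z := fun j => (f j).elim 0 fun g => E g j
  have he : ∀ g, Set.InjOn e (S g) := by
    intro g j hj j' hj' h
    have h1 : f j = some g := by simpa [S] using hj
    have h2 : f j' = some g := by simpa [S] using hj'
    simp only [e, h1, h2, Option.elim_some] at h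
    exact hE g hj hj' h
  let U : Γ → Finset Z := fun g => ((S g).image e)ᶜ
  have hU : ∀ g, (U g).card ≤ 17 := by
    intro g
    rw [Finset.card_compl, Finset.card_image_of_injOn (he g), hZ]
    have : m ≤ (S g).card + 17 := (hsize g).2
    omega
  obtain ⟨k, hk⟩ := exists_rotations χ hχ hχ1 m (by omega) hZ S L (by omega) e U
    (fun g => (Nat.le_succ _).trans (hsize g).1) hU
  let φ : J → Γ × Z := fun j => (f j).elim (Classical.arbitrary Γ, 0) fun g => (g, e j + k g)
  have hφ : ∀ j g, f j = some g → φ j = (g, e j + k g) := fun j g h => by simp [φ, h]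
  let W : Finset (Γ × Z) := Finset.univ.filter fun r => r.2 - k r.1 ∈ U r.1
  have hWsum : ∀ F : Γ × Z → ℝ, ∑ r ∈ W, F r = ∑ g, ∑ z ∈ U g, F (g, z + k g) := by
    intro F
    rw [Finset.sum_filter, Fintype.sum_prod_type]
    refine Finset.sum_congr rfl fun g _ => ?_
    rw [← Equiv.sum_comp (Equiv.addRight (k g))]
    simp
  have hinj : ∀ j j', f j ≠ none → f j' ≠ none → φ j = φ j' → j = j' := by
    intro j j' h h' heq
    obtain ⟨g, hg⟩ := Option.ne_none_iff_exists'.1 h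
    obtain ⟨g', hg'⟩ := Option.ne_none_iff_exists'.1 h'
    rw [hφ j g hg, hφ j' g' hg', Prod.mk.injEq] at heq
    obtain ⟨rfl, h2⟩ := heq
    exact he g (by simpa [S] using hg) (by simpa [S] using hg') (add_right_cancel h2)
  have hW : ∀ r, r ∈ W ↔ ∀ j, f j ≠ none → φ j ≠ r := by
    rintro ⟨g, z⟩
    simp only [W, U, S, Finset.mem_filter, Finset.mem_univ, true_and, Finset.mem_compl,
      Finset.mem_image, not_exists, not_and]
    constructor
    · intro h j hj heq
      obtain ⟨g', hg'⟩ := Option.ne_none_iff_exists'.1 hj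
      rw [hφ j g' hg', Prod.mk.injEq] at heq
      obtain ⟨rfl, h2⟩ := heq
      exact h j hg' (eq_sub_of_add_eq h2)
    · intro h j hj heq
      refine h j (by simp [hj]) ?_
      rw [hφ j g hj, heq, sub_add_cancel]
  have hLeq : (Finset.univ.filter fun j => ¬ f j ≠ none) = L := by
    ext j; simp [L]
  have hleft : ∀ c, ∑ r ∈ W, (Finset.univ.filter fun j => ¬ f j ≠ none ∧ A r j = c).card ≤
      t * (Finset.univ.filter fun j => ¬ f j ≠ none).card := by
    intro c
    rw [hLeq]
    have h1 : ∀ r, ((Finset.univ.filter fun j => ¬ f j ≠ none ∧ A r j = c).card : ℝ) =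
        ∑ j ∈ L, χ c r j := by
      intro r
      have h2 : (Finset.univ.filter fun j => ¬ f j ≠ none ∧ A r j = c) =
          L.filter fun j => A r j = c := by
        ext j; simp [L]
      rw [h2, Finset.natCast_card_filter]
    have hGL : (G : ℝ) ≤ L.card := by exact_mod_cast hLcard
    have hG0 : (0 : ℝ) < G := by exact_mod_cast hGpos
    have hσ0 : 0 ≤ σ := by
      have h3 : (0 : ℝ) ≤ σ * (G * m) := le_trans (Finset.sum_nonneg fun r _ =>
        Finset.sum_nonneg fun j _ => hχ c r j) (hσ c)
      exact nonneg_of_mul_nonneg_left h3 (by positivity)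
    have h4 : (∑ r ∈ W, ((Finset.univ.filter fun j => ¬ f j ≠ none ∧ A r j = c).card : ℝ)) ≤
        t * L.card := by
      simp only [h1]
      rw [hWsum]
      calc _ ≤ 17 / m * (∑ j ∈ L, ∑ r, χ c r j) + 68 * L.card := (hk c).2
        _ ≤ 17 / m * (9 * G * σ + 2 * (G * m)) + 68 * L.card := by
          gcongr
          exact hres c
        _ = G * (153 * σ / m + 34) + 68 * L.card := by field_simp; ring
        _ ≤ L.card * (153 * σ / m + 34) + 68 * L.card := by gcongr
        _ = (153 * σ / m + 102) * L.card := by ring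
        _ ≤ t * L.card := by gcongr
    exact_mod_cast h4
  obtain ⟨Ψ, hΨ⟩ := exists_equiv_extending (by rw [Fintype.card_prod, hJ, hZ]) A
    (fun j => f j ≠ none) φ hinj W hW t hleft
  refine ⟨Ψ, fun c => ?_⟩
  have hcover : (Finset.univ.filter fun j => f j ≠ none ∧ A (φ j) j = c) ⊆
      Finset.univ.biUnion fun g => (S g).filter fun j => A (g, e j + k g) j = c := by
    intro j hj
    simp only [Finset.mem_filter, Finset.mem_univ, true_and] at hj
    obtain ⟨g, hg⟩ := Option.ne_none_iff_exists'.1 hj.1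
    have h1 := hj.2
    rw [hφ j g hg] at h1
    simp [S, hg, h1]
  have h1 := (Finset.card_le_card hcover).trans Finset.card_biUnion_le
  have h2 : ((Finset.univ.filter fun j => f j ≠ none ∧ A (φ j) j = c).card : ℝ) ≤
      ∑ g, ∑ j ∈ S g, χ c (g, e j + k g) j := by
    calc _ ≤ ((∑ g, ((S g).filter fun j => A (g, e j + k g) j = c).card : ℕ) : ℝ) := by
          exact_mod_cast h1
      _ = _ := by
          push_cast
          exact Finset.sum_congr rfl fun g _ => Finset.natCast_card_filter _ _
  have h3 : (∑ g, ∑ j ∈ S g, ∑ z, χ c (g, z) j) / m ≤ σ + 4 := by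
    rw [div_le_iff₀ hmpos, mul_comm]; exact hmain c
  have h4 := (hk c).1
  have h5 : ((Finset.univ.filter fun j => A (Ψ j) j = c).card : ℝ) ≤
      (Finset.univ.filter fun j => f j ≠ none ∧ A (φ j) j = c).card + (127 * t + 64) := by
    exact_mod_cast hΨ c
  linarith

/-- Passing from `n` rows to a multiple of `m` rows by matching the remaining fewer than `m` rows
arbitrarily. -/
theorem exists_perm_card_color_le_of_remainder {n m : ℕ} {C : Type*} [Fintype C] [DecidableEq C]
    (A : Fin n → Fin n → C) (hm : 9 ≤ m) (hmn : m ≤ n) (σ : ℝ)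
    (hσ : ∀ c, ((Finset.univ.filter fun p : Fin n × Fin n => A p.1 p.2 = c).card : ℝ) ≤
      σ * ((n / m : ℕ) * m)) (t : ℕ) (ht : 153 * σ / m + 102 ≤ t) :
    ∃ π : Equiv.Perm (Fin n), ∀ c, ((Finset.univ.filter fun i => A i (π i) = c).card : ℝ) ≤
      σ + 4 + 4 * m + (127 * t + 64) + m := by
  classical
  have : NeZero m := ⟨by omega⟩
  have : Nonempty (Fin (n / m)) := ⟨⟨0, Nat.div_pos hmn (by omega)⟩⟩
  let R := Fin (n / m) × ZMod m
  have hR : Fintype.card R = n / m * m := by simp [R, ZMod.card]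
  let E : R ⊕ Fin (n % m) ≃ Fin n := Fintype.equivOfCardEq (by
    rw [Fintype.card_sum, hR, Fintype.card_fin, Fintype.card_fin, mul_comm]
    exact Nat.div_add_mod n m)
  obtain ⟨Ψ, hΨ⟩ := exists_equiv_of_grouped_rows
    (fun (r : R) (j : R) => A (E (Sum.inl r)) (E (Sum.inl j))) m hm (ZMod.card m)
    (by rw [hR, Fintype.card_fin]) σ (by
      intro c
      rw [Fintype.card_fin]
      refine le_trans ?_ (hσ c)
      rw [← Fintype.sum_prod_type', ← Finset.natCast_card_filter]
      norm_cast
      refine Finset.card_le_card_of_injOn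
        (fun p => (E (Sum.inl p.1), E (Sum.inl p.2))) ?_ ?_
      · intro p hp
        simpa using hp
      · intro p _ q _ h
        have h' : p.1 = q.1 ∧ p.2 = q.2 := by simpa using h
        exact Prod.ext h'.1 h'.2) t ht
  let π : Equiv.Perm (Fin n) :=
    (E.symm.trans (Equiv.sumCongr Ψ.symm (Equiv.refl _))).trans E
  have hπ : ∀ r, π (E (Sum.inl (Ψ r))) = E (Sum.inl r) := by intro r; simp [π]
  refine ⟨π, fun c => ?_⟩
  have hsub : (Finset.univ.filter fun i => A i (π i) = c) ⊆
      ((Finset.univ.filter fun j => A (E (Sum.inl (Ψ j))) (E (Sum.inl j)) = c).image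
        fun j => E (Sum.inl (Ψ j))) ∪ Finset.univ.image fun l => E (Sum.inr l) := by
    intro i hi
    have hi' : A i (π i) = c := by simpa using hi
    obtain ⟨x, rfl⟩ := E.surjective i
    rcases x with r | l
    · refine Finset.mem_union_left _ (Finset.mem_image.2 ⟨Ψ.symm r, ?_, by simp⟩)
      have := hπ (Ψ.symm r)
      simp only [Equiv.apply_symm_apply] at this
      rw [this] at hi'
      simpa using hi'
    · exact Finset.mem_union_right _ (Finset.mem_image_of_mem _ (Finset.mem_univ l))
  have h1 := (Finset.card_le_card hsub).trans ((Finset.card_union_le _ _).trans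
    (Nat.add_le_add Finset.card_image_le Finset.card_image_le))
  rw [Finset.card_univ, Fintype.card_fin] at h1
  have h2 : n % m ≤ m := (Nat.mod_lt n (by omega)).le
  have h3 := hΨ c
  have h4 : ((Finset.univ.filter fun i => A i (π i) = c).card : ℝ) ≤
      (Finset.univ.filter fun j => A (E (Sum.inl (Ψ j))) (E (Sum.inl j)) = c).card + m := by
    exact_mod_cast h1.trans (Nat.add_le_add_left h2 _)
  linarith

/-- There is a constant `c > 0` such that: if every color appears at most
`(s − c·√s)·n` times in the `n × n` matrix `A`, then `A` has an `s`-transversal,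
i.e. a permutation `π` of `[n]` such that each color appears at most `s` times
among the entries `A(i, π(i))`. -/
theorem s_transversal_exists :
    ∃ c : ℝ, 0 < c ∧
      ∀ (n s : ℕ), 0 < n → 0 < s →
        ∀ (C : Type) (A : Fin n → Fin n → C),
          (∀ col : C,
            (Nat.card {p : Fin n × Fin n // A p.1 p.2 = col} : ℝ) ≤
              ((s : ℝ) - c * Real.sqrt s) * n) →
          ∃ π : Equiv.Perm (Fin n),
            ∀ col : C, Nat.card {i : Fin n // A i (π i) = col} ≤ s := by
  classical
  refine ⟨200000, by norm_num, fun n s hn hs C A hA => ?_⟩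
  simp only [Nat.card_eq_fintype_card, Fintype.card_subtype] at hA ⊢
  rcases le_or_gt n s with hns | hns
  · refine ⟨1, fun c => (Finset.card_le_univ _).trans ?_⟩
    rwa [Fintype.card_fin]
  let D := Set.range fun p : Fin n × Fin n => A p.1 p.2
  let B : Fin n → Fin n → D := fun i j => ⟨A i j, (i, j), rfl⟩
  set m := Nat.sqrt s
  have hn0 : (0 : ℝ) < n := by exact_mod_cast hn
  have hsqrt : Real.sqrt s * Real.sqrt s = s := Real.mul_self_sqrt (Nat.cast_nonneg s)
  have hsqrt_pos : 0 < Real.sqrt s := Real.sqrt_pos.2 (by exact_mod_cast hs)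
  have hlarge : 200000 < Real.sqrt s := by
    let i : Fin n := ⟨0, hn⟩
    have h1 : 0 < (Finset.univ.filter fun p : Fin n × Fin n => A p.1 p.2 = A i i).card :=
      Finset.card_pos.2 ⟨(i, i), by simp⟩
    have h2 : (0 : ℝ) < ((s : ℝ) - 200000 * Real.sqrt s) * n :=
      lt_of_lt_of_le (by exact_mod_cast h1) (hA (A i i))
    have h3 := pos_of_mul_pos_left h2 hn0.le
    nlinarith
  have hms : m * m ≤ s := Nat.sqrt_le s
  have hsm : s < (m + 1) * (m + 1) := Nat.lt_succ_sqrt s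
  have hms' : (m * m : ℝ) ≤ s := by exact_mod_cast hms
  have hsm' : (s : ℝ) < (m + 1) * (m + 1) := by exact_mod_cast hsm
  have hm0 : (0 : ℝ) ≤ m := Nat.cast_nonneg m
  have hmr : (m : ℝ) ≤ Real.sqrt s := Real.le_sqrt_of_sq_le (by rw [sq]; exact hms')
  have hrm : Real.sqrt s < m + 1 := by
    rw [Real.sqrt_lt' (by linarith), sq]; exact hsm'
  have hm9' : (9 : ℝ) ≤ m := by linarith
  have hm9 : 9 ≤ m := by exact_mod_cast hm9'
  have hmpos : (0 : ℝ) < m := by linarith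
  have hmn : m ≤ n := (Nat.sqrt_le_self s).trans hns.le
  obtain ⟨π, hπ⟩ := exists_perm_card_color_le_of_remainder B hm9 hmn
    (s - 200000 * Real.sqrt s + 2 * m) (by
      intro c
      have h1 : ((Finset.univ.filter fun p : Fin n × Fin n => B p.1 p.2 = c).card : ℝ) ≤
          ((s : ℝ) - 200000 * Real.sqrt s) * n := by
        simpa [B, Subtype.ext_iff] using hA c.1
      refine h1.trans ?_
      have h2 : n ≤ n / m * m + m := (Nat.lt_div_mul_add (by omega)).le
      have h3 : (n : ℝ) ≤ (n / m : ℕ) * m + m := by exact_mod_cast h2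
      have h4 : (s : ℝ) ≤ n := by exact_mod_cast hns.le
      set Q : ℝ := (n / m : ℕ) * m
      have h5 : (s : ℝ) ≤ 2 * Q := by nlinarith
      have h6 : 0 ≤ (s : ℝ) - 200000 * Real.sqrt s := by nlinarith
      have h7 := mul_le_mul_of_nonneg_left h3 h6
      have h8 := mul_le_mul_of_nonneg_right h5 hm0
      have h9 := mul_nonneg hsqrt_pos.le hm0
      linarith) (153 * m + 867) (by
      have h1 : 153 * (s - 200000 * Real.sqrt s + 2 * m) / m ≤ 153 * m + 765 := by
        rw [div_le_iff₀ hmpos]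
        nlinarith
      push_cast
      linarith)
  refine ⟨π, fun c => ?_⟩
  by_cases hc : c ∈ D
  · have h1 := hπ ⟨c, hc⟩
    simp only [B, Subtype.ext_iff] at h1
    push_cast at h1
    have h2 : ((Finset.univ.filter fun i => A i (π i) = c).card : ℝ) ≤ s := by linarith
    exact_mod_cast h2
  · have h1 : (Finset.univ.filter fun i => A i (π i) = c) = ∅ := by
      rw [Finset.filter_eq_empty_iff]
      exact fun i _ h => hc ⟨(i, π i), h⟩
    simp [h1]
end

section
/- There exists n₀ such that the following holds for all n ≥ n₀. Let A be an n × n matrix with entries from a set C of colors in which every color appears at most 0.027·n times. Let τ be a permutation of [n] with no fixed points and no 2-cycles, i.e. τ(i) ≠ i and τ(τ(i)) ≠ i for all i ∈ [n]. Then there exists a permutation π of [n] that is conjugate to τ (i.e. π = σ⁻¹ τ σ for some permutation σ of [n]) and is a Latin transversal of A: for all i ≠ i' in [n], A(i, π(i)) ≠ A(i', π(i')). -/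
open scoped Classical in
/-- The multivariate independence polynomial, at `μ`, of the graph `R` induced on `T`. -/
noncomputable def indepSum {ι : Type*} (R : ι → ι → Prop) (μ : ι → ℝ) (T : Finset ι) : ℝ :=
  ∑ I ∈ T.powerset, if (I : Set ι).Pairwise (fun a b => ¬ R a b) then ∏ a ∈ I, μ a else 0

namespace indepSum

variable {ι : Type*} {R : ι → ι → Prop} {μ : ι → ℝ}

open scoped Classical in
lemma term_nonneg (hμ : ∀ a, 0 ≤ μ a) (I : Finset ι) :
    0 ≤ if (I : Set ι).Pairwise (fun a b => ¬ R a b) then ∏ a ∈ I, μ a else 0 := by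
  split_ifs
  · exact Finset.prod_nonneg fun a _ => hμ a
  · exact le_rfl

lemma mono (hμ : ∀ a, 0 ≤ μ a) {S T : Finset ι} (h : S ⊆ T) :
    indepSum R μ S ≤ indepSum R μ T :=
  Finset.sum_le_sum_of_subset_of_nonneg (Finset.powerset_mono.2 h)
    fun I _ _ => term_nonneg hμ I

lemma empty : indepSum R μ ∅ = 1 := by
  simp [indepSum]

lemma one_le (hμ : ∀ a, 0 ≤ μ a) (T : Finset ι) : 1 ≤ indepSum R μ T :=
  empty (R := R) (μ := μ) ▸ mono hμ (Finset.empty_subset T)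

lemma pos (hμ : ∀ a, 0 ≤ μ a) (T : Finset ι) : 0 < indepSum R μ T :=
  one_pos.trans_le (one_le hμ T)

lemma union_le [DecidableEq ι] (hμ : ∀ a, 0 ≤ μ a) (S T : Finset ι) :
    indepSum R μ (S ∪ T) ≤ indepSum R μ S * indepSum R μ T := by
  classical
  unfold indepSum
  rw [Finset.sum_mul_sum, ← Finset.sum_product']
  have hinj : Set.InjOn (fun I : Finset ι => (I ∩ S, I \ S)) (S ∪ T).powerset := by
    intro I _ J _ h
    simp only [Prod.mk.injEq] at h
    rw [← Finset.sdiff_union_inter I S, ← Finset.sdiff_union_inter J S, h.1, h.2]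
  have hsub : (S ∪ T).powerset.image (fun I => (I ∩ S, I \ S)) ⊆ S.powerset ×ˢ T.powerset := by
    intro x hx
    obtain ⟨I, hI, rfl⟩ := Finset.mem_image.1 hx
    rw [Finset.mem_powerset] at hI
    simp only [Finset.mem_product, Finset.mem_powerset]
    refine ⟨Finset.inter_subset_right, fun a ha => ?_⟩
    have := hI (Finset.mem_sdiff.1 ha).1
    have h2 := (Finset.mem_sdiff.1 ha).2
    simp_all
  refine le_trans ?_ (Finset.sum_le_sum_of_subset_of_nonneg hsub
    fun x _ _ => mul_nonneg (term_nonneg hμ _) (term_nonneg hμ _))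
  rw [Finset.sum_image hinj]
  refine Finset.sum_le_sum fun I _ => ?_
  by_cases hI : (I : Set ι).Pairwise (fun a b => ¬ R a b)
  · rw [if_pos hI, if_pos (hI.mono (by simp)), if_pos (hI.mono (by simp)),
      Finset.prod_inter_mul_prod_sdiff]
  · rw [if_neg hI]
    exact mul_nonneg (term_nonneg hμ _) (term_nonneg hμ _)

open scoped Classical in
lemma add_le_insert (hμ : ∀ a, 0 ≤ μ a) (hR : ∀ a b, R a b → R b a) {a : ι} {T : Finset ι}
    (ha : a ∉ T) :
    indepSum R μ T + μ a * indepSum R μ (T.filter fun b => ¬ R a b) ≤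
      indepSum R μ (insert a T) := by
  unfold indepSum
  rw [Finset.sum_powerset_insert ha, Finset.mul_sum]
  refine add_le_add le_rfl (le_trans (Finset.sum_le_sum fun I hI => ?_)
    (Finset.sum_le_sum_of_subset_of_nonneg (Finset.powerset_mono.2 (Finset.filter_subset _ T))
      fun I _ _ => term_nonneg hμ _))
  rw [Finset.mem_powerset] at hI
  by_cases h : (I : Set ι).Pairwise (fun a b => ¬ R a b)
  · have haI : a ∉ I := fun h' => ha (Finset.mem_of_mem_filter a (hI h'))
    rw [if_pos h, if_pos, Finset.prod_insert haI]
    rw [Finset.coe_insert, Set.pairwise_insert]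
    refine ⟨h, fun b hb _ => ?_⟩
    have hab := (Finset.mem_filter.1 (hI hb)).2
    exact ⟨hab, fun h' => hab (hR _ _ h')⟩
  · rw [if_neg h, mul_zero]
    exact term_nonneg hμ _

lemma le_of_clique {T : Finset ι} (hT : ∀ a ∈ T, ∀ b ∈ T, R a b) :
    indepSum R μ T ≤ 1 + ∑ a ∈ T, μ a := by
  classical
  induction T using Finset.induction_on with
  | empty => simp [empty]
  | insert a T ha ih =>
    have ih' := ih fun b hb c hc =>
      hT b (Finset.mem_insert_of_mem hb) c (Finset.mem_insert_of_mem hc)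
    rw [Finset.sum_insert ha]
    suffices indepSum R μ (insert a T) ≤ indepSum R μ T + μ a by linarith
    unfold indepSum
    rw [Finset.sum_powerset_insert ha]
    refine add_le_add le_rfl ?_
    rw [Finset.sum_eq_single_of_mem ∅ (Finset.empty_mem_powerset T)]
    · simp
    · intro I hI hne
      rw [if_neg]
      obtain ⟨b, hb⟩ := Finset.nonempty_iff_ne_empty.2 hne
      have hbT := Finset.mem_powerset.1 hI hb
      intro h
      refine h (Finset.mem_insert_self a I) (Finset.mem_insert_of_mem hb) ?_
        (hT a (Finset.mem_insert_self a T) b (Finset.mem_insert_of_mem hbT))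
      rintro rfl
      exact ha hbT

end indepSum

open scoped Classical in
/-- The lopsided local lemma in its cluster expansion form. Here `P S` is the probability, up to
scaling, that no event of `S` occurs. -/
theorem cluster_local_lemma {ι : Type*} [Fintype ι] [DecidableEq ι] {R : ι → ι → Prop} {μ p : ι → ℝ}
    (hμ : ∀ a, 0 ≤ μ a) (hp : ∀ a, 0 ≤ p a)
    (hrefl : ∀ a, R a a) (hsymm : ∀ a b, R a b → R b a)
    (hpμ : ∀ a, p a * indepSum R μ (Finset.univ.filter (R a)) ≤ μ a)
    (P : Finset ι → ℝ) (hP : ∀ S, 0 ≤ P S) (hempty : 0 < P ∅)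
    (hstep : ∀ a T, a ∉ T →
      P T - p a * P (T.filter fun b => ¬ R a b) ≤ P (insert a T)) (S : Finset ι) :
    0 < P S := by
  have key : ∀ S S' : Finset ι, S' ⊆ S →
      P S' * indepSum R μ Sᶜ ≤ P S * indepSum R μ S'ᶜ := by
    intro S
    induction S using Finset.strongInduction with
    | H S ih =>
      intro S' hS'
      obtain rfl | hss := hS'.eq_or_ssubset
      · exact le_rfl
      obtain ⟨a, haS, haS'⟩ := Finset.exists_of_ssubset hss
      set T := S.erase a with hT
      have hTS : T ⊂ S := Finset.erase_ssubset haS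
      have haT : a ∉ T := Finset.notMem_erase a S
      have hS : insert a T = S := Finset.insert_erase haS
      have hTc : Tᶜ = insert a Sᶜ := by
        rw [hT, Finset.compl_erase]
      set N := Sᶜ.filter fun b => ¬ R a b with hN
      set T₀ := T.filter fun b => ¬ R a b with hT₀
      have h1 : indepSum R μ Sᶜ + μ a * indepSum R μ N ≤ indepSum R μ Tᶜ := by
        rw [hTc]
        convert indepSum.add_le_insert hμ hsymm (T := Sᶜ) (by simpa using haS)
      have h2 : indepSum R μ T₀ᶜ ≤ indepSum R μ (Finset.univ.filter (R a)) * indepSum R μ N := by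
        refine le_trans (indepSum.mono hμ ?_) (indepSum.union_le hμ _ _)
        intro b hb
        by_cases hab : R a b
        · simp [hab]
        · have hba : b ≠ a := fun h => hab (h ▸ hrefl a)
          simp [hT₀, hT, hab, hba] at hb
          simp [hN, hab, hb]
      have h3 := ih T hTS T₀ (Finset.filter_subset _ T)
      have h4 := ih T hTS S' (Finset.subset_erase.2 ⟨hS', haS'⟩)
      have h5 := hstep a T haT
      rw [hS] at h5
      have hYT := indepSum.pos (R := R) hμ Tᶜ
      have hYN := indepSum.pos (R := R) hμ N
      have h6 : p a * indepSum R μ T₀ᶜ ≤ μ a * indepSum R μ N :=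
        calc p a * indepSum R μ T₀ᶜ
            ≤ p a * (indepSum R μ (Finset.univ.filter (R a)) * indepSum R μ N) :=
              mul_le_mul_of_nonneg_left h2 (hp a)
          _ = p a * indepSum R μ (Finset.univ.filter (R a)) * indepSum R μ N := by ring
          _ ≤ μ a * indepSum R μ N := mul_le_mul_of_nonneg_right (hpμ a) hYN.le
      have h7 : P T * indepSum R μ Sᶜ ≤ P S * indepSum R μ Tᶜ := by
        have e1 := mul_le_mul_of_nonneg_right h5 hYT.le
        have e2 := mul_le_mul_of_nonneg_left h3 (hp a)
        have e3 := mul_le_mul_of_nonneg_left h6 (hP T)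
        have e4 := mul_le_mul_of_nonneg_left h1 (hP T)
        nlinarith
      have e1 := mul_le_mul_of_nonneg_right h7 (indepSum.pos (R := R) hμ S'ᶜ).le
      have e2 := mul_le_mul_of_nonneg_right h4 (indepSum.pos (R := R) hμ Sᶜ).le
      refine le_of_mul_le_mul_right ?_ hYT
      nlinarith
  have h := key S ∅ (Finset.empty_subset S)
  have h1 := mul_pos hempty (indepSum.pos (R := R) hμ Sᶜ)
  exact pos_of_mul_pos_left (h1.trans_le h) (indepSum.pos (R := R) hμ _).le

/-- A permutation moving `x` to `y` that displaces no point outside the range of `x`, except into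
that range. -/
lemma exists_perm_comp_eq {α : Type*} {t : ℕ} (x y : Fin t → α)
    (hx : Function.Injective x) (hy : Function.Injective y) :
    ∃ ρ : Equiv.Perm α, (∀ k, ρ (x k) = y k) ∧
      ∀ v, v ∉ Set.range x → ρ v = v ∨ ρ v ∈ Set.range x := by
  classical
  induction t with
  | zero => exact ⟨1, fun k => k.elim0, fun v _ => Or.inl rfl⟩
  | succ t ih =>
    obtain ⟨ρ, h1, h2⟩ := ih (fun k => x k.castSucc) (fun k => y k.castSucc)
      (hx.comp (Fin.castSucc_injective t)) (hy.comp (Fin.castSucc_injective t))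
    refine ⟨Equiv.swap (ρ (x (Fin.last t))) (y (Fin.last t)) * ρ, fun k => ?_, fun v hv => ?_⟩
    · induction k using Fin.lastCases with
      | last => simp
      | cast k =>
        rw [Equiv.Perm.mul_apply, Equiv.swap_apply_of_ne_of_ne, h1]
        · intro h
          exact (Fin.castSucc_lt_last k).ne (hx (ρ.injective h))
        · rw [h1]
          intro h
          exact (Fin.castSucc_lt_last k).ne (hy h)
    · have hlast : ρ (x (Fin.last t)) ∈ Set.range x := by
        by_cases h : x (Fin.last t) ∈ Set.range fun k : Fin t => x k.castSucc
        · obtain ⟨k, hk⟩ := h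
          exact absurd (hx hk) (Fin.castSucc_lt_last k).ne
        · obtain h | ⟨k, hk⟩ := h2 _ h
          · exact ⟨_, h.symm⟩
          · exact ⟨_, hk⟩
      have hv' : ρ v = v ∨ ρ v ∈ Set.range x := by
        obtain h | ⟨k, hk⟩ := h2 v fun ⟨k, hk⟩ => hv ⟨_, hk⟩
        · exact Or.inl h
        · exact Or.inr ⟨_, hk⟩
      rw [Equiv.Perm.mul_apply]
      by_cases hvy : ρ v = y (Fin.last t)
      · rw [hvy, Equiv.swap_apply_right]
        exact Or.inr hlast
      · rwa [Equiv.swap_apply_of_ne_of_ne _ hvy]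
        intro h
        exact hv ⟨_, (ρ.injective h).symm⟩

/-- Prescribing `t` values of a random permutation is negatively correlated with any property `B`
that survives the corresponding switchings. -/
lemma card_prescribed_mul_le {α : Type*} [Fintype α] [DecidableEq α] {t : ℕ} (u x : Fin t → α)
    (hx : Function.Injective x) (B : Finset (Equiv.Perm α))
    (hB : ∀ σ ∈ B, (∀ k, σ (u k) = x k) → ∀ ρ : Equiv.Perm α,
      (∀ v, v ∉ Set.range x → ρ v = v ∨ ρ v ∈ Set.range x) → ρ * σ ∈ B) :
    (B.filter fun σ => ∀ k, σ (u k) = x k).card * (Fintype.card α).descFactorial t ≤ B.card := by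
  choose ρ h1 h2 using fun y : Fin t ↪ α => exists_perm_comp_eq x y hx y.injective
  have hcard : (Fintype.card α).descFactorial t = (Finset.univ : Finset (Fin t ↪ α)).card := by
    rw [Finset.card_univ, Fintype.card_embedding_eq, Fintype.card_fin]
  rw [hcard, ← Finset.card_product]
  refine Finset.card_le_card_of_injOn (fun z => ρ z.2 * z.1) ?_ ?_
  · rintro ⟨σ, y⟩ h
    simp only [Finset.coe_product, Set.mem_prod, Finset.mem_coe, Finset.mem_filter] at h
    exact hB σ h.1.1 h.1.2 _ (h2 y)
  · rintro ⟨σ, y⟩ h ⟨σ', y'⟩ h' heq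
    simp only [Finset.coe_product, Set.mem_prod, Finset.mem_coe, Finset.mem_filter] at h h' heq
    have hy : y = y' := by
      ext k
      have := congrArg (fun π : Equiv.Perm α => π (u k)) heq
      simpa [h.1.2, h'.1.2, h1] using this
    subst hy
    rw [mul_left_cancel heq]

/-- A triple `(i, j, x)` stands for the requirement `σ i = x`, `σ j = τ x` on a permutation `σ`,
which forces `σ⁻¹ * τ * σ` to map `i` to `j`. -/
abbrev Placement (n : ℕ) : Type := Fin n × Fin n × Fin n

namespace Placement

variable {n : ℕ} {C : Type}

/-- `σ` satisfies the requirement `f`. -/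
def Holds (τ σ : Equiv.Perm (Fin n)) (f : Placement n) : Prop :=
  σ f.1 = f.2.2 ∧ σ f.2.1 = τ f.2.2

/-- Two placements that are jointly satisfiable and occupy distinct cells of the same color. -/
def Clash (A : Fin n → Fin n → C) (τ : Equiv.Perm (Fin n)) (f g : Placement n) : Prop :=
  A f.1 f.2.1 = A g.1 g.2.1 ∧ f.1 ≠ g.1 ∧ f.2.1 ≠ g.2.1 ∧ f.1 ≠ f.2.1 ∧ g.1 ≠ g.2.1 ∧
    f.2.2 ≠ g.2.2 ∧ (g.1 = f.2.1 ↔ g.2.2 = τ f.2.2) ∧ (f.1 = g.2.1 ↔ f.2.2 = τ g.2.2)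

/-- One cell of the pair lies in the row indexed by the column of the other. -/
def Linked (f g : Placement n) : Prop := g.1 = f.2.1 ∨ f.1 = g.2.1

lemma Clash.symm {A : Fin n → Fin n → C} {τ : Equiv.Perm (Fin n)} {f g : Placement n}
    (h : Clash A τ f g) : Clash A τ g f :=
  ⟨h.1.symm, h.2.1.symm, h.2.2.1.symm, h.2.2.2.2.1, h.2.2.2.1, h.2.2.2.2.2.1.symm,
    h.2.2.2.2.2.2.2, h.2.2.2.2.2.2.1⟩

lemma linked_comm {f g : Placement n} : Linked f g ↔ Linked g f := or_comm

open scoped Classical in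
/-- The local lemma weight of a pair of placements. -/
noncomputable def weight (A : Fin n → Fin n → C) (τ : Equiv.Perm (Fin n)) (K : ℝ)
    (f g : Placement n) : ℝ :=
  if Clash A τ f g then (if Linked f g then K else K / n) else 0

variable {A : Fin n → Fin n → C} {τ : Equiv.Perm (Fin n)} {K : ℝ}

lemma weight_nonneg (hK : 0 ≤ K) (f g : Placement n) : 0 ≤ weight A τ K f g := by
  unfold weight
  split_ifs <;> positivity

open scoped Classical in
lemma weight_comm (f g : Placement n) : weight A τ K f g = weight A τ K g f := by
  have h : Clash A τ f g ↔ Clash A τ g f := ⟨Clash.symm, Clash.symm⟩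
  exact if_congr h (if_congr linked_comm rfl rfl) rfl

lemma sum_weight_value_le (hK : 0 ≤ K) (f : Placement n) (i j : Fin n) :
    ∑ y, weight A τ K f (i, j, y) ≤ K := by
  have hn : (0 : ℝ) < n := by exact_mod_cast i.pos
  by_cases hl : i = f.2.1 ∨ f.1 = j
  · obtain ⟨y₀, hy₀⟩ : ∃ y₀, ∀ y, Clash A τ f (i, j, y) → y = y₀ := by
      obtain h | h := hl
      · exact ⟨τ f.2.2, fun y hy => hy.2.2.2.2.2.2.1.1 h⟩
      · refine ⟨τ.symm f.2.2, fun y hy => ?_⟩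
        rw [hy.2.2.2.2.2.2.2.1 h, Equiv.symm_apply_apply]
    rw [Finset.sum_eq_single_of_mem y₀ (Finset.mem_univ _)]
    · unfold weight
      split_ifs with h1 h2
      · exact le_rfl
      · exact absurd hl h2
      · exact hK
    · intro y _ hy
      exact if_neg fun h => hy (hy₀ y h)
  · calc ∑ y, weight A τ K f (i, j, y) ≤ ∑ _y : Fin n, K / n := by
          refine Finset.sum_le_sum fun y _ => ?_
          unfold weight
          split_ifs with h1 h2
          · exact absurd h2 hl
          · exact le_rfl
          · positivity
      _ = K := by
          simp only [Finset.sum_const, Finset.card_univ, Fintype.card_fin, nsmul_eq_mul]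
          field_simp

lemma sum_weight_le {b : ℝ} (hK : 0 ≤ K)
    (hA : ∀ c, (Nat.card {p : Fin n × Fin n // A p.1 p.2 = c} : ℝ) ≤ b) (f : Placement n) :
    ∑ g, weight A τ K f g ≤ b * K := by
  classical
  calc ∑ g, weight A τ K f g = ∑ p : Fin n × Fin n, ∑ y, weight A τ K f (p.1, p.2, y) := by
        rw [Fintype.sum_prod_type, Fintype.sum_prod_type]
        exact Finset.sum_congr rfl fun i _ => Fintype.sum_prod_type _
    _ ≤ ∑ p : Fin n × Fin n, if A p.1 p.2 = A f.1 f.2.1 then K else 0 := by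
        refine Finset.sum_le_sum fun p _ => ?_
        split_ifs with h
        · exact sum_weight_value_le hK f p.1 p.2
        · exact (Finset.sum_eq_zero fun y _ => if_neg fun hc => h hc.1.symm).le
    _ = (Nat.card {p : Fin n × Fin n // A p.1 p.2 = A f.1 f.2.1} : ℝ) * K := by
        rw [← Finset.sum_filter, Finset.sum_const, nsmul_eq_mul, Nat.card_eq_fintype_card,
          Fintype.card_subtype]
    _ ≤ b * K := mul_le_mul_of_nonneg_right (hA _) hK

open scoped Classical in
/-- The weight of a pair of placements, counting each unordered pair once. -/
noncomputable def pairWeight (A : Fin n → Fin n → C) (τ : Equiv.Perm (Fin n)) (K : ℝ)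
    (e : Placement n × Placement n) : ℝ :=
  if e.1.1 < e.2.1 then weight A τ K e.1 e.2 else 0

lemma pairWeight_nonneg (hK : 0 ≤ K) (e : Placement n × Placement n) :
    0 ≤ pairWeight A τ K e := by
  unfold pairWeight
  split_ifs
  · exact weight_nonneg hK _ _
  · exact le_rfl

open scoped Classical in
lemma sum_pairWeight_le {b : ℝ} (hK : 0 ≤ K)
    (hA : ∀ c, (Nat.card {p : Fin n × Fin n // A p.1 p.2 = c} : ℝ) ≤ b)
    (Q : Finset (Placement n)) :
    ∑ e with e.1 ∈ Q ∨ e.2 ∈ Q, pairWeight A τ K e ≤ Q.card * (b * K) := by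
  calc ∑ e with e.1 ∈ Q ∨ e.2 ∈ Q, pairWeight A τ K e
      ≤ ∑ e : Placement n × Placement n, ((if e.1 ∈ Q then pairWeight A τ K e else 0) +
          if e.2 ∈ Q then pairWeight A τ K e else 0) := by
        rw [Finset.sum_filter]
        refine Finset.sum_le_sum fun e _ => ?_
        have := pairWeight_nonneg (A := A) (τ := τ) hK e
        split_ifs <;> first | linarith | tauto
    _ = ∑ f, ∑ g, ((if f ∈ Q then pairWeight A τ K (f, g) else 0) +
          if f ∈ Q then pairWeight A τ K (g, f) else 0) := by
        simp only [Finset.sum_add_distrib]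
        exact congrArg₂ (· + ·) (Fintype.sum_prod_type _) (Fintype.sum_prod_type_right _)
    _ ≤ ∑ f, if f ∈ Q then ∑ g, weight A τ K f g else 0 := by
        refine Finset.sum_le_sum fun f _ => ?_
        split_ifs with hf
        · refine Finset.sum_le_sum fun g _ => ?_
          have := weight_nonneg (A := A) (τ := τ) hK f g
          have hc := weight_comm (A := A) (τ := τ) (K := K) f g
          simp only [pairWeight]
          split_ifs with h1 h2
          · exact absurd h2 h1.asymm
          all_goals linarith
        · simp
    _ = ∑ f ∈ Q, ∑ g, weight A τ K f g := by
        rw [← Finset.sum_filter, Finset.filter_mem_eq_inter, Finset.univ_inter]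
    _ ≤ ∑ _f ∈ Q, b * K := Finset.sum_le_sum fun f _ => sum_weight_le hK hA f
    _ = Q.card * (b * K) := by rw [Finset.sum_const, nsmul_eq_mul]

/-- The arguments whose images are prescribed by a pair of placements. -/
def args (e : Placement n × Placement n) : Finset (Fin n) := {e.1.1, e.1.2.1, e.2.1, e.2.2.1}

/-- The values prescribed by a pair of placements. -/
def vals (τ : Equiv.Perm (Fin n)) (e : Placement n × Placement n) : Finset (Fin n) :=
  {e.1.2.2, τ e.1.2.2, e.2.2.2, τ e.2.2.2}

/-- Two pairs of placements prescribe the image of a common argument, or a common value. -/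
def Conflict (τ : Equiv.Perm (Fin n)) (e e' : Placement n × Placement n) : Prop :=
  (∃ i, i ∈ args e ∧ i ∈ args e') ∨ ∃ x, x ∈ vals τ e ∧ x ∈ vals τ e'

lemma conflict_refl (e : Placement n × Placement n) : Conflict τ e e :=
  Or.inl ⟨e.1.1, by simp [args], by simp [args]⟩

lemma Conflict.symm {e e' : Placement n × Placement n} (h : Conflict τ e e') :
    Conflict τ e' e :=
  h.imp (fun ⟨i, h1, h2⟩ => ⟨i, h2, h1⟩) fun ⟨i, h1, h2⟩ => ⟨i, h2, h1⟩

/-- The placements that prescribe the image of `i`. -/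
def withArg (i : Fin n) : Finset (Placement n) := {f | f.1 = i ∨ f.2.1 = i}

/-- The placements that prescribe the preimage of `x`. -/
def withVal (τ : Equiv.Perm (Fin n)) (x : Fin n) : Finset (Placement n) :=
  {f | f.2.2 = x ∨ τ f.2.2 = x}

/-- The placements along the arc of `τ` that starts at `x`. -/
def withArc (x : Fin n) : Finset (Placement n) := {f | f.2.2 = x}

lemma card_withArg_le (i : Fin n) : (withArg i).card ≤ 2 * n ^ 2 := by
  have h : withArg i ⊆ (Finset.univ : Finset (Fin n × Fin n)).image (fun p => (i, p.1, p.2)) ∪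
      (Finset.univ : Finset (Fin n × Fin n)).image (fun p => (p.1, i, p.2)) := by
    rintro ⟨a, b, c⟩ h
    simp only [withArg, Finset.mem_filter, Finset.mem_univ, true_and] at h
    obtain rfl | rfl := h <;> simp
  refine (Finset.card_le_card h).trans ((Finset.card_union_le _ _).trans ?_)
  have h1 := Finset.card_image_le (s := (Finset.univ : Finset (Fin n × Fin n)))
    (f := fun p => (i, p.1, p.2))
  have h2 := Finset.card_image_le (s := (Finset.univ : Finset (Fin n × Fin n)))
    (f := fun p => (p.1, i, p.2))
  simp only [Finset.card_univ, Fintype.card_prod, Fintype.card_fin] at h1 h2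
  nlinarith

lemma card_withArc_le (x : Fin n) : (withArc x).card ≤ n ^ 2 := by
  have h : withArc x ⊆ (Finset.univ : Finset (Fin n × Fin n)).image
      (fun p => (p.1, p.2, x)) := by
    rintro ⟨a, b, c⟩ h
    simp only [withArc, Finset.mem_filter, Finset.mem_univ, true_and] at h
    subst h
    simp
  refine (Finset.card_le_card h).trans (Finset.card_image_le.trans ?_)
  simp [sq]

lemma card_withVal_le (x : Fin n) : (withVal τ x).card ≤ 2 * n ^ 2 := by
  have h : withVal τ x ⊆ withArc x ∪ withArc (τ.symm x) := by
    intro f hf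
    simpa [withVal, withArc, Equiv.eq_symm_apply] using hf
  have h1 := (Finset.card_le_card h).trans (Finset.card_union_le _ _)
  have h2 := card_withArc_le x
  have h3 := card_withArc_le (τ.symm x)
  linarith

open scoped Classical in
/-- The pairs of placements that meet `Q`. -/
noncomputable def meeting (Q : Finset (Placement n)) : Finset (Placement n × Placement n) :=
  {e | e.1 ∈ Q ∨ e.2 ∈ Q}

lemma mem_meeting {Q : Finset (Placement n)} {e : Placement n × Placement n} :
    e ∈ meeting Q ↔ e.1 ∈ Q ∨ e.2 ∈ Q := by
  simp [meeting]

lemma mem_meeting_withArg {i : Fin n} {e : Placement n × Placement n} :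
    e ∈ meeting (withArg i) ↔ i ∈ args e := by
  simp only [mem_meeting, withArg, args, Finset.mem_filter, Finset.mem_univ, true_and,
    Finset.mem_insert, Finset.mem_singleton, or_assoc, eq_comm]

lemma mem_meeting_withVal {x : Fin n} {e : Placement n × Placement n} :
    e ∈ meeting (withVal τ x) ↔ x ∈ vals τ e := by
  simp only [mem_meeting, withVal, vals, Finset.mem_filter, Finset.mem_univ, true_and,
    Finset.mem_insert, Finset.mem_singleton, or_assoc, eq_comm]

lemma meeting_mono {Q Q' : Finset (Placement n)} (h : Q ⊆ Q') : meeting Q ⊆ meeting Q' :=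
  fun _ he => mem_meeting.2 ((mem_meeting.1 he).imp (@h _) (@h _))

lemma mem_meeting_withVal_apply {x : Fin n} {e : Placement n × Placement n}
    (h : τ x ∈ vals τ e) : e ∈ meeting (withVal τ x) ∪ meeting (withArc (τ x)) := by
  simp only [vals, Finset.mem_insert, Finset.mem_singleton, EmbeddingLike.apply_eq_iff_eq] at h
  simp only [Finset.mem_union, mem_meeting, withVal, withArc, Finset.mem_filter,
    Finset.mem_univ, true_and]
  obtain h | h | h | h := h <;> simp [h]

lemma conflict_of_mem_withArg {i : Fin n} {e e' : Placement n × Placement n}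
    (h : e ∈ meeting (withArg i)) (h' : e' ∈ meeting (withArg i)) : Conflict τ e e' :=
  Or.inl ⟨i, mem_meeting_withArg.1 h, mem_meeting_withArg.1 h'⟩

lemma conflict_of_mem_withVal {x : Fin n} {e e' : Placement n × Placement n}
    (h : e ∈ meeting (withVal τ x)) (h' : e' ∈ meeting (withVal τ x)) : Conflict τ e e' :=
  Or.inr ⟨x, mem_meeting_withVal.1 h, mem_meeting_withVal.1 h'⟩

lemma withArc_subset (x : Fin n) : withArc x ⊆ withVal τ x := by
  intro f hf
  simp only [withArc, withVal, Finset.mem_filter, Finset.mem_univ, true_and] at hf ⊢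
  exact Or.inl hf

lemma indepSum_meeting_le {b : ℝ} (hK : 0 ≤ K) (hb : 0 ≤ b)
    (hA : ∀ c, (Nat.card {p : Fin n × Fin n // A p.1 p.2 = c} : ℝ) ≤ b)
    {Q : Finset (Placement n)} {m : ℕ} (hQ : Q.card ≤ m)
    (hclique : ∀ e ∈ meeting Q, ∀ e' ∈ meeting Q, Conflict τ e e') :
    indepSum (Conflict τ) (pairWeight A τ K) (meeting Q) ≤ 1 + m * (b * K) := by
  have h1 := sum_pairWeight_le (τ := τ) hK hA Q
  have h2 : (Q.card : ℝ) * (b * K) ≤ m * (b * K) :=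
    mul_le_mul_of_nonneg_right (by exact_mod_cast hQ) (by positivity)
  have h3 := indepSum.le_of_clique (μ := pairWeight A τ K) hclique
  unfold meeting at h3 ⊢
  linarith

open scoped Classical in
lemma indepSum_neighborhood_le {b z : ℝ} (hK : 0 ≤ K) (hb : 0 ≤ b)
    (hA : ∀ c, (Nat.card {p : Fin n × Fin n // A p.1 p.2 = c} : ℝ) ≤ b)
    (hz : (n : ℝ) ^ 2 * (b * K) = z) (a : Placement n × Placement n) :
    indepSum (Conflict τ) (pairWeight A τ K) (Finset.univ.filter (Conflict τ a)) ≤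
      (1 + 2 * z) ^ 6 * (1 + z) ^ 2 := by
  have hμ := pairWeight_nonneg (A := A) (τ := τ) hK
  have harg (i : Fin n) :
      indepSum (Conflict τ) (pairWeight A τ K) (meeting (withArg i)) ≤ 1 + 2 * z := by
    have := indepSum_meeting_le (A := A) hK hb hA (card_withArg_le i)
      fun e he e' he' => conflict_of_mem_withArg (τ := τ) he he'
    push_cast at this
    linarith
  have hval (x : Fin n) : indepSum (Conflict τ) (pairWeight A τ K)
      (meeting (withVal τ x) ∪ meeting (withArc (τ x))) ≤ (1 + 2 * z) * (1 + z) := by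
    have h1 := indepSum_meeting_le (A := A) hK hb hA (card_withVal_le (τ := τ) x)
      fun e he e' he' => conflict_of_mem_withVal he he'
    have h2 := indepSum_meeting_le (A := A) hK hb hA (card_withArc_le (τ x))
      fun e he e' he' => conflict_of_mem_withVal (τ := τ)
        (meeting_mono (withArc_subset _) he) (meeting_mono (withArc_subset _) he')
    push_cast at h1 h2
    have h1' : indepSum (Conflict τ) (pairWeight A τ K) (meeting (withVal τ x)) ≤ 1 + 2 * z := by
      linarith
    rw [hz] at h2
    exact (indepSum.union_le hμ _ _).trans
      (mul_le_mul h1' h2 (indepSum.pos hμ _).le ((indepSum.pos hμ _).le.trans h1'))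
  have hmul {S T : Finset (Placement n × Placement n)} {s t : ℝ}
      (hS : indepSum (Conflict τ) (pairWeight A τ K) S ≤ s)
      (hT : indepSum (Conflict τ) (pairWeight A τ K) T ≤ t) :
      indepSum (Conflict τ) (pairWeight A τ K) (S ∪ T) ≤ s * t :=
    (indepSum.union_le hμ _ _).trans
      (mul_le_mul hS hT (indepSum.pos hμ _).le ((indepSum.pos hμ _).le.trans hS))
  have hall := hmul (hmul (hmul (harg a.1.1) (harg a.1.2.1)) (hmul (harg a.2.1) (harg a.2.2.1)))
    (hmul (hval a.1.2.2) (hval a.2.2.2))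
  refine (indepSum.mono hμ fun e he => ?_).trans (hall.trans_eq (by ring))
  obtain ⟨i, hi, hie⟩ | ⟨x, hx, hxe⟩ := (Finset.mem_filter.1 he).2
  · simp only [args, Finset.mem_insert, Finset.mem_singleton] at hi
    rw [← mem_meeting_withArg] at hie
    refine Finset.mem_union_left _ ?_
    obtain rfl | rfl | rfl | rfl := hi <;> simp only [Finset.mem_union, hie, true_or, or_true]
  · simp only [vals, Finset.mem_insert, Finset.mem_singleton] at hx
    refine Finset.mem_union_right _ ?_
    rw [Finset.mem_union]
    obtain rfl | rfl | rfl | rfl := hx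
    · exact Or.inl (Finset.mem_union_left _ (mem_meeting_withVal.2 hxe))
    · exact Or.inl (mem_meeting_withVal_apply hxe)
    · exact Or.inr (Finset.mem_union_left _ (mem_meeting_withVal.2 hxe))
    · exact Or.inr (mem_meeting_withVal_apply hxe)

/-- The event that `σ⁻¹ * τ * σ` uses two cells of the same color, in the manner prescribed
by `e`. -/
def Bad (A : Fin n → Fin n → C) (τ : Equiv.Perm (Fin n)) (e : Placement n × Placement n)
    (σ : Equiv.Perm (Fin n)) : Prop :=
  e.1.1 < e.2.1 ∧ Clash A τ e.1 e.2 ∧ Holds τ σ e.1 ∧ Holds τ σ e.2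

open scoped Classical in
/-- The permutations that avoid all the bad events in `S`. -/
noncomputable def avoiding (A : Fin n → Fin n → C) (τ : Equiv.Perm (Fin n))
    (S : Finset (Placement n × Placement n)) : Finset (Equiv.Perm (Fin n)) :=
  {σ | ∀ e ∈ S, ¬ Bad A τ e σ}

open scoped Classical in
lemma card_bad_mul_descFactorial_le {S : Finset (Placement n × Placement n)}
    {a : Placement n × Placement n} (hS : ∀ e ∈ S, ¬ Conflict τ a e) {t : ℕ} (u x : Fin t → Fin n)
    (hx : Function.Injective x) (hu_args : ∀ k, u k ∈ args a) (hx_vals : ∀ k, x k ∈ vals τ a)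
    (hux : ∀ σ, Bad A τ a σ → ∀ k, σ (u k) = x k) :
    ((avoiding A τ S).filter (Bad A τ a)).card * n.descFactorial t ≤
      (avoiding A τ S).card := by
  have h := card_prescribed_mul_le u x hx (avoiding A τ S) ?_
  · rw [Fintype.card_fin] at h
    refine le_trans (Nat.mul_le_mul_right _ (Finset.card_le_card ?_)) h
    intro σ hσ
    rw [Finset.mem_filter] at hσ ⊢
    exact ⟨hσ.1, hux σ hσ.2⟩
  · intro σ hσ hσu ρ hρ
    simp only [avoiding, Finset.mem_filter, Finset.mem_univ, true_and] at hσ ⊢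
    intro e he hbad
    refine hσ e he ?_
    have key : ∀ i ∈ args e, ∀ v ∈ vals τ e, (ρ * σ) i = v → σ i = v := by
      intro i hi v hv hiv
      have hi' : σ i ∉ Set.range x := by
        rintro ⟨k, hk⟩
        rw [← hσu k] at hk
        exact hS e he (Or.inl ⟨i, σ.injective hk ▸ hu_args k, hi⟩)
      obtain h | ⟨k, hk⟩ := hρ _ hi'
      · rw [← h]
        exact hiv
      · exact absurd (Or.inr ⟨v, (hk.trans hiv) ▸ hx_vals k, hv⟩) (hS e he)
    obtain ⟨h1, h2, ⟨h3, h4⟩, h5, h6⟩ := hbad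
    exact ⟨h1, h2, ⟨key _ (by simp [args]) _ (by simp [vals]) h3,
      key _ (by simp [args]) _ (by simp [vals]) h4⟩,
      key _ (by simp [args]) _ (by simp [vals]) h5, key _ (by simp [args]) _ (by simp [vals]) h6⟩

lemma injective_vec_four {α : Type*} {a b c d : α} (hab : a ≠ b) (hac : a ≠ c) (had : a ≠ d)
    (hbc : b ≠ c) (hbd : b ≠ d) (hcd : c ≠ d) : Function.Injective ![a, b, c, d] := by
  intro k l hkl
  fin_cases k <;> fin_cases l <;> simp_all [eq_comm]

open scoped Classical in
lemma card_bad_le {D : ℝ} (hn : 0 < n) (hD : 0 < D) (hK : 0 ≤ K)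
    (hτ : ∀ i, τ i ≠ i) (hτ₂ : ∀ i, τ (τ i) ≠ i)
    (h3 : D ≤ K * n.descFactorial 3) (h4 : D * n ≤ K * n.descFactorial 4)
    {S : Finset (Placement n × Placement n)} {a : Placement n × Placement n}
    (hS : ∀ e ∈ S, ¬ Conflict τ a e) :
    (((avoiding A τ S).filter (Bad A τ a)).card : ℝ) ≤
      pairWeight A τ K a / D * (avoiding A τ S).card := by
  by_cases hlt : a.1.1 < a.2.1
  swap
  · have h : (avoiding A τ S).filter (Bad A τ a) = ∅ :=
      Finset.filter_false_of_mem fun σ _ h => hlt h.1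
    simp [h, pairWeight, hlt]
  by_cases hc : Clash A τ a.1 a.2
  swap
  · have h : (avoiding A τ S).filter (Bad A τ a) = ∅ :=
      Finset.filter_false_of_mem fun σ _ h => hc h.2.1
    simp [h, pairWeight, weight, hc]
  have hn' : (0 : ℝ) < n := by exact_mod_cast hn
  obtain ⟨hcol, hrow, hcl, hf, hg, hxy, hl1, hl2⟩ := id hc
  have conclude : ∀ {M : ℕ} {w : ℝ}, pairWeight A τ K a = w → D ≤ w * M → 0 ≤ w →
      ((avoiding A τ S).filter (Bad A τ a)).card * M ≤ (avoiding A τ S).card →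
      (((avoiding A τ S).filter (Bad A τ a)).card : ℝ) ≤
        pairWeight A τ K a / D * (avoiding A τ S).card := by
    intro M w hw hDw hw0 h
    have h' : (((avoiding A τ S).filter (Bad A τ a)).card : ℝ) * M ≤ (avoiding A τ S).card := by
      exact_mod_cast h
    rw [hw, div_mul_eq_mul_div, le_div_iff₀ hD]
    have e1 := mul_le_mul_of_nonneg_left hDw
      (Nat.cast_nonneg (α := ℝ) ((avoiding A τ S).filter (Bad A τ a)).card)
    have e2 := mul_le_mul_of_nonneg_left h' hw0
    linarith
  by_cases hl : Linked a.1 a.2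
  · refine conclude (M := n.descFactorial 3) (w := K)
      (by simp [pairWeight, weight, hlt, hc, hl]) h3 hK ?_
    have hinj (x : Fin n) : Function.Injective ![x, τ x, τ (τ x)] := by
      have e1 := hτ x
      have e2 := hτ₂ x
      have e3 := hτ (τ x)
      intro k l hkl
      fin_cases k <;> fin_cases l <;> simp_all [eq_comm]
    obtain h | h := hl
    · have hy := hl1.1 h
      refine card_bad_mul_descFactorial_le hS ![a.1.1, a.1.2.1, a.2.2.1]
        ![a.1.2.2, τ a.1.2.2, τ (τ a.1.2.2)] (hinj _) ?_ ?_ ?_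
      · intro k
        fin_cases k <;> simp [args]
      · intro k
        fin_cases k <;> simp [vals, hy]
      · rintro σ ⟨-, -, ⟨e1, e2⟩, e3, e4⟩ k
        fin_cases k <;> simp [e1, e2, e4, hy]
    · have hx := hl2.1 h
      refine card_bad_mul_descFactorial_le hS ![a.2.1, a.2.2.1, a.1.2.1]
        ![a.2.2.2, τ a.2.2.2, τ (τ a.2.2.2)] (hinj _) ?_ ?_ ?_
      · intro k
        fin_cases k <;> simp [args]
      · intro k
        fin_cases k <;> simp [vals, hx]
      · rintro σ ⟨-, -, ⟨e1, e2⟩, e3, e4⟩ k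
        fin_cases k <;> simp [e3, e2, e4, hx]
  · refine conclude (M := n.descFactorial 4) (w := K / n)
      (by simp [pairWeight, weight, hlt, hc, hl]) ?_ (by positivity) ?_
    · rw [div_mul_eq_mul_div, le_div_iff₀ hn']
      exact h4
    · simp only [Linked, not_or] at hl
      have e1 : a.2.2.2 ≠ τ a.1.2.2 := fun h => hl.1 (hl1.2 h)
      have e2 : a.1.2.2 ≠ τ a.2.2.2 := fun h => hl.2 (hl2.2 h)
      refine card_bad_mul_descFactorial_le hS ![a.1.1, a.1.2.1, a.2.1, a.2.2.1]
        ![a.1.2.2, τ a.1.2.2, a.2.2.2, τ a.2.2.2] ?_ ?_ ?_ ?_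
      · exact injective_vec_four (hτ _).symm hxy e2 e1.symm (fun h => hxy (τ.injective h))
          (hτ _).symm
      · intro k
        fin_cases k <;> simp [args]
      · intro k
        fin_cases k <;> simp [vals]
      · rintro σ ⟨-, -, ⟨e1, e2⟩, e3, e4⟩ k
        fin_cases k <;> simp [e1, e2, e3, e4]

/-- If `σ` avoids every bad event, then `σ⁻¹ * τ * σ` is a Latin transversal. -/
lemma color_ne_of_forall_not_bad (hτ : ∀ i, τ i ≠ i) {σ : Equiv.Perm (Fin n)}
    (hσ : ∀ e, ¬ Bad A τ e σ) {i i' : Fin n} (hlt : i < i') :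
    A i ((σ⁻¹ * τ * σ) i) ≠ A i' ((σ⁻¹ * τ * σ) i') := by
  intro hcol
  have hπ (k : Fin n) : σ ((σ⁻¹ * τ * σ) k) = τ (σ k) := by simp
  have hfix (k : Fin n) : k ≠ (σ⁻¹ * τ * σ) k := fun h => hτ (σ k) (by rw [← hπ k, ← h])
  have hlink (k l : Fin n) : l = (σ⁻¹ * τ * σ) k ↔ σ l = τ (σ k) := by
    rw [← hπ k, σ.injective.eq_iff]
  exact hσ ((i, (σ⁻¹ * τ * σ) i, σ i), (i', (σ⁻¹ * τ * σ) i', σ i'))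
    ⟨hlt, ⟨hcol, hlt.ne, fun h => hlt.ne ((σ⁻¹ * τ * σ).injective h), hfix i, hfix i',
      fun h => hlt.ne (σ.injective h), hlink i i', hlink i' i⟩, ⟨rfl, hπ i⟩, rfl, hπ i'⟩

theorem exists_forall_not_bad {b z : ℝ} (hn : 0 < n) (hK : 0 ≤ K) (hb : 0 ≤ b)
    (hτ : ∀ i, τ i ≠ i) (hτ₂ : ∀ i, τ (τ i) ≠ i)
    (hA : ∀ c, (Nat.card {p : Fin n × Fin n // A p.1 p.2 = c} : ℝ) ≤ b)
    (hz : (n : ℝ) ^ 2 * (b * K) = z)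
    (h3 : (1 + 2 * z) ^ 6 * (1 + z) ^ 2 ≤ K * n.descFactorial 3)
    (h4 : (1 + 2 * z) ^ 6 * (1 + z) ^ 2 * n ≤ K * n.descFactorial 4) :
    ∃ σ : Equiv.Perm (Fin n), ∀ e, ¬ Bad A τ e σ := by
  classical
  set D : ℝ := (1 + 2 * z) ^ 6 * (1 + z) ^ 2 with hD
  have hz0 : 0 ≤ z := hz ▸ by positivity
  have hD0 : 0 < D := by positivity
  have hμ := pairWeight_nonneg (A := A) (τ := τ) hK
  have h := cluster_local_lemma (R := Conflict τ) (μ := pairWeight A τ K)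
    (p := fun a => pairWeight A τ K a / D) hμ (fun a => div_nonneg (hμ a) hD0.le)
    conflict_refl (fun _ _ => Conflict.symm) ?_ (fun S => ((avoiding A τ S).card : ℝ))
    (fun S => Nat.cast_nonneg _) ?_ ?_ Finset.univ
  · have h' : 0 < (avoiding A τ Finset.univ).card := by exact_mod_cast h
    obtain ⟨σ, hσ⟩ := Finset.card_pos.1 h'
    simp only [avoiding, Finset.mem_filter, Finset.mem_univ, true_and, forall_const] at hσ
    exact ⟨σ, hσ⟩
  · intro a
    rw [div_mul_eq_mul_div, div_le_iff₀ hD0]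
    exact mul_le_mul_of_nonneg_left (indepSum_neighborhood_le hK hb hA hz a) (hμ a)
  · have : 0 < (avoiding A τ ∅).card := Finset.card_pos.2 ⟨1, by simp [avoiding]⟩
    exact_mod_cast this
  · intro a T _
    set T₀ := T.filter fun e => ¬ Conflict τ a e with hT₀
    have h1 := card_bad_le (A := A) (S := T₀) (a := a) hn hD0 hK hτ hτ₂ h3 h4
      fun e he => (Finset.mem_filter.1 he).2
    have h2 : avoiding A τ T ⊆
        avoiding A τ (insert a T) ∪ (avoiding A τ T₀).filter (Bad A τ a) := by
      intro σ hσ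
      simp only [avoiding, Finset.mem_filter, Finset.mem_univ, true_and, Finset.mem_union,
        Finset.mem_insert, forall_eq_or_imp] at hσ ⊢
      by_cases hbad : Bad A τ a σ
      · exact Or.inr ⟨fun e he => hσ e (Finset.mem_of_mem_filter e he), hbad⟩
      · exact Or.inl ⟨hbad, hσ⟩
    have hle : ((avoiding A τ T).card : ℝ) ≤ (avoiding A τ (insert a T)).card +
        ((avoiding A τ T₀).filter (Bad A τ a)).card := by
      exact_mod_cast (Finset.card_le_card h2).trans (Finset.card_union_le _ _)
    exact sub_le_iff_le_add.2 (hle.trans (add_le_add le_rfl h1))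

end Placement

/-- For all sufficiently large `n`: if every color appears at most `0.027·n` times
in the `n × n` matrix `A`, and `τ` is a permutation of `[n]` with no fixed points
and no 2-cycles, then there is a permutation `π` conjugate to `τ` (i.e.
`π = σ⁻¹ τ σ` for some `σ`) which is a Latin transversal of `A`. -/
theorem latin_transversal_with_cycle_structure :
    ∃ n₀ : ℕ, ∀ n : ℕ, n₀ ≤ n →
      ∀ (C : Type) (A : Fin n → Fin n → C),
        (∀ col : C,
          (Nat.card {p : Fin n × Fin n // A p.1 p.2 = col} : ℝ) ≤ 0.027 * n) →
        ∀ τ : Equiv.Perm (Fin n), (∀ i, τ i ≠ i) → (∀ i, τ (τ i) ≠ i) →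
          ∃ σ : Equiv.Perm (Fin n),
            ∀ i i' : Fin n, i ≠ i' →
              A i ((σ⁻¹ * τ * σ) i) ≠ A i' ((σ⁻¹ * τ * σ) i') := by
  refine ⟨1000, fun n hn C A hA τ hτ hτ₂ => ?_⟩
  have hn' : (1000 : ℝ) ≤ n := by exact_mod_cast hn
  have hn0 : (0 : ℝ) < n := by linarith
  have hsub (k : ℕ) (hk : k ≤ 1000) : ((n - k : ℕ) : ℝ) = n - k := Nat.cast_sub (hk.trans hn)
  have hd3 : (n.descFactorial 3 : ℝ) = n * (n - 1) * (n - 2) := by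
    simp [Nat.descFactorial_succ, hsub]
    ring
  have hd4 : (n.descFactorial 4 : ℝ) = n * (n - 1) * (n - 2) * (n - 3) := by
    rw [Nat.descFactorial_succ, Nat.cast_mul, hd3, hsub 3 (by norm_num)]
    push_cast
    ring
  have hcubic : 0.99 * (n : ℝ) ^ 3 ≤ (n - 1) * (n - 2) * (n - 3) := by
    nlinarith [mul_nonneg (sq_nonneg (n : ℝ)) (sub_nonneg.2 hn')]
  have hfac3 : (1 + 2 * 0.082 : ℝ) ^ 6 * (1 + 0.082) ^ 2 ≤
      0.082 / 0.027 / (n : ℝ) ^ 3 * n.descFactorial 3 := by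
    rw [hd3, div_mul_eq_mul_div, le_div_iff₀ (by positivity)]
    norm_num
    nlinarith
  have hfac4 : (1 + 2 * 0.082 : ℝ) ^ 6 * (1 + 0.082) ^ 2 * n ≤
      0.082 / 0.027 / (n : ℝ) ^ 3 * n.descFactorial 4 := by
    rw [hd4, div_mul_eq_mul_div, le_div_iff₀ (by positivity)]
    have h := mul_le_mul_of_nonneg_left hcubic hn0.le
    norm_num at h ⊢
    nlinarith [pow_pos hn0 4]
  obtain ⟨σ, hσ⟩ := Placement.exists_forall_not_bad (A := A) (b := 0.027 * n)
    (by omega) (by positivity) (by positivity) hτ hτ₂ hA (by field_simp) hfac3 hfac4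
  refine ⟨σ, fun i i' hne => ?_⟩
  obtain h | h := lt_or_gt_of_ne hne
  · exact Placement.color_ne_of_forall_not_bad hτ hσ h
  · exact (Placement.color_ne_of_forall_not_bad hτ hσ h).symm
end

section
/- Let G be a finite graph of maximum degree at most Δ whose vertex set is partitioned into blocks V = V_1 ⊔ … ⊔ V_k, each block of size exactly b. If b ≥ 4Δ, then G has an independent transversal: there exist vertices v_1 ∈ V_1, …, v_k ∈ V_k such that {v_1, …, v_k} is an independent set of G. -/
open Classical in
/-- The choice functions for the blocks of `part` that are independent on the blocks in `S` and
agree with the default choice `d` on all other blocks. -/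
noncomputable def partialTransversals {V ι : Type*} [Fintype V] [Fintype ι] (G : SimpleGraph V)
    (part : V → ι) (d : ι → V) (S : Finset ι) : Finset (ι → V) :=
  Finset.univ.filter fun f => (∀ i, part (f i) = i) ∧ (∀ i, i ∉ S → f i = d i) ∧
    ∀ i ∈ S, ∀ j ∈ S, ¬ G.Adj (f i) (f j)

section PartialTransversals

variable {V ι : Type*} [Fintype V] [Fintype ι] {G : SimpleGraph V} {part : V → ι} {d : ι → V}

theorem mem_partialTransversals {S : Finset ι} {f : ι → V} :
    f ∈ partialTransversals G part d S ↔ (∀ i, part (f i) = i) ∧ (∀ i, i ∉ S → f i = d i) ∧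
      ∀ i ∈ S, ∀ j ∈ S, ¬ G.Adj (f i) (f j) := by
  simp [partialTransversals]

open Classical in
/-- Resetting the choice at `j` to the default embeds the partial transversals through a given
vertex `u` of the block `j` into those of `S.erase j`. -/
theorem card_partialTransversals_through_le (hd : ∀ i, part (d i) = i) (S : Finset ι) (j : ι)
    (u : V) :
    ((partialTransversals G part d S).filter fun f => f j = u).card ≤
      (partialTransversals G part d (S.erase j)).card := by
  refine Finset.card_le_card_of_injOn (fun f => Function.update f j (d j)) ?_ ?_
  · intro f hf
    obtain ⟨hf, -⟩ := Finset.mem_filter.1 hf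
    obtain ⟨h1, h2, h3⟩ := mem_partialTransversals.1 hf
    refine mem_partialTransversals.2 ⟨fun i => ?_, fun i hi => ?_, fun i hi i' hi' => ?_⟩
    · by_cases h : i = j
      · subst h; simp [hd]
      · simp [h, h1]
    · by_cases h : i = j
      · subst h; simp
      · simpa [h] using h2 i fun hS => hi (Finset.mem_erase.2 ⟨h, hS⟩)
    · rw [Finset.mem_erase] at hi hi'
      simpa [hi.1, hi'.1] using h3 i hi.2 i' hi'.2
  · intro f hf g hg hfg
    have hf := (Finset.mem_filter.1 hf).2
    have hg := (Finset.mem_filter.1 hg).2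
    funext i
    by_cases h : i = j
    · subst h; rw [hf, hg]
    · simpa [h] using congrFun hfg i

open Classical in
/-- Pairs of a partial transversal on `S` and a vertex of a new block `i` that is not adjacent to
it yield distinct partial transversals on `insert i S`. -/
theorem card_extensions_le (S : Finset ι) {i : ι} (hi : i ∉ S) :
    (((partialTransversals G part d S) ×ˢ (Finset.univ.filter fun v => part v = i)).filter
      fun p => ¬ ∃ j ∈ S, G.Adj p.2 (p.1 j)).card ≤
      (partialTransversals G part d (insert i S)).card := by
  refine Finset.card_le_card_of_injOn (fun p => Function.update p.1 i p.2) ?_ ?_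
  · rintro ⟨f, v⟩ hp
    simp only [Finset.coe_filter, Finset.mem_product, Finset.mem_filter, Finset.mem_univ,
      true_and, Set.mem_ofPred_eq, not_exists, not_and] at hp
    obtain ⟨⟨hf, hv⟩, hadj⟩ := hp
    obtain ⟨h1, h2, h3⟩ := mem_partialTransversals.1 hf
    have hne : ∀ j ∈ S, j ≠ i := fun j hj h => hi (h ▸ hj)
    refine mem_partialTransversals.2 ⟨fun j => ?_, fun j hj => ?_, fun j hj j' hj' => ?_⟩
    · by_cases h : j = i
      · subst h; simp [hv]
      · simp [h, h1]
    · rw [Finset.mem_insert, not_or] at hj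
      simpa [hj.1] using h2 j hj.2
    · rcases Finset.mem_insert.1 hj with rfl | hjS <;>
        rcases Finset.mem_insert.1 hj' with rfl | hjS'
      · simp
      · simpa [hne j' hjS'] using hadj j' hjS'
      · simpa [hne j hjS, G.adj_comm] using hadj j hjS
      · simpa [hne j hjS, hne j' hjS'] using h3 j hjS j' hjS'
  · rintro ⟨f, v⟩ hp ⟨g, w⟩ hq hfg
    simp only [Finset.coe_filter, Finset.mem_product, Set.mem_ofPred_eq] at hp hq
    have hf := (mem_partialTransversals.1 hp.1.1).2.1 i hi
    have hg := (mem_partialTransversals.1 hq.1.1).2.1 i hi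
    refine Prod.ext (funext fun j => ?_) (by simpa using congrFun hfg i)
    by_cases h : j = i
    · subst h; exact hf.trans hg.symm
    · simpa [h] using congrFun hfg j

open Classical in
/-- Adding a block multiplies the number of partial transversals by at least `b / 2`. -/
theorem mul_card_partialTransversals_le {Δ b : ℕ} (hb0 : 0 < b)
    (hdeg : ∀ v : V, (G.neighborSet v).ncard ≤ Δ)
    (hblock : ∀ i, (Finset.univ.filter fun v => part v = i).card = b)
    (hb : 4 * Δ ≤ b) (hd : ∀ i, part (d i) = i) (S : Finset ι) {i : ι} (hi : i ∉ S) :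
    b * (partialTransversals G part d S).card ≤
      2 * (partialTransversals G part d (insert i S)).card := by
  induction S using Finset.strongInduction generalizing i with
  | H S ih =>
  set N := (partialTransversals G part d S).card with hN
  set B := Finset.univ.filter fun v => part v = i with hB
  have hsplit := Finset.card_filter_add_card_filter_not
    (s := partialTransversals G part d S ×ˢ B) (fun p => ∃ j ∈ S, G.Adj p.2 (p.1 j))
  rw [Finset.card_product, hblock i, ← hN] at hsplit
  have hgood := card_extensions_le (G := G) (part := part) (d := d) S hi
  rw [← hB] at hgood
  have hthrough : ∀ u, part u ∈ S →
      b * ((partialTransversals G part d S).filter fun f => f (part u) = u).card ≤ 2 * N := by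
    intro u hu
    have h := ih (S.erase (part u)) (Finset.erase_ssubset hu) (Finset.notMem_erase _ _)
    rw [Finset.insert_erase hu] at h
    exact (Nat.mul_le_mul_left b (card_partialTransversals_through_le hd S _ u)).trans h
  have hbad : b * ((partialTransversals G part d S ×ˢ B).filter
      fun p => ∃ j ∈ S, G.Adj p.2 (p.1 j)).card ≤ b * (Δ * (2 * N)) := by
    have hsub : (partialTransversals G part d S ×ˢ B).filter
        (fun p => ∃ j ∈ S, G.Adj p.2 (p.1 j)) ⊆
        B.biUnion fun v => ((G.neighborFinset v).filter fun u => part u ∈ S).biUnion fun u =>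
          ((partialTransversals G part d S).filter fun f => f (part u) = u) ×ˢ {v} := by
      rintro ⟨f, v⟩ hp
      obtain ⟨hp, j, hj, hadj⟩ := Finset.mem_filter.1 hp
      obtain ⟨hf, hv⟩ := Finset.mem_product.1 hp
      have hpart : part (f j) = j := (mem_partialTransversals.1 hf).1 j
      refine Finset.mem_biUnion.2 ⟨v, hv, Finset.mem_biUnion.2 ⟨f j, ?_, ?_⟩⟩
      · simpa [hpart, hj] using hadj
      · simpa [hpart] using hf
    calc _ ≤ b * ∑ v ∈ B, ∑ u ∈ (G.neighborFinset v).filter fun u => part u ∈ S,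
          ((partialTransversals G part d S).filter fun f => f (part u) = u).card := by
          gcongr
          refine (Finset.card_le_card hsub).trans (Finset.card_biUnion_le.trans ?_)
          refine Finset.sum_le_sum fun v _ => Finset.card_biUnion_le.trans ?_
          simp
      _ = ∑ v ∈ B, ∑ u ∈ (G.neighborFinset v).filter fun u => part u ∈ S,
          b * ((partialTransversals G part d S).filter fun f => f (part u) = u).card := by
          simp_rw [Finset.mul_sum]
      _ ≤ ∑ v ∈ B, Δ * (2 * N) := by
          refine Finset.sum_le_sum fun v _ => ?_
          refine (Finset.sum_le_card_nsmul _ _ (2 * N) fun u hu =>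
            hthrough u (Finset.mem_filter.1 hu).2).trans ?_
          rw [smul_eq_mul]
          refine Nat.mul_le_mul_right _ ((Finset.card_filter_le _ _).trans ?_)
          rw [← Set.ncard_coe_finset, SimpleGraph.coe_neighborFinset]
          exact hdeg v
      _ = b * (Δ * (2 * N)) := by rw [Finset.sum_const, hblock i, smul_eq_mul]
  have hbad := Nat.le_of_mul_le_mul_left hbad hb0
  have hΔ := Nat.mul_le_mul_right N hb
  linarith

theorem partialTransversals_nonempty {Δ b : ℕ} (hb0 : 0 < b)
    (hdeg : ∀ v : V, (G.neighborSet v).ncard ≤ Δ)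
    (hblock : ∀ i, Nat.card {v : V // part v = i} = b)
    (hb : 4 * Δ ≤ b) (hd : ∀ i, part (d i) = i) (S : Finset ι) :
    (partialTransversals G part d S).Nonempty := by
  classical
  induction S using Finset.induction_on with
  | empty => exact ⟨d, mem_partialTransversals.2 (by simp [hd])⟩
  | insert i S hi ih =>
    have h := mul_card_partialTransversals_le hb0 hdeg
      (fun i => by rw [← hblock i, Nat.card_eq_fintype_card, Fintype.card_subtype]) hb hd S hi
    have := Nat.mul_pos hb0 ih.card_pos
    exact Finset.card_pos.1 (by omega)

end PartialTransversals


/-- If the finite graph `G` has maximum degree at most `Δ` and its vertex set is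
partitioned into `k` blocks each of size exactly `b`, with `b ≥ 4Δ`, then `G` has
an independent transversal: one vertex from each block, forming an independent set.
(`0 < b` records that the blocks of the partition are nonempty.) -/
theorem independent_transversal_exists (V : Type*) [Fintype V] (G : SimpleGraph V)
    (Δ b k : ℕ) (hb0 : 0 < b)
    (hdeg : ∀ v : V, (G.neighborSet v).ncard ≤ Δ)
    (part : V → Fin k) (hblock : ∀ i : Fin k, Nat.card {v : V // part v = i} = b)
    (hb : b ≥ 4 * Δ) :
    ∃ f : Fin k → V, (∀ i, part (f i) = i) ∧
      ∀ i j : Fin k, i ≠ j → ¬ G.Adj (f i) (f j) := by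
  have hne : ∀ i, ∃ v, part v = i := fun i => by
    have : 0 < Nat.card {v : V // part v = i} := by rw [hblock i]; exact hb0
    obtain ⟨⟨v, hv⟩⟩ := (Nat.card_pos_iff.1 this).1
    exact ⟨v, hv⟩
  choose d hd using hne
  obtain ⟨f, hf⟩ := partialTransversals_nonempty hb0 hdeg hblock hb hd Finset.univ
  obtain ⟨h1, -, h3⟩ := mem_partialTransversals.1 hf
  exact ⟨f, h1, fun i j _ => h3 i (Finset.mem_univ i) j (Finset.mem_univ j)⟩
end

section
/- Let G be a finite graph of maximum degree at most Δ whose vertex set is partitioned into blocks V = V_1 ⊔ … ⊔ V_k, each block of size exactly b, and suppose b ≥ 4Δ. Then for every fixed vertex v of G there exists an independent transversal of G that includes v: there exist vertices v_1 ∈ V_1, …, v_k ∈ V_k forming an independent set of G with v ∈ {v_1, …, v_k}. -/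
namespace SimpleGraph

open Finset

open scoped Classical in
/-- The independent sets of `G` that meet each block with index in `S` in exactly one vertex and
meet no other block. -/
noncomputable def partialTransversals {V ι : Type*} [Fintype V] (G : SimpleGraph V) (part : V → ι)
    (S : Finset ι) : Finset (Finset V) :=
  {A | A.image part = S ∧ Set.InjOn part A ∧ ∀ x ∈ A, ∀ y ∈ A, ¬ G.Adj x y}

open scoped Classical in
/-- The partial transversals over `S` containing no neighbour of `w`. -/
noncomputable def partialTransversalsAvoiding {V ι : Type*} [Fintype V] (G : SimpleGraph V)
    (part : V → ι) (S : Finset ι) (w : V) : Finset (Finset V) :=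
  {A ∈ G.partialTransversals part S | ∀ u ∈ A, ¬ G.Adj w u}

section

variable {V ι : Type*} [Fintype V] {G : SimpleGraph V} {part : V → ι} {S : Finset ι}

open scoped Classical in
theorem mem_partialTransversals {A : Finset V} :
    A ∈ G.partialTransversals part S ↔
      A.image part = S ∧ Set.InjOn part A ∧ ∀ x ∈ A, ∀ y ∈ A, ¬ G.Adj x y := by
  simp [partialTransversals]

theorem mem_partialTransversalsAvoiding {A : Finset V} {w : V} :
    A ∈ G.partialTransversalsAvoiding part S w ↔
      A ∈ G.partialTransversals part S ∧ ∀ u ∈ A, ¬ G.Adj w u := by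
  simp [partialTransversalsAvoiding]

theorem part_mem_of_mem_partialTransversals {A : Finset V}
    (hA : A ∈ G.partialTransversals part S) {u : V} (hu : u ∈ A) : part u ∈ S := by
  classical
  rw [← (mem_partialTransversals.1 hA).1]
  exact mem_image_of_mem part hu

open scoped Classical in
theorem card_partialTransversals_filter_mem_le (u : V) :
    #{A ∈ G.partialTransversals part S | u ∈ A} ≤
      #(G.partialTransversals part (S.erase (part u))) := by
  refine card_le_card_of_injOn (fun A => A.erase u) ?_ ?_
  · intro A hA
    simp only [coe_filter, Set.mem_ofPred_eq] at hA
    obtain ⟨hA, hu⟩ := hA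
    obtain ⟨h1, h2, h3⟩ := mem_partialTransversals.1 hA
    refine mem_coe.2 (mem_partialTransversals.2 ⟨?_, ?_, ?_⟩)
    · ext i
      simp only [mem_image, mem_erase, ← h1]
      constructor
      · rintro ⟨x, ⟨hxu, hx⟩, rfl⟩
        exact ⟨fun h => hxu (h2 hx hu h), x, hx, rfl⟩
      · rintro ⟨hi, x, hx, rfl⟩
        exact ⟨x, ⟨fun h => hi (h ▸ rfl), hx⟩, rfl⟩
    · exact h2.mono (by simp)
    · exact fun x hx y hy => h3 x (mem_of_mem_erase hx) y (mem_of_mem_erase hy)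
  · intro A hA B hB h
    simp only [coe_filter, Set.mem_ofPred_eq] at hA hB
    rw [← insert_erase hA.2, ← insert_erase hB.2]
    exact congrArg (insert u) h

open scoped Classical in
theorem insert_mem_partialTransversals {A : Finset V} {w : V} (hw : part w ∉ S)
    (hA : A ∈ G.partialTransversalsAvoiding part S w) :
    insert w A ∈ G.partialTransversals part (insert (part w) S) := by
  obtain ⟨hA, hadj⟩ := mem_partialTransversalsAvoiding.1 hA
  obtain ⟨h1, h2, h3⟩ := mem_partialTransversals.1 hA
  have hpart : ∀ x ∈ A, part x ≠ part w := fun x hx h =>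
    hw (h ▸ part_mem_of_mem_partialTransversals hA hx)
  refine mem_partialTransversals.2 ⟨by rw [image_insert, h1], ?_, ?_⟩
  · intro x hx y hy hxy
    rcases mem_insert.1 (mem_coe.1 hx) with rfl | hxA <;>
      rcases mem_insert.1 (mem_coe.1 hy) with rfl | hyA
    · rfl
    · exact (hpart y hyA hxy.symm).elim
    · exact (hpart x hxA hxy).elim
    · exact h2 hxA hyA hxy
  · intro x hx y hy
    rcases mem_insert.1 hx with rfl | hxA <;> rcases mem_insert.1 hy with rfl | hyA
    · exact G.irrefl
    · exact hadj y hyA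
    · exact fun h => hadj x hxA h.symm
    · exact h3 x hxA y hyA

open scoped Classical in
theorem sum_card_partialTransversalsAvoiding_le {i : ι} (hi : i ∉ S) :
    ∑ w with part w = i, #(G.partialTransversalsAvoiding part S w) ≤
      #(G.partialTransversals part (insert i S)) := by
  rw [← card_sigma]
  refine card_le_card_of_injOn (fun p => insert p.1 p.2) ?_ ?_
  · rintro ⟨w, A⟩ h
    simp only [coe_sigma, Set.mem_sigma_iff, mem_coe, mem_filter_univ] at h
    obtain ⟨rfl, hA⟩ := h
    exact insert_mem_partialTransversals hi hA
  · rintro ⟨w, A⟩ h ⟨w', B⟩ h' heq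
    simp only [coe_sigma, Set.mem_sigma_iff, mem_coe, mem_filter_univ] at h h' heq
    obtain ⟨rfl, hA⟩ := h
    obtain ⟨hw', hB⟩ := h'
    have hwA : w ∉ A := fun h =>
      hi (part_mem_of_mem_partialTransversals (mem_partialTransversalsAvoiding.1 hA).1 h)
    have hwB : w ∉ B := fun h =>
      hi (part_mem_of_mem_partialTransversals (mem_partialTransversalsAvoiding.1 hB).1 h)
    obtain rfl : w = w' :=
      (mem_insert.1 (heq ▸ mem_insert_self w A)).resolve_right hwB
    rw [← erase_insert hwA, heq, erase_insert hwB]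

theorem card_partialTransversals_le_two_mul_avoiding {Δ b : ℕ} [DecidableEq ι]
    (hdeg : ∀ v : V, (G.neighborSet v).ncard ≤ Δ) (hb : 4 * Δ ≤ b) (hpos : 0 < b)
    (h : ∀ i ∈ S, b * #(G.partialTransversals part (S.erase i)) ≤
      2 * #(G.partialTransversals part S)) (w : V) :
    #(G.partialTransversals part S) ≤ 2 * #(G.partialTransversalsAvoiding part S w) := by
  classical
  set T := #(G.partialTransversals part S) with hT
  set bad := {A ∈ G.partialTransversals part S | ¬ ∀ u ∈ A, ¬ G.Adj w u} with hbad
  have hsplit : #(G.partialTransversalsAvoiding part S w) + #bad = T := by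
    rw [partialTransversalsAvoiding]
    exact card_filter_add_card_filter_not _
  have hle : #bad ≤
      ∑ u ∈ G.neighborFinset w, #{A ∈ G.partialTransversals part S | u ∈ A} := by
    refine (card_le_card fun A hA => ?_).trans card_biUnion_le
    simp only [hbad, mem_filter, not_forall, not_not] at hA
    obtain ⟨hA, u, hu, huw⟩ := hA
    exact mem_biUnion.2 ⟨u, by simpa using huw, mem_filter.2 ⟨hA, hu⟩⟩
  have hterm : ∀ u : V, b * #{A ∈ G.partialTransversals part S | u ∈ A} ≤ 2 * T := by
    intro u
    by_cases hu : part u ∈ S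
    · refine (Nat.mul_le_mul_left b ?_).trans (h _ hu)
      convert card_partialTransversals_filter_mem_le (G := G) (part := part) (S := S) u
    · rw [filter_eq_empty_iff.2 fun A hA hA' =>
        hu (part_mem_of_mem_partialTransversals hA hA')]
      simp
  have hcard : #(G.neighborFinset w) ≤ Δ := by
    have := hdeg w
    rwa [Set.ncard_eq_toFinset_card'] at this
  have hsum : b * #bad ≤ Δ * (2 * T) := calc
    b * #bad ≤ ∑ u ∈ G.neighborFinset w, b * #{A ∈ G.partialTransversals part S | u ∈ A} := by
      rw [← mul_sum]
      exact Nat.mul_le_mul_left b hle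
    _ ≤ #(G.neighborFinset w) * (2 * T) := by
      simpa only [smul_eq_mul] using sum_le_card_nsmul _ _ _ fun u _ => hterm u
    _ ≤ Δ * (2 * T) := Nat.mul_le_mul_right _ hcard
  have hhalf : 2 * #bad ≤ T := by
    refine Nat.le_of_mul_le_mul_left ?_ hpos
    nlinarith [Nat.mul_le_mul_right T hb]
  lia

theorem mul_card_partialTransversals_le {Δ b : ℕ} [DecidableEq ι]
    (hdeg : ∀ v : V, (G.neighborSet v).ncard ≤ Δ)
    (hblock : ∀ i, Nat.card {v : V // part v = i} = b) (hb : 4 * Δ ≤ b) (hpos : 0 < b)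
    (S : Finset ι) : ∀ i ∉ S, b * #(G.partialTransversals part S) ≤
      2 * #(G.partialTransversals part (insert i S)) := by
  induction S using Finset.strongInduction with
  | H S ih =>
    intro i hi
    have hhalf := card_partialTransversals_le_two_mul_avoiding (part := part) (S := S)
      hdeg hb hpos fun j hj => by
        simpa only [insert_erase hj] using ih _ (erase_ssubset hj) j (notMem_erase j S)
    have hsum := sum_card_partialTransversalsAvoiding_le (G := G) (part := part) hi
    classical
    have hcard : #{w | part w = i} = b := by
      rw [← hblock i, Nat.card_eq_fintype_card, Fintype.card_subtype]
    calc b * #(G.partialTransversals part S)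
        = ∑ w with part w = i, #(G.partialTransversals part S) := by simp [hcard]
      _ ≤ ∑ w with part w = i, 2 * #(G.partialTransversalsAvoiding part S w) :=
          sum_le_sum fun w _ => hhalf w
      _ ≤ 2 * #(G.partialTransversals part (insert i S)) := by
          rw [← mul_sum]
          convert Nat.mul_le_mul_left 2 hsum

theorem card_partialTransversals_pos {Δ b : ℕ}
    (hdeg : ∀ v : V, (G.neighborSet v).ncard ≤ Δ)
    (hblock : ∀ i, Nat.card {v : V // part v = i} = b) (hb : 4 * Δ ≤ b) (hpos : 0 < b)
    (S : Finset ι) : 0 < #(G.partialTransversals part S) := by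
  classical
  induction S using Finset.induction_on with
  | empty => exact card_pos.2 ⟨∅, mem_partialTransversals.2 (by simp)⟩
  | insert i S hi ih =>
    have := mul_card_partialTransversals_le hdeg hblock hb hpos S i hi
    have := Nat.mul_pos hpos ih
    lia

end

end SimpleGraph


/-- If the finite graph `G` has maximum degree at most `Δ` and its vertex set is
partitioned into `k` blocks each of size exactly `b`, with `b ≥ 4Δ`, then for any
fixed vertex `v₀` there is an independent transversal of `G` containing `v₀`. -/
theorem independent_transversal_through_vertex (V : Type*) [Fintype V] (G : SimpleGraph V)
    (Δ b k : ℕ)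
    (hdeg : ∀ v : V, (G.neighborSet v).ncard ≤ Δ)
    (part : V → Fin k) (hblock : ∀ i : Fin k, Nat.card {v : V // part v = i} = b)
    (hb : b ≥ 4 * Δ) (v₀ : V) :
    ∃ f : Fin k → V, (∀ i, part (f i) = i) ∧
      (∀ i j : Fin k, i ≠ j → ¬ G.Adj (f i) (f j)) ∧
      (∃ i : Fin k, f i = v₀) := by
  have hpos : 0 < b := by
    rw [← hblock (part v₀)]
    have : Nonempty {v : V // part v = part v₀} := ⟨⟨v₀, rfl⟩⟩
    exact Nat.card_pos
  set S := Finset.univ.erase (part v₀) with hS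
  have hhalf := G.card_partialTransversals_le_two_mul_avoiding (part := part) (S := S)
    hdeg hb hpos (fun j hj => by
      simpa only [Finset.insert_erase hj] using
        SimpleGraph.mul_card_partialTransversals_le hdeg hblock hb hpos _ j
          (Finset.notMem_erase j S)) v₀
  have hT := SimpleGraph.card_partialTransversals_pos hdeg hblock hb hpos S
  obtain ⟨A, hA⟩ : (G.partialTransversalsAvoiding part S v₀).Nonempty :=
    Finset.card_pos.1 (by lia)
  classical
  obtain ⟨himage, hinj, hindep⟩ := SimpleGraph.mem_partialTransversals.1
    (SimpleGraph.insert_mem_partialTransversals (Finset.notMem_erase _ _) hA)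
  have hex : ∀ i, ∃ v ∈ insert v₀ A, part v = i := fun i => by
    refine Finset.mem_image.1 ?_
    convert (Finset.ext_iff.1 himage i).2 ?_
    by_cases h : i = part v₀ <;> simp [h]
  choose f hfA hf using hex
  exact ⟨f, hf, fun i j _ => hindep _ (hfA i) _ (hfA j), part v₀,
    hinj (hfA _) (Finset.mem_insert_self _ _) (hf _)⟩
end

section
/- Let G be a finite graph of maximum degree at most Δ whose vertex set is partitioned into blocks V = V_1 ⊔ … ⊔ V_k, each block of size exactly b. If b ≥ 5Δ, then G has a strong coloring: a proper vertex coloring χ : V → [b] whose restriction to each block V_i is a bijection onto [b]. -/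
/-- `f` picks one vertex from each `W i`, `i ∈ I`, with no edge of `G` between the picked vertices. -/
def IsIndepTransversal {V ι : Type*} (G : SimpleGraph V) (W : ι → Finset V) (I : Finset ι)
    (f : ι → V) : Prop :=
  (∀ i ∈ I, f i ∈ W i) ∧ ∀ i ∈ I, ∀ j ∈ I, i ≠ j → ¬ G.Adj (f i) (f j)

/-- A property of graphs that holds for `H₀ ≤ G` but fails for `G` is lost when some single
edge is added on the way from `H₀` to `G`. -/
theorem SimpleGraph.exists_critical_edge {V : Type*} [Finite V] (P : SimpleGraph V → Prop)
    {H₀ G : SimpleGraph V} (hle : H₀ ≤ G) (h₀ : P H₀) (hG : ¬ P G) :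
    ∃ H ≤ G, ¬ P H ∧ ∃ x y, H.Adj x y ∧ ¬ H₀.Adj x y ∧ P (H.deleteEdges {s(x, y)}) := by
  obtain ⟨H, ⟨hH₀, hHG, hPH⟩, hmin⟩ :=
    Set.Finite.exists_minimal (Set.toFinite {H : SimpleGraph V | H₀ ≤ H ∧ H ≤ G ∧ ¬ P H})
      ⟨G, hle, le_rfl, hG⟩
  refine ⟨H, hHG, hPH, ?_⟩
  have hne : ¬ H ≤ H₀ := fun h => hPH (le_antisymm h hH₀ ▸ h₀)
  rw [SimpleGraph.le_iff_adj] at hne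
  push Not at hne
  obtain ⟨x, y, hxy, hxy₀⟩ := hne
  refine ⟨x, y, hxy, hxy₀, ?_⟩
  by_contra hP
  have h₁ : H₀ ≤ H.deleteEdges {s(x, y)} := by
    intro a b hab
    rw [SimpleGraph.deleteEdges_adj]
    refine ⟨hH₀ hab, fun h => hxy₀ ?_⟩
    rw [Set.mem_singleton_iff] at h
    rw [← SimpleGraph.mem_edgeSet, ← h]
    exact hab
  have h₂ := hmin ⟨h₁, (SimpleGraph.deleteEdges_le _).trans hHG, hP⟩
    (SimpleGraph.deleteEdges_le _)
  have h₃ := h₂ hxy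
  simp [SimpleGraph.deleteEdges_adj] at h₃

/-- If `G` has no independent transversal, but some transversal has the pair `i`, `j` as its only
conflict, then the classes of some `S ∋ i, j` are totally dominated by `2 (|S| - 1)` vertices. -/
theorem exists_dominating_of_unique_conflict {V ι : Type*} [Finite V] (n : ℕ) :
    ∀ (G : SimpleGraph V) (W : ι → Finset V) (I : Finset ι) (f : ι → V) (i j : ι),
      I.card = n → (∀ a ∈ I, ∀ b ∈ I, ∀ v, v ∈ W a → v ∈ W b → a = b) →
      i ∈ I → j ∈ I → i ≠ j → (∀ a ∈ I, f a ∈ W a) →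
      (∀ a ∈ I, ∀ b ∈ I, a ≠ b → G.Adj (f a) (f b) → (a = i ∧ b = j) ∨ (a = j ∧ b = i)) →
      (¬ ∃ g, IsIndepTransversal G W I g) →
      ∃ S ⊆ I, i ∈ S ∧ j ∈ S ∧ ∃ D : Finset V, D.card + 2 ≤ 2 * S.card ∧
        ∀ s ∈ S, ∀ w ∈ W s, ∃ d ∈ D, G.Adj d w := by
  classical
  induction n with
  | zero =>
    intro G W I f i j hI _ hi
    rw [Finset.card_eq_zero] at hI
    simp [hI] at hi
  | succ n ih =>
    intro G W I f i j hI hdisj hi hj hij hf hconf hno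
    set x := f i with hx
    set y := f j with hy
    let W' : ι → Finset V := fun k =>
      (if k = i then W i ∪ W j else W k).filter (fun v => ¬ G.Adj x v ∧ ¬ G.Adj y v)
    have hW'x : ∀ k v, v ∈ W' k → ¬ G.Adj x v ∧ ¬ G.Adj y v := fun k v hv =>
      (Finset.mem_filter.1 hv).2
    have hW'i : ∀ v, v ∈ W' i ↔ (v ∈ W i ∨ v ∈ W j) ∧ ¬ G.Adj x v ∧ ¬ G.Adj y v := by
      intro v; simp [W']
    have hW'k : ∀ k, k ≠ i → ∀ v, v ∈ W' k ↔ v ∈ W k ∧ ¬ G.Adj x v ∧ ¬ G.Adj y v := by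
      intro k hk v; simp [W', hk]
    by_cases hemp : ∃ z, z ∈ W' i
    swap
    · refine ⟨{i, j}, ?_, by simp, by simp, {x, y}, ?_, ?_⟩
      · intro a ha
        simp only [Finset.mem_insert, Finset.mem_singleton] at ha
        rcases ha with rfl | rfl <;> assumption
      · rw [Finset.card_pair hij]
        have := Finset.card_le_two (a := x) (b := y)
        omega
      · intro s hs w hw
        by_contra hcon
        push Not at hcon
        refine hemp ⟨w, (hW'i w).2 ⟨?_, hcon x (by simp), hcon y (by simp)⟩⟩
        simp only [Finset.mem_insert, Finset.mem_singleton] at hs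
        rcases hs with rfl | rfl
        · exact Or.inl hw
        · exact Or.inr hw
    obtain ⟨z, hz⟩ := hemp
    have hmem : ∀ k ∈ I.erase j, k ∈ I ∧ k ≠ j := fun k hk =>
      ⟨Finset.mem_of_mem_erase hk, Finset.ne_of_mem_erase hk⟩
    have hno' : ¬ ∃ g, IsIndepTransversal G W' (I.erase j) g := by
      rintro ⟨g, hg, hgi⟩
      have hgW : ∀ k ∈ I, k ≠ j → k ≠ i → g k ∈ W k := fun k hk hkj hki =>
        ((hW'k k hki _).1 (hg k (Finset.mem_erase.2 ⟨hkj, hk⟩))).1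
      have hgx : ∀ k ∈ I, k ≠ j → ¬ G.Adj x (g k) ∧ ¬ G.Adj y (g k) := fun k hk hkj =>
        hW'x k _ (hg k (Finset.mem_erase.2 ⟨hkj, hk⟩))
      have hgg : ∀ a ∈ I, a ≠ j → ∀ b ∈ I, b ≠ j → a ≠ b → ¬ G.Adj (g a) (g b) :=
        fun a ha haj b hb hbj => hgi a (Finset.mem_erase.2 ⟨haj, ha⟩) b
          (Finset.mem_erase.2 ⟨hbj, hb⟩)
      have hgxi := hgx i hi hij
      rcases ((hW'i _).1 (hg i (Finset.mem_erase.2 ⟨hij, hi⟩))).1 with h | h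
      · refine hno ⟨fun k => if k = j then y else g k, ?_, ?_⟩
        · intro k hk
          by_cases hkj : k = j
          · subst hkj; simpa [hy] using hf k hk
          · by_cases hki : k = i
            · subst hki; simpa [hkj] using h
            · simpa [hkj] using hgW k hk hkj hki
        · intro a ha b hb hab hadj
          by_cases haj : a = j <;> by_cases hbj : b = j <;>
            simp only [haj, hbj, if_true, if_false] at hadj
          · exact hab (haj.trans hbj.symm)
          · exact (hgx b hb hbj).2 hadj
          · exact (hgx a ha haj).2 hadj.symm
          · exact hgg a ha haj b hb hbj hab hadj
      · refine hno ⟨fun k => if k = j then g i else if k = i then x else g k, ?_, ?_⟩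
        · intro k hk
          by_cases hkj : k = j
          · subst hkj; simpa using h
          · by_cases hki : k = i
            · subst hki; simpa [hkj, hx] using hf k hk
            · simpa [hkj, hki] using hgW k hk hkj hki
        · intro a ha b hb hab hadj
          have key : ∀ a ∈ I, ∀ b ∈ I, a ≠ b → a = j ∨ a = i →
              ¬ G.Adj (if a = j then g i else if a = i then x else g a)
                (if b = j then g i else if b = i then x else g b) := by
            intro a ha b hb hab h hadj
            rcases h with rfl | rfl
            · simp only [if_true, hab.symm, if_false] at hadj
              by_cases hbi : b = i
              · simp only [hbi, if_true] at hadj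
                exact hgxi.1 hadj.symm
              · simp only [hbi, if_false] at hadj
                exact hgg i hi hij b hb hab.symm (Ne.symm hbi) hadj
            · simp only [hij, if_true, if_false, hab.symm] at hadj
              by_cases hbj : b = j
              · simp only [hbj, if_true] at hadj
                exact hgxi.1 hadj
              · simp only [hbj, if_false] at hadj
                exact (hgx b hb hbj).1 hadj
          by_cases h₁ : a = j ∨ a = i
          · exact key a ha b hb hab h₁ hadj
          by_cases h₂ : b = j ∨ b = i
          · exact key b hb a ha hab.symm h₂ hadj.symm
          push Not at h₁ h₂
          simp only [h₁.1, h₁.2, h₂.1, h₂.2, if_false] at hadj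
          exact hgg a ha h₁.1 b hb h₂.1 hab hadj
    have hdisj' : ∀ a ∈ I.erase j, ∀ b ∈ I.erase j, ∀ v, v ∈ W' a → v ∈ W' b → a = b := by
      have key : ∀ b ∈ I.erase j, ∀ v, v ∈ W' i → v ∈ W' b → i = b := by
        intro b hb v hvi hvb
        by_contra hib
        have hvb' := ((hW'k b (Ne.symm hib) v).1 hvb).1
        rcases ((hW'i v).1 hvi).1 with h | h
        · exact hib (hdisj i hi b (hmem b hb).1 v h hvb')
        · exact (hmem b hb).2 (hdisj j hj b (hmem b hb).1 v h hvb').symm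
      intro a ha b hb v hva hvb
      by_cases hai : a = i
      · subst hai; exact key b hb v hva hvb
      by_cases hbi : b = i
      · subst hbi; exact (key a ha v hvb hva).symm
      exact hdisj a (hmem a ha).1 b (hmem b hb).1 v ((hW'k a hai v).1 hva).1
        ((hW'k b hbi v).1 hvb).1
    let H₀ : SimpleGraph V := G.deleteEdges {e | z ∈ e}
    have hH₀ : ∃ g, IsIndepTransversal H₀ W' (I.erase j) g := by
      refine ⟨fun k => if k = i then z else f k, ?_, ?_⟩
      · intro k hk
        obtain ⟨hkI, hkj⟩ := hmem k hk
        by_cases hki : k = i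
        · subst hki; simpa using hz
        · simp only [hki, if_false]
          refine (hW'k k hki _).2 ⟨hf k hkI, fun h => ?_, fun h => ?_⟩
          · rcases hconf i hi k hkI (Ne.symm hki) h with h | h
            · exact hkj h.2
            · exact hki h.2
          · rcases hconf j hj k hkI (Ne.symm hkj) h with h | h
            · exact hkj h.2
            · exact hki h.2
      · intro a ha b hb hab hadj
        simp only [H₀, SimpleGraph.deleteEdges_adj, Set.mem_ofPred_eq, Sym2.mem_iff, not_or] at hadj
        by_cases hai : a = i
        · simp [hai] at hadj
        by_cases hbi : b = i
        · simp [hbi] at hadj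
        simp only [hai, hbi, if_false] at hadj
        rcases hconf a (hmem a ha).1 b (hmem b hb).1 hab hadj.1 with h | h
        · exact hai h.1
        · exact hbi h.2
    obtain ⟨H, hHG, hnoH, p, q, hpq, hpq₀, g, hgW, hgi⟩ :=
      SimpleGraph.exists_critical_edge (fun H => ∃ g, IsIndepTransversal H W' (I.erase j) g)
        (SimpleGraph.deleteEdges_le _) hH₀ hno'
    have hzpq : z ∈ s(p, q) := by
      by_contra h
      exact hpq₀ (SimpleGraph.deleteEdges_adj.2 ⟨hHG hpq, h⟩)
    have hconfH : ∀ a ∈ I.erase j, ∀ b ∈ I.erase j, a ≠ b → H.Adj (g a) (g b) →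
        s(g a, g b) = s(p, q) := by
      intro a ha b hb hab hadj
      by_contra h
      exact hgi a ha b hb hab (SimpleGraph.deleteEdges_adj.2 ⟨hadj, h⟩)
    have hiI : i ∈ I.erase j := Finset.mem_erase.2 ⟨hij, hi⟩
    have hgz : ∀ a ∈ I.erase j, g a = z → a = i := fun a ha h =>
      hdisj' a ha i hiI z (h ▸ hgW a ha) hz
    have hone : ∀ a ∈ I.erase j, ∀ b ∈ I.erase j, a ≠ b → H.Adj (g a) (g b) →
        a = i ∨ b = i := by
      intro a ha b hb hab hadj
      rw [← hconfH a ha b hb hab hadj, Sym2.mem_iff] at hzpq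
      exact hzpq.imp (fun h => hgz a ha h.symm) (fun h => hgz b hb h.symm)
    obtain ⟨l, hl, hil, hadjl⟩ : ∃ l ∈ I.erase j, i ≠ l ∧ H.Adj (g i) (g l) := by
      by_contra hcon
      push Not at hcon
      refine hnoH ⟨g, hgW, fun a ha b hb hab hadj => ?_⟩
      rcases hone a ha b hb hab hadj with rfl | rfl
      · exact hcon b hb hab hadj
      · exact hcon a ha hab.symm hadj.symm
    have huniq : ∀ b ∈ I.erase j, i ≠ b → H.Adj (g i) (g b) → b = l := by
      intro b hb hib hadj
      have h := (hconfH i hiI b hb hib hadj).trans (hconfH i hiI l hl hil hadjl).symm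
      rw [Sym2.congr_right] at h
      exact hdisj' b hb l hl (g b) (hgW b hb) (h ▸ hgW l hl)
    obtain ⟨S, hSI, hiS, -, D, hD, hdom⟩ := ih H W' (I.erase j) g i l
      (by rw [Finset.card_erase_of_mem hj, hI]; rfl) hdisj' hiI hl hil hgW
      (by
        intro a ha b hb hab hadj
        rcases hone a ha b hb hab hadj with rfl | rfl
        · exact Or.inl ⟨rfl, huniq b hb hab hadj⟩
        · exact Or.inr ⟨huniq a ha hab.symm hadj.symm, rfl⟩) hnoH
    have hjS : j ∉ S := fun h => (hmem j (hSI h)).2 rfl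
    refine ⟨insert j S, ?_, Finset.mem_insert_of_mem hiS, Finset.mem_insert_self _ _,
      {x, y} ∪ D, ?_, ?_⟩
    · intro a ha
      rcases Finset.mem_insert.1 ha with rfl | h
      · exact hj
      · exact (hmem a (hSI h)).1
    · rw [Finset.card_insert_of_notMem hjS]
      have h₁ := Finset.card_union_le {x, y} D
      have h₂ := Finset.card_le_two (a := x) (b := y)
      omega
    · intro s hs w hw
      by_cases hxw : G.Adj x w
      · exact ⟨x, by simp, hxw⟩
      by_cases hyw : G.Adj y w
      · exact ⟨y, by simp, hyw⟩
      have : ∃ t ∈ S, w ∈ W' t := by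
        rcases Finset.mem_insert.1 hs with rfl | h
        · exact ⟨i, hiS, (hW'i w).2 ⟨Or.inr hw, hxw, hyw⟩⟩
        · by_cases hsi : s = i
          · subst hsi; exact ⟨s, hiS, (hW'i w).2 ⟨Or.inl hw, hxw, hyw⟩⟩
          · exact ⟨s, h, (hW'k s hsi w).2 ⟨hw, hxw, hyw⟩⟩
      obtain ⟨t, ht, hwt⟩ := this
      obtain ⟨d, hd, hdw⟩ := hdom t ht w hwt
      exact ⟨d, Finset.mem_union_right _ hd, hHG hdw⟩

/-- Haxell's theorem: disjoint classes of size at least `2Δ` in a graph of maximum degree at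
most `Δ` have an independent transversal. -/
theorem exists_isIndepTransversal {V ι : Type*} [Finite V] [Nonempty V] (G : SimpleGraph V)
    (W : ι → Finset V) (I : Finset ι) (Δ : ℕ) (hΔ : 0 < Δ)
    (hdeg : ∀ v, (G.neighborSet v).ncard ≤ Δ)
    (hdisj : ∀ a ∈ I, ∀ b ∈ I, ∀ v, v ∈ W a → v ∈ W b → a = b)
    (hW : ∀ i ∈ I, 2 * Δ ≤ (W i).card) :
    ∃ f, IsIndepTransversal G W I f := by
  classical
  have := Fintype.ofFinite V
  by_contra hno
  have hbot : ∃ g, IsIndepTransversal (⊥ : SimpleGraph V) W I g := by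
    have hne : ∀ i, ∃ v, i ∈ I → v ∈ W i := by
      intro i
      by_cases hi : i ∈ I
      · obtain ⟨v, hv⟩ := Finset.card_pos.1 (lt_of_lt_of_le (by omega) (hW i hi))
        exact ⟨v, fun _ => hv⟩
      · exact ⟨Classical.arbitrary V, fun h => absurd h hi⟩
    choose g hg using hne
    exact ⟨g, hg, fun _ _ _ _ _ h => h⟩
  obtain ⟨H, hHG, hnoH, p, q, hpq, -, g, hgW, hgi⟩ :=
    SimpleGraph.exists_critical_edge (fun H => ∃ g, IsIndepTransversal H W I g) bot_le hbot hno
  have hconf : ∀ a ∈ I, ∀ b ∈ I, a ≠ b → H.Adj (g a) (g b) → s(g a, g b) = s(p, q) := by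
    intro a ha b hb hab hadj
    by_contra h
    exact hgi a ha b hb hab (SimpleGraph.deleteEdges_adj.2 ⟨hadj, h⟩)
  obtain ⟨i, hi, j, hj, hij, hadj⟩ :
      ∃ i ∈ I, ∃ j ∈ I, i ≠ j ∧ H.Adj (g i) (g j) := by
    by_contra hcon
    push Not at hcon
    exact hnoH ⟨g, hgW, hcon⟩
  have hinj : ∀ a ∈ I, ∀ b ∈ I, g a = g b → a = b := fun a ha b hb h =>
    hdisj a ha b hb (g a) (hgW a ha) (h ▸ hgW b hb)
  obtain ⟨S, hSI, hiS, -, D, hD, hdom⟩ := exists_dominating_of_unique_conflict I.card H W I g i j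
    rfl hdisj hi hj hij hgW (by
      intro a ha b hb hab hadj'
      have h := (hconf a ha b hb hab hadj').trans (hconf i hi j hj hij hadj).symm
      rw [Sym2.eq_iff] at h
      exact h.imp (fun h => ⟨hinj a ha i hi h.1, hinj b hb j hj h.2⟩)
        (fun h => ⟨hinj a ha j hj h.1, hinj b hb i hi h.2⟩)) hnoH
  have h₁ : S.card * (2 * Δ) ≤ (S.biUnion W).card := by
    rw [Finset.card_biUnion]
    · rw [← smul_eq_mul]
      exact Finset.card_nsmul_le_sum _ _ _ fun s hs => hW s (hSI hs)
    · intro a ha b hb hab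
      refine Finset.disjoint_left.2 ?_
      exact fun v hva hvb => hab (hdisj a (hSI ha) b (hSI hb) v hva hvb)
  have h₂ : S.biUnion W ⊆ D.biUnion fun d => (G.neighborSet d).toFinset := by
    intro w hw
    obtain ⟨s, hs, hws⟩ := Finset.mem_biUnion.1 hw
    obtain ⟨d, hd, hdw⟩ := hdom s hs w hws
    exact Finset.mem_biUnion.2 ⟨d, hd, by simpa using hHG hdw⟩
  have h₃ : (D.biUnion fun d => (G.neighborSet d).toFinset).card ≤ D.card * Δ :=
    Finset.card_biUnion_le_card_mul _ _ _ fun d _ => by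
      rw [← Set.ncard_eq_toFinset_card']; exact hdeg d
  have h₄ := h₁.trans ((Finset.card_le_card h₂).trans h₃)
  have h₅ : (D.card + 2) * Δ ≤ 2 * S.card * Δ := Nat.mul_le_mul_right _ hD
  nlinarith

/-- `χ` is a proper coloring of `G` that is bijective on every fibre of `part`. -/
def IsStrongColoring {V ι C : Type*} (G : SimpleGraph V) (part : V → ι) (χ : V → C) : Prop :=
  (∀ u w : V, G.Adj u w → χ u ≠ χ w) ∧ ∀ (i : ι) (c : C), ∃! v : V, part v = i ∧ χ v = c

/-- With blocks of size at least `4Δ`, a strong coloring survives the insertion of an edge. -/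
theorem exists_isStrongColoring_of_deleteEdge {V ι C : Type*} [Finite V] [Finite ι]
    (G : SimpleGraph V) (part : V → ι) (Δ : ℕ)
    (hdeg : ∀ v : V, (G.neighborSet v).ncard ≤ Δ)
    (hblock : ∀ i, 4 * Δ ≤ Nat.card {v : V // part v = i})
    {x y : V} (hxy : G.Adj x y) {χ : V → C}
    (hχ : IsStrongColoring (G.deleteEdges {s(x, y)}) part χ) :
    ∃ χ' : V → C, IsStrongColoring G part χ' := by
  classical
  have := Fintype.ofFinite V
  have := Fintype.ofFinite ι
  obtain ⟨hproper, hbij⟩ := hχ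
  have hinj : ∀ u v, part u = part v → χ u = χ v → u = v := fun u v hp hc =>
    (hbij (part v) (χ v)).unique ⟨hp, hc⟩ ⟨rfl, rfl⟩
  have hprop : ∀ u w, G.Adj u w → χ u = χ w → s(u, w) = s(x, y) := by
    intro u w hadj hc
    by_contra h
    exact hproper u w (SimpleGraph.deleteEdges_adj.2 ⟨hadj, h⟩) hc
  have hΔ : 0 < Δ := lt_of_lt_of_le
    ((Set.ncard_pos (Set.toFinite _)).2 ⟨y, hxy⟩) (hdeg x)
  by_cases hc : χ x = χ y
  swap
  · refine ⟨χ, fun u w hadj h => ?_, hbij⟩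
    rcases Sym2.eq_iff.1 (hprop u w hadj h) with ⟨rfl, rfl⟩ | ⟨rfl, rfl⟩
    · exact hc h
    · exact hc h.symm
  choose w hw using fun i => (hbij i (χ x)).exists
  have hwuniq : ∀ v, χ v = χ x → v = w (part v) := fun v hv =>
    hinj _ _ (hw (part v)).1.symm (hv.trans (hw (part v)).2.symm)
  let W : ι → Finset V := fun i => Finset.univ.filter fun u =>
    part u = i ∧ ¬ G.Adj x u ∧ ∀ v, G.Adj (w i) v → χ v ≠ χ u
  have hWmem : ∀ i u, u ∈ W i ↔ part u = i ∧ ¬ G.Adj x u ∧ ∀ v, G.Adj (w i) v → χ v ≠ χ u := by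
    intro i u; simp [W]
  have hWcard : ∀ i, 2 * Δ ≤ (W i).card := by
    intro i
    let B : Finset V := Finset.univ.filter fun u => part u = i
    let R : Finset V := B.filter fun u => ∃ v, G.Adj (w i) v ∧ χ v = χ u
    have hB : 4 * Δ ≤ B.card := by
      have := hblock i
      rwa [Nat.card_eq_fintype_card, Fintype.card_subtype] at this
    have hN : ∀ v, (G.neighborSet v).toFinset.card ≤ Δ := fun v => by
      rw [← Set.ncard_eq_toFinset_card']; exact hdeg v
    have hR : R.card ≤ Δ := by
      have hinjR : Set.InjOn χ (R : Set V) := by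
        intro u hu v hv h
        have hu' : part u = i := by simp [R, B] at hu; exact hu.1
        have hv' : part v = i := by simp [R, B] at hv; exact hv.1
        exact hinj u v (hu'.trans hv'.symm) h
      rw [← Finset.card_image_of_injOn hinjR]
      refine le_trans (Finset.card_le_card ?_)
        ((Finset.card_image_le (s := (G.neighborSet (w i)).toFinset) (f := χ)).trans (hN _))
      intro c hc
      obtain ⟨u, hu, rfl⟩ := Finset.mem_image.1 hc
      obtain ⟨v, hv, hvu⟩ := (Finset.mem_filter.1 hu).2
      exact Finset.mem_image.2 ⟨v, by simpa using hv, hvu⟩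
    have hsub : B ⊆ W i ∪ ((G.neighborSet x).toFinset ∪ R) := by
      intro u hu
      by_cases h₁ : G.Adj x u
      · simp [h₁]
      by_cases h₂ : ∃ v, G.Adj (w i) v ∧ χ v = χ u
      · simp only [Finset.mem_union]
        exact Or.inr (Or.inr (Finset.mem_filter.2 ⟨hu, h₂⟩))
      · push Not at h₂
        exact Finset.mem_union_left _ ((hWmem i u).2 ⟨(Finset.mem_filter.1 hu).2, h₁, h₂⟩)
    have h₁ := Finset.card_le_card hsub
    have h₂ := Finset.card_union_le (W i) ((G.neighborSet x).toFinset ∪ R)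
    have h₃ := Finset.card_union_le (G.neighborSet x).toFinset R
    have h₄ := hN x
    omega
  have : Nonempty V := ⟨x⟩
  obtain ⟨f, hfW, hfi⟩ := exists_isIndepTransversal G W (Finset.univ.erase (part x)) Δ hΔ hdeg
    (fun a _ b _ v hva hvb => ((hWmem a v).1 hva).1.symm.trans ((hWmem b v).1 hvb).1)
    (fun i _ => hWcard i)
  have hfW' : ∀ i, i ≠ part x → f i ∈ W i := fun i hi => hfW i (by simp [hi])
  let u : ι → V := fun i => if i = part x then x else f i
  have hux : u (part x) = x := by simp [u]
  have huf : ∀ i, i ≠ part x → u i = f i := fun i hi => by simp [u, hi]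
  have hup : ∀ i, part (u i) = i := by
    intro i
    by_cases hi : i = part x
    · rw [hi, hux]
    · rw [huf i hi]; exact ((hWmem i _).1 (hfW' i hi)).1
  have huindep : ∀ i j, i ≠ j → ¬ G.Adj (u i) (u j) := by
    intro i j hij hadj
    by_cases hi : i = part x
    · have hj : j ≠ part x := fun h => hij (hi.trans h.symm)
      rw [hi, hux, huf j hj] at hadj
      exact ((hWmem j _).1 (hfW' j hj)).2.1 hadj
    by_cases hj : j = part x
    · rw [hj, hux, huf i hi] at hadj
      exact ((hWmem i _).1 (hfW' i hi)).2.1 hadj.symm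
    rw [huf i hi, huf j hj] at hadj
    exact hfi i (by simp [hi]) j (by simp [hj]) hij hadj
  let σ : ι → Equiv.Perm C := fun i => Equiv.swap (χ x) (χ (u i))
  have hσx : σ (part x) = 1 := by
    simp only [σ, hux]
    exact Equiv.swap_self _
  have hσc : ∀ v, σ (part v) (χ v) = χ x → v = u (part v) := by
    intro v hv
    rw [Equiv.swap_apply_eq_iff, Equiv.swap_apply_left] at hv
    exact hinj _ _ (hup _).symm hv
  have hσd : ∀ v, σ (part v) (χ v) ≠ χ x → χ v ≠ χ x → σ (part v) (χ v) = χ v := by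
    intro v h₁ h₂
    refine Equiv.swap_apply_of_ne_of_ne h₂ fun h => h₁ ?_
    rw [h]; exact Equiv.swap_apply_right _ _
  have hcross : ∀ v v', G.Adj v v' → χ v = χ x → χ v' ≠ χ x →
      σ (part v) (χ v) = σ (part v') (χ v') → σ (part v) (χ v) ≠ χ x → False := by
    intro v v' hadj hv hv' heq hne
    rw [hσd v' (heq ▸ hne) hv'] at heq
    have hpx : part v ≠ part x := by
      intro h
      rw [h, hσx] at hne
      exact hne hv
    have huv : σ (part v) (χ v) = χ (u (part v)) := by
      rw [hv]; exact Equiv.swap_apply_left _ _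
    rw [huf _ hpx] at huv
    rw [hwuniq v hv] at hadj
    exact ((hWmem _ _).1 (hfW' _ hpx)).2.2 v' hadj (heq.symm.trans huv)
  refine ⟨fun v => σ (part v) (χ v), ?_, ?_⟩
  · intro v v' hadj heq
    simp only at heq
    by_cases hd : σ (part v) (χ v) = χ x
    · have hv := hσc v hd
      have hv' := hσc v' (heq ▸ hd)
      by_cases hp : part v = part v'
      · rw [hp] at hv
        exact hadj.ne (hv.trans hv'.symm)
      · rw [hv, hv'] at hadj
        exact huindep _ _ hp hadj
    have hd' : σ (part v') (χ v') ≠ χ x := heq ▸ hd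
    by_cases h₁ : χ v = χ x <;> by_cases h₂ : χ v' = χ x
    · rcases Sym2.eq_iff.1 (hprop v v' hadj (h₁.trans h₂.symm)) with ⟨rfl, rfl⟩ | ⟨rfl, rfl⟩
      · rw [hσx] at hd; exact hd rfl
      · rw [hσx] at hd'; exact hd' rfl
    · exact hcross v v' hadj h₁ h₂ heq hd
    · exact hcross v' v hadj.symm h₂ h₁ heq.symm hd'
    · rw [hσd v hd h₁, hσd v' hd' h₂] at heq
      rcases Sym2.eq_iff.1 (hprop v v' hadj heq) with ⟨rfl, rfl⟩ | ⟨rfl, rfl⟩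
      · exact h₁ rfl
      · exact h₂ rfl
  · intro i c
    obtain ⟨v, ⟨hv, hvc⟩, huniq⟩ := hbij i ((σ i).symm c)
    refine ⟨v, ⟨hv, ?_⟩, ?_⟩
    · simp only [hv, hvc, Equiv.apply_symm_apply]
    · rintro v' ⟨hv', hvc'⟩
      refine huniq v' ⟨hv', ?_⟩
      simp only [hv'] at hvc'
      rw [← hvc', Equiv.symm_apply_apply]

/-- If the finite graph `G` has maximum degree at most `Δ` and its vertex set is
partitioned into `k` blocks each of size exactly `b`, with `b ≥ 5Δ`, then `G` has a
strong coloring: a proper coloring `χ : V → [b]` in which, within each block, every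
color appears exactly once. -/
theorem strong_coloring_exists_5Delta (V : Type*) [Fintype V] (G : SimpleGraph V)
    (Δ b k : ℕ)
    (hdeg : ∀ v : V, (G.neighborSet v).ncard ≤ Δ)
    (part : V → Fin k) (hblock : ∀ i : Fin k, Nat.card {v : V // part v = i} = b)
    (hb : b ≥ 5 * Δ) :
    ∃ χ : V → Fin b, (∀ u w : V, G.Adj u w → χ u ≠ χ w) ∧
      ∀ (i : Fin k) (c : Fin b), ∃! v : V, part v = i ∧ χ v = c := by
  by_contra hno
  have hbot : ∃ χ : V → Fin b, IsStrongColoring (⊥ : SimpleGraph V) part χ := by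
    let e : ∀ i, {v : V // part v = i} ≃ Fin b := fun i => Finite.equivFinOfCardEq (hblock i)
    refine ⟨fun v => e (part v) ⟨v, rfl⟩, fun _ _ h => h.elim, fun i c => ?_⟩
    refine ⟨(e i).symm c, ⟨((e i).symm c).2, ?_⟩, ?_⟩
    · have key : ∀ (v : V) (h : part v = i), e (part v) ⟨v, rfl⟩ = e i ⟨v, h⟩ := by
        rintro v rfl; rfl
      exact (key _ ((e i).symm c).2).trans (by simp)
    · rintro v ⟨rfl, rfl⟩
      simp
  obtain ⟨H, hHG, hnoH, x, y, hxy, -, χ, hχ⟩ := SimpleGraph.exists_critical_edge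
    (fun H => ∃ χ : V → Fin b, IsStrongColoring H part χ) bot_le hbot hno
  refine hnoH (exists_isStrongColoring_of_deleteEdge H part Δ (fun v => ?_) (fun i => ?_) hxy hχ)
  · exact (Set.ncard_le_ncard (fun w hw => hHG hw) (Set.toFinite _)).trans (hdeg v)
  · rw [hblock i]; omega
end
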